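/- Let G be a finitely generated group and suppose that for some n ≥ 2 there exists a group homomorphism ρ : G → GL_n(ℂ) whose image ρ(G) is not virtually nilpotent. Then G has uniformly exponential growth, i.e., ω(G) = inf_S ω(G,S) > 1. -/

import Mathlib

open Filter

variable {G : Type*} [Group G]

noncomputable def wordLength (S : Set G) (g : G) : ℕ :=
  sInf {k | ∃ w : List G, w.length = k ∧ (∀ x ∈ w, x ∈ S ∨ x⁻¹ ∈ S) ∧ w.prod = g}

noncomputable def ballCard (S : Set G) (n : ℕ) : ℕ :=
  Set.ncard {g : G | wordLength S g ≤ n}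

noncomputable def growthRate (S : Set G) : ℝ :=
  limUnder atTop (fun n : ℕ => (ballCard S n : ℝ) ^ ((n : ℝ)⁻¹))

noncomputable def minGrowth (G : Type*) [Group G] : ℝ :=
  sInf {x : ℝ | ∃ S : Finset G, Subgroup.closure (S : Set G) = ⊤ ∧ growthRate (S : Set G) = x}

namespace UG
open Filter
def InBall {G : Type*} [Group G] (S : Set G) (m : ℕ) (g : G) : Prop :=
  ∃ w : List G, w.length ≤ m ∧ (∀ x ∈ w, x ∈ S ∨ x⁻¹ ∈ S) ∧ w.prod = g

def wd {M : Type*} [Monoid M] (a b : M) (l : List Bool) : M :=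
  (l.map (fun c => cond c a b)).prod

def FreePair {M : Type*} [Monoid M] (a b : M) : Prop :=
  ∀ u u' : List Bool, u.length = u'.length → a * wd a b u ≠ b * wd a b u'

section
variable {G : Type*} [Group G]

lemma InBall.one (S : Set G) (m : ℕ) : InBall S m 1 := ⟨[], by simp, by simp, by simp⟩

lemma InBall.mul {S : Set G} {m n : ℕ} {g h : G} (hg : InBall S m g) (hh : InBall S n h) :
    InBall S (m + n) (g * h) := by
  obtain ⟨w, h1, h2, h3⟩ := hg
  obtain ⟨w', h1', h2', h3'⟩ := hh
  refine ⟨w ++ w', by simp; omega, ?_, by simp [h3, h3']⟩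
  intro x hx
  rcases List.mem_append.1 hx with hx | hx
  · exact h2 x hx
  · exact h2' x hx

lemma InBall.mono {S : Set G} {m n : ℕ} {g : G} (hg : InBall S m g) (h : m ≤ n) :
    InBall S n g := by
  obtain ⟨w, h1, h2, h3⟩ := hg
  exact ⟨w, h1.trans h, h2, h3⟩

lemma InBall.inv {S : Set G} {m : ℕ} {g : G} (hg : InBall S m g) : InBall S m g⁻¹ := by
  obtain ⟨w, h1, h2, h3⟩ := hg
  refine ⟨(w.map (·⁻¹)).reverse, by simpa using h1, ?_, ?_⟩
  · intro x hx
    simp only [List.mem_reverse, List.mem_map] at hx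
    obtain ⟨y, hy, rfl⟩ := hx
    have := h2 y hy
    simpa using this.symm
  · rw [← h3, List.prod_inv_reverse]

lemma InBall.of_mem {S : Set G} {g : G} (hg : g ∈ S) : InBall S 1 g :=
  ⟨[g], by simp, by simp [hg], by simp⟩

lemma InBall.pow {S : Set G} {m : ℕ} {g : G} (hg : InBall S m g) (k : ℕ) :
    InBall S (m * k) (g ^ k) := by
  induction k with
  | zero => simpa using InBall.one S 0
  | succ k ih => rw [pow_succ, Nat.mul_succ]; exact ih.mul hg

lemma InBall.list_prod {S : Set G} {m : ℕ} (l : List G) (h : ∀ x ∈ l, InBall S m x) :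
    InBall S (m * l.length) l.prod := by
  induction l with
  | nil => simpa using InBall.one S 0
  | cons a l ih =>
    rw [List.prod_cons, List.length_cons, Nat.mul_succ, add_comm]
    exact (h a (by simp)).mul (ih fun x hx => h x (by simp [hx]))

lemma InBall.trans {S T : Set G} {m n : ℕ} {g : G} (hT : ∀ t ∈ T, InBall S m t)
    (hg : InBall T n g) : InBall S (m * n) g := by
  obtain ⟨w, h1, h2, h3⟩ := hg
  have := InBall.list_prod (S := S) (m := m) w (fun x hx => by
    rcases h2 x hx with h | h
    · exact hT x h
    · simpa using (hT _ h).inv)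
  rw [h3] at this
  exact this.mono (Nat.mul_le_mul_left _ h1)

lemma InBall.map {G' : Type*} [Group G'] (f : G →* G') {S : Set G} {m : ℕ} {g : G}
    (hg : InBall S m g) : InBall (f '' S) m (f g) := by
  obtain ⟨w, h1, h2, h3⟩ := hg
  refine ⟨w.map f, by simpa using h1, ?_, by rw [← h3, map_list_prod]⟩
  intro x hx
  obtain ⟨y, hy, rfl⟩ := List.mem_map.1 hx
  rcases h2 y hy with h | h
  · exact Or.inl ⟨y, h, rfl⟩
  · exact Or.inr ⟨y⁻¹, h, by simp⟩

lemma exists_inBall {S : Set G} (hS : Subgroup.closure S = ⊤) (g : G) :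
    ∃ m, InBall S m g := by
  have hg : g ∈ Subgroup.closure S := by rw [hS]; trivial
  induction hg using Subgroup.closure_induction with
  | mem x hx => exact ⟨1, .of_mem hx⟩
  | one => exact ⟨0, .one S 0⟩
  | mul x y _ _ hx hy =>
    obtain ⟨m, hm⟩ := hx
    obtain ⟨n, hn⟩ := hy
    exact ⟨m + n, hm.mul hn⟩
  | inv x _ hx =>
    obtain ⟨m, hm⟩ := hx
    exact ⟨m, hm.inv⟩

lemma wordLength_le_iff {S : Set G} (hS : Subgroup.closure S = ⊤) (g : G) (m : ℕ) :
    wordLength S g ≤ m ↔ InBall S m g := by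
  constructor
  · intro h
    obtain ⟨k, w, h1, h2, h3⟩ := exists_inBall hS g
    have hne : {k | ∃ w : List G, w.length = k ∧ (∀ x ∈ w, x ∈ S ∨ x⁻¹ ∈ S) ∧ w.prod = g}.Nonempty :=
      ⟨_, w, rfl, h2, h3⟩
    obtain ⟨w, h1, h2, h3⟩ := Nat.sInf_mem hne
    exact ⟨w, h1.le.trans h, h2, h3⟩
  · rintro ⟨w, h1, h2, h3⟩
    have hle : wordLength S g ≤ w.length := Nat.sInf_le ⟨w, rfl, h2, h3⟩
    exact hle.trans h1

lemma finite_ball (S : Finset G) (m : ℕ) : {g : G | InBall (S : Set G) m g}.Finite := by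
  induction m with
  | zero =>
    refine (Set.finite_singleton (1 : G)).subset ?_
    rintro g ⟨w, h1, -, h3⟩
    simp at h1
    subst h1
    simpa using h3.symm
  | succ m ih =>
    have hT : {x : G | x ∈ S ∨ x⁻¹ ∈ S}.Finite := by
      refine (S.finite_toSet.union (S.finite_toSet.image (·⁻¹))).subset ?_
      rintro x (hx | hx)
      · exact Or.inl hx
      · exact Or.inr ⟨x⁻¹, hx, by simp⟩
    refine (((hT.union (Set.finite_singleton 1)).image2 (fun x y => x * y) ih)).subset ?_
    rintro g ⟨w, h1, h2, h3⟩
    cases w with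
    | nil => exact ⟨1, by simp, 1, .one _ _, by simpa using h3⟩
    | cons a w =>
      refine ⟨a, Or.inl (h2 a (by simp)), w.prod, ⟨w, by simpa using h1, fun x hx => h2 x (by simp [hx]), rfl⟩, by simpa using h3⟩

lemma ballCard_eq {S : Finset G} (hS : Subgroup.closure (S : Set G) = ⊤) (m : ℕ) :
    ballCard (S : Set G) m = {g : G | InBall (S : Set G) m g}.ncard := by
  unfold ballCard
  congr 1
  ext g
  exact wordLength_le_iff hS g m

lemma ballCard_pos {S : Finset G} (hS : Subgroup.closure (S : Set G) = ⊤) (m : ℕ) :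
    0 < ballCard (S : Set G) m := by
  rw [ballCard_eq hS, Set.ncard_pos (finite_ball S m)]
  exact ⟨1, .one _ _⟩

lemma InBall.split {S : Set G} {m n : ℕ} {g : G} (h : InBall S (m + n) g) :
    ∃ x y, InBall S m x ∧ InBall S n y ∧ x * y = g := by
  obtain ⟨w, h1, h2, h3⟩ := h
  refine ⟨(w.take m).prod, (w.drop m).prod, ⟨_, by simp, fun x hx => h2 x (List.mem_of_mem_take hx), rfl⟩,
    ⟨_, by simp; omega, fun x hx => h2 x (List.mem_of_mem_drop hx), rfl⟩, ?_⟩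
  rw [← List.prod_append, List.take_append_drop, h3]

lemma ballCard_add {S : Finset G} (hS : Subgroup.closure (S : Set G) = ⊤) (m n : ℕ) :
    ballCard (S : Set G) (m + n) ≤ ballCard (S : Set G) m * ballCard (S : Set G) n := by
  rw [ballCard_eq hS, ballCard_eq hS, ballCard_eq hS]
  rw [← Set.ncard_prod]
  refine (Set.ncard_le_ncard (t := (fun p : G × G => p.1 * p.2) '' (_ ×ˢ _)) ?_
    (((finite_ball S m).prod (finite_ball S n)).image _)).trans
    (Set.ncard_image_le ((finite_ball S m).prod (finite_ball S n)))
  rintro g hg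
  obtain ⟨x, y, hx, hy, h⟩ := InBall.split hg
  exact ⟨(x, y), ⟨hx, hy⟩, h⟩

lemma wd_injOn {a b : G} (h : FreePair a b) : ∀ u u' : List Bool, u.length = u'.length →
    wd a b u = wd a b u' → u = u' := by
  intro u
  induction u with
  | nil => intro u' h1 _; exact (List.length_eq_zero_iff.1 h1.symm).symm
  | cons c u ih =>
    intro u' h1 h2
    cases u' with
    | nil => simp at h1
    | cons c' u' =>
      have hl : u.length = u'.length := by simpa using h1
      simp only [wd, List.map_cons, List.prod_cons] at h2
      cases c <;> cases c' <;> simp only [cond_true, cond_false] at h2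
      · rw [ih u' hl (mul_left_cancel h2)]
      · exact absurd h2.symm (h _ _ hl.symm)
      · exact absurd h2 (h _ _ hl)
      · rw [ih u' hl (mul_left_cancel h2)]

lemma two_pow_le_ballCard {S : Finset G} (hS : Subgroup.closure (S : Set G) = ⊤) {m : ℕ} {a b : G}
    (ha : InBall (S : Set G) m a) (hb : InBall (S : Set G) m b) (h : FreePair a b) (k : ℕ) :
    2 ^ k ≤ ballCard (S : Set G) (m * k) := by
  rw [ballCard_eq hS]
  have h1 : Set.ncard (Set.univ : Set (List.Vector Bool k)) = 2 ^ k := by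
    rw [Set.ncard_univ, Nat.card_eq_fintype_card, card_vector, Fintype.card_bool]
  rw [← h1]
  refine Set.ncard_le_ncard_of_injOn (fun v => wd a b v.toList) ?_ ?_ (finite_ball S _)
  · intro v _
    have := InBall.list_prod (S := (S : Set G)) (m := m) (v.toList.map (fun c => cond c a b)) ?_
    · simpa [wd] using this
    · intro x hx
      obtain ⟨c, -, rfl⟩ := List.mem_map.1 hx
      cases c
      · exact hb
      · exact ha
  · intro v _ v' _ hv
    exact List.Vector.toList_injective (wd_injOn h _ _ (by simp) hv)

lemma growthRate_ge {S : Finset G} (hS : Subgroup.closure (S : Set G) = ⊤) {m : ℕ} (hm : 0 < m)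
    {a b : G} (ha : InBall (S : Set G) m a) (hb : InBall (S : Set G) m b) (h : FreePair a b) :
    Real.exp (Real.log 2 / m) ≤ growthRate (S : Set G) := by
  set u : ℕ → ℝ := fun n => Real.log (ballCard (S : Set G) n) with hu
  have hpos : ∀ n, (0 : ℝ) < ballCard (S : Set G) n := fun n => by
    exact_mod_cast ballCard_pos hS n
  have hsub : Subadditive u := by
    intro i j
    simp only [hu]
    rw [← Real.log_mul (hpos i).ne' (hpos j).ne']
    apply Real.log_le_log (hpos _)
    exact_mod_cast ballCard_add hS i j
  have hnn : ∀ n, 0 ≤ u n := fun n => Real.log_natCast_nonneg _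
  have hbdd : BddBelow (Set.range fun n => u n / n) := by
    refine ⟨0, ?_⟩
    rintro _ ⟨n, rfl⟩
    exact div_nonneg (hnn n) (Nat.cast_nonneg n)
  have ht := hsub.tendsto_lim hbdd
  have hge : Real.log 2 / m ≤ hsub.lim := by
    have hcomp : Tendsto (fun k : ℕ => m * (k + 1)) atTop atTop := by
      apply tendsto_atTop_mono (fun k => ?_) tendsto_id
      simp only [id]
      nlinarith
    refine ge_of_tendsto (ht.comp hcomp) (Eventually.of_forall fun k => ?_)
    simp only [Function.comp]
    have hk := two_pow_le_ballCard hS ha hb h (k + 1)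
    have : (k + 1 : ℝ) * Real.log 2 ≤ u (m * (k + 1)) := by
      simp only [hu]
      rw [show ((k : ℝ) + 1) * Real.log 2 = Real.log (2 ^ (k + 1)) by
        rw [Real.log_pow]; push_cast; ring]
      apply Real.log_le_log (by positivity)
      exact_mod_cast hk
    have hm' : (0 : ℝ) < m := by exact_mod_cast hm
    rw [div_le_div_iff₀ hm' (by push_cast; positivity)]
    push_cast
    nlinarith
  have hlim : Tendsto (fun n : ℕ => (ballCard (S : Set G) n : ℝ) ^ ((n : ℝ)⁻¹)) atTop
      (nhds (Real.exp hsub.lim)) := by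
    refine ((Real.continuous_exp.tendsto _).comp ht).congr fun n => ?_
    simp only [Function.comp, hu]
    rw [Real.rpow_def_of_pos (hpos n), div_eq_mul_inv]
  unfold growthRate
  rw [hlim.limUnder_eq]
  exact Real.exp_le_exp.2 hge

theorem growth_criterion (hG : Group.FG G) (m : ℕ)
    (h : ∀ S : Finset G, Subgroup.closure (S : Set G) = ⊤ →
      ∃ a b : G, InBall (S : Set G) m a ∧ InBall (S : Set G) m b ∧ FreePair a b) :
    1 < minGrowth G := by
  have hm : (0 : ℝ) < (m + 1 : ℕ) := by positivity
  refine lt_of_lt_of_le (b := Real.exp (Real.log 2 / (m + 1 : ℕ))) ?_ ?_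
  · rw [Real.one_lt_exp_iff]
    exact div_pos (Real.log_pos (by norm_num)) hm
  · unfold minGrowth
    obtain ⟨S0, hS0⟩ := Group.fg_def.1 hG
    refine le_csInf ⟨_, S0, hS0, rfl⟩ ?_
    rintro x ⟨S, hS, rfl⟩
    obtain ⟨a, b, ha, hb, hab⟩ := h S hS
    exact growthRate_ge hS (Nat.succ_pos m) (ha.mono (Nat.le_succ m)) (hb.mono (Nat.le_succ m)) hab

end

end UG

namespace UG
open Filter
section
variable {G : Type*} [Group G]

lemma exists_coset_rep (G0 : Subgroup G) [G0.FiniteIndex] (S : Set G) :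
    ∀ (n : ℕ) (w : List G), w.length = n → (∀ x ∈ w, x ∈ S ∨ x⁻¹ ∈ S) →
      ∃ t, InBall S G0.index t ∧ w.prod * t⁻¹ ∈ G0 := by
  intro n
  induction n using Nat.strong_induction_on with
  | _ n ih =>
    intro w hw hl
    by_cases hn : n ≤ G0.index
    · exact ⟨w.prod, ⟨w, hw.le.trans hn, hl, rfl⟩, by simp⟩
    · push Not at hn
      have : Finite (G ⧸ G0) := Subgroup.finite_quotient_of_finiteIndex
      have := Fintype.ofFinite (G ⧸ G0)
      have hcard : Fintype.card (G ⧸ G0) < Fintype.card (Fin (G0.index + 1)) := by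
        rw [Fintype.card_fin, Subgroup.index, Nat.card_eq_fintype_card]; omega
      obtain ⟨j, j', hjj, he⟩ := Fintype.exists_ne_map_eq_of_card_lt
        (fun j : Fin (G0.index + 1) => (((w.take j).prod⁻¹ : G) : G ⧸ G0)) hcard
      wlog hlt : j < j' generalizing j j'
      · exact this j' j hjj.symm he.symm (lt_of_le_of_ne (not_lt.1 hlt) hjj.symm)
      have he' : (w.take j).prod * (w.take j').prod⁻¹ ∈ G0 := by
        have := QuotientGroup.eq.1 he
        simpa using this
      have hj' : (j' : ℕ) ≤ G0.index := Nat.lt_succ_iff.1 j'.2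
      have hlt' : (j : ℕ) < j' := hlt
      obtain ⟨t, ht, hmem⟩ := ih (w.take j ++ w.drop j').length (by simp; omega) _ rfl (by
        intro x hx
        rcases List.mem_append.1 hx with hx | hx
        · exact hl x (List.mem_of_mem_take hx)
        · exact hl x (List.mem_of_mem_drop hx))
      refine ⟨t, ht, ?_⟩
      have := G0.mul_mem (G0.inv_mem he') hmem
      rw [List.prod_append] at this
      have e : w.prod = (w.take j').prod * (w.drop j').prod := by
        rw [← List.prod_append, List.take_append_drop]
      rw [e]
      convert this using 1
      group

theorem exists_schreier (G0 : Subgroup G) [G0.FiniteIndex] :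
    ∃ r : ℕ, ∀ S : Finset G, Subgroup.closure (S : Set G) = ⊤ →
      ∃ S0 : Finset G0, Subgroup.closure (S0 : Set G0) = ⊤ ∧
        ∀ x ∈ S0, InBall (S : Set G) r (x : G) := by
  refine ⟨G0.index + 1 + G0.index, fun S hS => ?_⟩
  have hfin : {x : G0 | InBall (S : Set G) (G0.index + 1 + G0.index) (x : G)}.Finite :=
    Set.Finite.preimage (f := fun x : G0 => (x : G)) (Subtype.val_injective.injOn)
      (finite_ball S (G0.index + 1 + G0.index))
  refine ⟨hfin.toFinset, ?_, by simp⟩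
  rw [Set.Finite.coe_toFinset]
  set T := {x : G0 | InBall (S : Set G) (G0.index + 1 + G0.index) (x : G)} with hT
  have key : ∀ w : List G, (∀ x ∈ w, x ∈ (S : Set G) ∨ x⁻¹ ∈ (S : Set G)) →
      ∃ y ∈ Subgroup.closure T, ∃ t, InBall (S : Set G) G0.index t ∧ w.prod = (y : G) * t := by
    intro w
    induction w using List.reverseRecOn with
    | nil => intro _; exact ⟨1, one_mem _, 1, .one _ _, by simp⟩
    | append_singleton w x ih =>
      intro hl
      obtain ⟨y, hy, t, ht, he⟩ := ih (fun z hz => hl z (by simp [hz]))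
      have htx : InBall (S : Set G) (G0.index + 1) (t * x) :=
        ht.mul ⟨[x], by simp, by simpa using hl x (by simp), by simp⟩
      have htx0 := htx
      obtain ⟨v, hv1, hv2, hv3⟩ := htx
      obtain ⟨t', ht', hm⟩ := exists_coset_rep G0 (S : Set G) _ v rfl hv2
      rw [hv3] at hm
      refine ⟨y * ⟨_, hm⟩, mul_mem hy (Subgroup.subset_closure ?_), t', ht', ?_⟩
      · exact htx0.mul ht'.inv
      · simp [he]; group
  rw [eq_top_iff]
  intro g _
  obtain ⟨m, w, h1, h2, h3⟩ := exists_inBall hS (g : G)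
  obtain ⟨y, hy, t, ht, he⟩ := key w h2
  have htG : t ∈ G0 := by
    have : t = (y : G)⁻¹ * g := by rw [← h3, he]; group
    rw [this]; exact mul_mem (inv_mem y.2) g.2
  have : g = y * ⟨t, htG⟩ := by
    apply Subtype.ext
    rw [← h3, he]; rfl
  rw [this]
  exact mul_mem hy (Subgroup.subset_closure (ht.mono (by omega)))

lemma wd_map {M M' : Type*} [Monoid M] [Monoid M'] (f : M →* M') (a b : M) (l : List Bool) :
    f (wd a b l) = wd (f a) (f b) l := by
  unfold wd
  rw [map_list_prod, List.map_map]
  congr 1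
  apply List.map_congr_left
  intro c _
  cases c <;> rfl

lemma FreePair.of_map {M M' : Type*} [Monoid M] [Monoid M'] (f : M →* M') {a b : M}
    (h : FreePair (f a) (f b)) : FreePair a b := by
  intro u u' hl he
  apply h u u' hl
  rw [← wd_map, ← wd_map, ← map_mul, ← map_mul, he]

lemma FreePair.map_inj {M M' : Type*} [Monoid M] [Monoid M'] (f : M →* M')
    (hf : Function.Injective f) {a b : M} (h : FreePair a b) : FreePair (f a) (f b) := by
  intro u u' hl he
  apply h u u' hl
  apply hf
  rw [map_mul, map_mul, wd_map, wd_map, he]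

/-- uniform free semigroups -/
def UFS (G : Type*) [Group G] : Prop :=
  ∃ m : ℕ, ∀ S : Finset G, Subgroup.closure (S : Set G) = ⊤ →
      ∃ a b : G, InBall (S : Set G) m a ∧ InBall (S : Set G) m b ∧ FreePair a b

theorem UFS.of_finiteIndex (G0 : Subgroup G) [G0.FiniteIndex] (h : UFS G0) : UFS G := by
  obtain ⟨r, hr⟩ := exists_schreier G0
  obtain ⟨m, hm⟩ := h
  refine ⟨r * m, fun S hS => ?_⟩
  obtain ⟨S0, h0, h1⟩ := hr S hS
  obtain ⟨a, b, ha, hb, hab⟩ := hm S0 h0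
  have hT : ∀ t ∈ (G0.subtype '' (S0 : Set G0)), InBall (S : Set G) r t := by
    rintro _ ⟨x, hx, rfl⟩
    exact h1 x hx
  exact ⟨a, b, InBall.trans hT (ha.map G0.subtype), InBall.trans hT (hb.map G0.subtype),
    hab.map_inj G0.subtype Subtype.val_injective⟩

end

end UG

namespace UG
open Filter
set_option autoImplicit false
set_option linter.unusedVariables false
def QB : Type := AlgebraicClosure ℚ
noncomputable instance : Field QB := inferInstanceAs (Field (AlgebraicClosure ℚ))
instance : CharZero QB := inferInstanceAs (CharZero (AlgebraicClosure ℚ))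
instance : IsAlgClosed QB := inferInstanceAs (IsAlgClosed (AlgebraicClosure ℚ))
instance : Algebra.IsAlgebraic ℚ QB := by
  have h := AlgebraicClosure.isAlgebraic ℚ
  have e : (AlgebraicClosure.instAlgebra ℚ : Algebra ℚ (AlgebraicClosure ℚ)) = (DivisionRing.toRatAlgebra : Algebra ℚ QB) :=
    Subsingleton.elim _ _
  exact e ▸ h
instance : IsAlgClosure ℚ QB := ⟨inferInstance, inferInstance⟩
instance : Normal ℚ QB := IsAlgClosure.normal ℚ QB

def IsInf (v : AbsoluteValue QB ℝ) : Prop := ∀ q : ℚ, v (algebraMap ℚ QB q) = |(q : ℝ)|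
def IsAt (p : ℕ) (v : AbsoluteValue QB ℝ) : Prop :=
  ∀ q : ℚ, v (algebraMap ℚ QB q) = ((padicNorm p q : ℚ) : ℝ)

lemma exists_isInf : ∃ v, IsInf v := by
  let f : QB →+* ℂ := (IsAlgClosed.lift (R := ℚ) (S := QB) (M := ℂ)).toRingHom
  refine ⟨(NormedField.toAbsoluteValue ℂ).comp f.injective, fun q => ?_⟩
  show ‖f (algebraMap ℚ QB q)‖ = _
  rw [← RingHom.comp_apply, eq_ratCast (f.comp (algebraMap ℚ QB)) q]
  simp

lemma exists_isAt (p : ℕ) (hp : p.Prime) : ∃ v, IsAt p v := by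
  have : Fact p.Prime := ⟨hp⟩
  let _ : Algebra ℚ (PadicAlgCl p) := DivisionRing.toRatAlgebra
  let f : QB →+* PadicAlgCl p := (IsAlgClosed.lift (R := ℚ) (S := QB) (M := PadicAlgCl p)).toRingHom
  refine ⟨(NormedField.toAbsoluteValue (PadicAlgCl p)).comp f.injective, fun q => ?_⟩
  show ‖f (algebraMap ℚ QB q)‖ = _
  rw [← RingHom.comp_apply, eq_ratCast (f.comp (algebraMap ℚ QB)) q, ← Padic.eq_padicNorm, ← PadicAlgCl.norm_extends]
  congr 1
  try exact (map_ratCast (algebraMap ℚ_[p] (PadicAlgCl p)) q).symm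

noncomputable def conjV (v : AbsoluteValue QB ℝ) (σ : QB ≃ₐ[ℚ] QB) : AbsoluteValue QB ℝ :=
  v.comp (f := (σ : QB →+* QB)) σ.injective

lemma conjV_apply (v : AbsoluteValue QB ℝ) (σ : QB ≃ₐ[ℚ] QB) (x : QB) : conjV v σ x = v (σ x) := rfl

lemma IsInf.conj {v} (h : IsInf v) (σ) : IsInf (conjV v σ) := fun q => by
  rw [conjV_apply, AlgEquiv.commutes, h q]
lemma IsAt.conj {p v} (h : IsAt p v) (σ) : IsAt p (conjV v σ) := fun q => by
  rw [conjV_apply, AlgEquiv.commutes, h q]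

lemma IsAt.nonarch {p v} (hp : p.Prime) (h : IsAt p v) (x y : QB) : v (x + y) ≤ max (v x) (v y) := by
  have : Fact p.Prime := ⟨hp⟩
  have hu : IsUltrametricDist (WithAbs v) := by
    apply IsUltrametricDist.isUltrametricDist_of_forall_norm_natCast_le_one
    intro n
    rw [WithAbs.norm_eq_apply_ofAbs]
    have := h n
    simp only [map_natCast] at this
    rw [show (n : WithAbs v).ofAbs = (n : QB) from map_natCast (WithAbs.equiv v) n, this]
    exact_mod_cast padicNorm.of_nat n
  exact IsUltrametricDist.norm_add_le_max (WithAbs.toAbs v x) (WithAbs.toAbs v y)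

/-- abstract bounded elements -/
structure Ctl (T : Finset ℕ) (b : ℝ) (x : QB) : Prop where
  inf : ∀ v, IsInf v → v x ≤ b
  fin : ∀ p, p.Prime → p ∈ T → ∀ v, IsAt p v → v x ≤ b
  out : ∀ p, p.Prime → p ∉ T → ∀ v, IsAt p v → v x ≤ 1

lemma IsInf.natCast {v} (h : IsInf v) (n : ℕ) : v n = n := by
  have := h n; simpa using this
lemma IsAt.natCast_le {p v} (hp : p.Prime) (h : IsAt p v) (n : ℕ) : v n ≤ 1 := by
  have : Fact p.Prime := ⟨hp⟩
  have := h n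
  simp only [map_natCast] at this
  rw [this]
  exact_mod_cast padicNorm.of_nat n

section
variable {T : Finset ℕ} {b b' : ℝ} {x y : QB}

lemma Ctl.one_le_of (h : Ctl T b x) : 0 ≤ b := by
  obtain ⟨v, hv⟩ := exists_isInf
  exact (v.nonneg x).trans (h.inf v hv)

lemma Ctl.mono (h : Ctl T b x) (hb : b ≤ b') : Ctl T b' x :=
  ⟨fun v hv => (h.inf v hv).trans hb, fun p hp hT v hv => (h.fin p hp hT v hv).trans hb, h.out⟩

lemma Ctl.mul (h : Ctl T b x) (h' : Ctl T b' y) : Ctl T (b * b') (x * y) := by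
  have hb := h.one_le_of
  refine ⟨fun v hv => ?_, fun p hp hT v hv => ?_, fun p hp hT v hv => ?_⟩ <;> rw [v.map_mul]
  · exact mul_le_mul (h.inf v hv) (h'.inf v hv) (v.nonneg _) hb
  · exact mul_le_mul (h.fin p hp hT v hv) (h'.fin p hp hT v hv) (v.nonneg _) hb
  · exact mul_le_one₀ (h.out p hp hT v hv) (v.nonneg _) (h'.out p hp hT v hv)

lemma Ctl.add (h : Ctl T b x) (h' : Ctl T b' y) : Ctl T (b + b') (x + y) := by
  have hb := h.one_le_of
  have hb' := h'.one_le_of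
  refine ⟨fun v hv => ?_, fun p hp hT v hv => ?_, fun p hp hT v hv => ?_⟩
  · exact (v.add_le _ _).trans (add_le_add (h.inf v hv) (h'.inf v hv))
  · exact (v.add_le _ _).trans (add_le_add (h.fin p hp hT v hv) (h'.fin p hp hT v hv))
  · exact (hv.nonarch hp x y).trans (max_le (h.out p hp hT v hv) (h'.out p hp hT v hv))

lemma Ctl.neg (h : Ctl T b x) : Ctl T b (-x) := by
  refine ⟨fun v hv => ?_, fun p hp hT v hv => ?_, fun p hp hT v hv => ?_⟩ <;> rw [v.map_neg]
  · exact h.inf v hv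
  · exact h.fin p hp hT v hv
  · exact h.out p hp hT v hv

lemma Ctl.zero (hb : 0 ≤ b) : Ctl T b 0 := by
  refine ⟨fun v hv => ?_, fun p hp hT v hv => ?_, fun p hp hT v hv => ?_⟩ <;> rw [v.map_zero]
  · exact hb
  · exact hb
  · exact zero_le_one

lemma Ctl.one (hb : 1 ≤ b) : Ctl T b 1 := by
  refine ⟨fun v hv => ?_, fun p hp hT v hv => ?_, fun p hp hT v hv => ?_⟩ <;> rw [v.map_one]
  all_goals exact hb

lemma Ctl.conj (h : Ctl T b x) (σ : QB ≃ₐ[ℚ] QB) : Ctl T b (σ x) :=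
  ⟨fun v hv => h.inf _ (hv.conj σ), fun p hp hT v hv => h.fin p hp hT _ (hv.conj σ),
    fun p hp hT v hv => h.out p hp hT _ (hv.conj σ)⟩

lemma Ctl.pow (h : Ctl T b x) (n : ℕ) : Ctl T (b ^ n) (x ^ n) := by
  induction n with
  | zero => simpa using Ctl.one le_rfl
  | succ n ih => rw [pow_succ, pow_succ]; exact ih.mul h

lemma Ctl.multiset_prod (s : Multiset QB) (hb : 0 ≤ b) (h : ∀ x ∈ s, Ctl T b x) :
    Ctl T (b ^ Multiset.card s) s.prod := by
  induction s using Multiset.induction_on with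
  | empty => simpa using Ctl.one le_rfl
  | cons a s ih =>
    rw [Multiset.prod_cons, Multiset.card_cons, pow_succ']
    exact (h a (Multiset.mem_cons_self a s)).mul (ih fun x hx => h x (Multiset.mem_cons_of_mem hx))

end

/-- a place dominated by T: infinite or at p -/
def IsPl (v : AbsoluteValue QB ℝ) : Prop := IsInf v ∨ ∃ p, p.Prime ∧ IsAt p v

lemma Ctl.pl {T b x} (hb : 1 ≤ b) (h : Ctl T b x) {v} (hv : IsPl v) : v x ≤ b := by
  rcases hv with hv | ⟨p, hp, hv⟩
  · exact h.inf v hv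
  · by_cases hT : p ∈ T
    · exact h.fin p hp hT v hv
    · exact (h.out p hp hT v hv).trans hb

lemma product_formula_nat (n : ℕ) (hn : n ≠ 0) :
    (n : ℚ) * ∏ p ∈ n.primeFactors, padicNorm p n = 1 := by
  have h1 : ∏ p ∈ n.primeFactors, padicNorm p n = ((∏ p ∈ n.primeFactors, p ^ n.factorization p : ℕ) : ℚ)⁻¹ := by
    rw [Nat.cast_prod, ← Finset.prod_inv_distrib]
    refine Finset.prod_congr rfl fun p hp => ?_
    have hpp := Nat.prime_of_mem_primeFactors hp
    have : Fact p.Prime := ⟨hpp⟩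
    rw [padicNorm.eq_zpow_of_nonzero (by exact_mod_cast hn), Nat.factorization_def _ hpp]
    simp
  have h2 : ∏ p ∈ n.primeFactors, p ^ n.factorization p = n := Nat.prod_factorization_pow_eq_self hn
  rw [h1, h2, mul_inv_cancel₀ (by exact_mod_cast hn)]

lemma product_formula_nat' (n : ℕ) (hn : n ≠ 0) (S : Finset ℕ) (hS : n.primeFactors ⊆ S)
    (hp : ∀ p ∈ S, p.Prime) : (n : ℚ) * ∏ p ∈ S, padicNorm p n = 1 := by
  rw [← product_formula_nat n hn]
  congr 1
  symm
  refine Finset.prod_subset hS fun p hpS hpn => ?_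
  have : Fact p.Prime := ⟨hp p hpS⟩
  rw [padicNorm.nat_eq_one_iff]
  intro hd
  exact hpn (Nat.mem_primeFactors.2 ⟨hp p hpS, hd, hn⟩)

lemma product_formula (q : ℚ) (hq : q ≠ 0) (S0 : Finset ℕ) (hS0 : ∀ p ∈ S0, p.Prime) :
    ∃ S : Finset ℕ, S0 ⊆ S ∧ (∀ p ∈ S, p.Prime) ∧ |q| * ∏ p ∈ S, padicNorm p q = 1 := by
  refine ⟨S0 ∪ (q.num.natAbs.primeFactors ∪ q.den.primeFactors), Finset.subset_union_left, ?_, ?_⟩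
  · intro p hp
    simp only [Finset.mem_union] at hp
    rcases hp with hp | hp | hp
    · exact hS0 p hp
    · exact Nat.prime_of_mem_primeFactors hp
    · exact Nat.prime_of_mem_primeFactors hp
  · set S := S0 ∪ (q.num.natAbs.primeFactors ∪ q.den.primeFactors) with hS
    have hSp : ∀ p ∈ S, p.Prime := by
      intro p hp
      simp only [hS, Finset.mem_union] at hp
      rcases hp with hp | hp | hp
      · exact hS0 p hp
      · exact Nat.prime_of_mem_primeFactors hp
      · exact Nat.prime_of_mem_primeFactors hp
    have h1 := product_formula_nat' q.num.natAbs (by simpa using hq) S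
      (fun p hp => by simp only [hS, Finset.mem_union]; tauto) hSp
    have h2 := product_formula_nat' q.den q.den_ne_zero S
      (fun p hp => by simp only [hS, Finset.mem_union]; tauto) hSp
    have e : |q| = (q.num.natAbs : ℚ) / q.den := by
      conv_lhs => rw [← Rat.num_div_den q]
      rw [abs_div, Nat.abs_cast, Nat.cast_natAbs, Int.cast_abs]
    have e2 : ∏ p ∈ S, padicNorm p q = (∏ p ∈ S, padicNorm p q.num.natAbs) / ∏ p ∈ S, padicNorm p q.den := by
      rw [← Finset.prod_div_distrib]
      refine Finset.prod_congr rfl fun p hp => ?_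
      have : Fact p.Prime := ⟨hSp p hp⟩
      conv_lhs => rw [← Rat.num_div_den q]
      rw [padicNorm.div]
      congr 1
      rcases Int.natAbs_eq q.num with h | h
      · rw [show (q.num : ℚ) = (q.num.natAbs : ℚ) by
          conv_lhs => rw [h]
          simp]
      · rw [show (q.num : ℚ) = -(q.num.natAbs : ℚ) by
          conv_lhs => rw [h]
          simp, padicNorm.neg]
    rw [e, e2, div_mul_div_comm, h1, h2, div_one]

end UG

namespace UG
open Filter Polynomial
set_option autoImplicit false
set_option linter.unusedVariables false
/-- rational numbers: lower bound at each place from the product formula -/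
lemma rat_lower (T : Finset ℕ) (b : ℝ) (hb : 1 ≤ b) (q : ℚ) (hq : q ≠ 0)
    (h : Ctl T b (algebraMap ℚ QB q)) {v : AbsoluteValue QB ℝ} (hv : IsPl v) :
    (b ^ (T.card + 1))⁻¹ ≤ v (algebraMap ℚ QB q) := by
  -- bounds at rational places
  have hinf : |(q : ℝ)| ≤ b := by
    obtain ⟨w, hw⟩ := exists_isInf
    rw [← hw q]; exact h.inf w hw
  have hfin : ∀ p, p.Prime → ((padicNorm p q : ℚ) : ℝ) ≤ if p ∈ T then b else 1 := by
    intro p hp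
    obtain ⟨w, hw⟩ := exists_isAt p hp
    rw [← hw q]
    split_ifs with hT
    · exact h.fin p hp hT w hw
    · exact h.out p hp hT w hw
  have hnn : ∀ p, (0 : ℝ) ≤ ((padicNorm p q : ℚ) : ℝ) := fun p => by exact_mod_cast padicNorm.nonneg q
  have hprod : ∀ S : Finset ℕ, (∀ p ∈ S, p.Prime) →
      ∏ p ∈ S, ((padicNorm p q : ℚ) : ℝ) ≤ b ^ T.card := by
    intro S hS
    calc ∏ p ∈ S, ((padicNorm p q : ℚ) : ℝ) ≤ ∏ p ∈ S, (if p ∈ T then b else 1) :=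
          Finset.prod_le_prod (fun p _ => hnn p) (fun p hp => hfin p (hS p hp))
      _ = b ^ (S ∩ T).card := by
          rw [Finset.prod_ite_mem, Finset.prod_const]
      _ ≤ b ^ T.card := pow_le_pow_right₀ hb (Finset.card_le_card Finset.inter_subset_right)
  have hbp : 0 < b ^ (T.card + 1) := by positivity
  rcases hv with hv | ⟨p, hp, hv⟩
  · obtain ⟨S, -, hS, he⟩ := product_formula q hq ∅ (by simp)
    have he' : |(q : ℝ)| * ∏ p ∈ S, ((padicNorm p q : ℚ) : ℝ) = 1 := by exact_mod_cast he
    rw [hv q, inv_le_iff_one_le_mul₀ hbp, ← he']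
    apply mul_le_mul_of_nonneg_left _ (abs_nonneg _)
    exact (hprod S hS).trans (pow_le_pow_right₀ hb (Nat.le_succ _))
  · obtain ⟨S, hpS, hS, he⟩ := product_formula q hq {p} (by simpa using hp)
    have he' : |(q : ℝ)| * ∏ p ∈ S, ((padicNorm p q : ℚ) : ℝ) = 1 := by exact_mod_cast he
    have hpS' : p ∈ S := hpS (by simp)
    rw [← Finset.mul_prod_erase S _ hpS'] at he'
    rw [hv q, inv_le_iff_one_le_mul₀ hbp, ← he']
    have h1 := hprod (S.erase p) (fun p hp => hS p (Finset.mem_of_mem_erase hp))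
    have h2 : |(q : ℝ)| * ∏ p ∈ S.erase p, ((padicNorm p q : ℚ) : ℝ) ≤ b * b ^ T.card :=
      mul_le_mul hinf h1 (Finset.prod_nonneg fun p _ => hnn p) (by linarith)
    calc _ = ((padicNorm p q : ℚ) : ℝ) * (|(q : ℝ)| * ∏ p ∈ S.erase p, ((padicNorm p q : ℚ) : ℝ)) := by ring
      _ ≤ ((padicNorm p q : ℚ) : ℝ) * b ^ (T.card + 1) := by
        rw [pow_succ']
        exact mul_le_mul_of_nonneg_left h2 (hnn p)

lemma root_conj {x y : QB} (hy : y ∈ ((minpoly ℚ x).map (algebraMap ℚ QB)).roots) :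
    ∃ σ : QB ≃ₐ[ℚ] QB, y = σ x := by
  have hx : IsIntegral ℚ x := Algebra.IsIntegral.isIntegral x
  have h0 : aeval y (minpoly ℚ x) = 0 := by
    rw [mem_roots', IsRoot.def, eval_map_algebraMap] at hy
    exact hy.2
  have h1 : minpoly ℚ x = minpoly ℚ y := minpoly.eq_of_irreducible_of_monic
    (minpoly.irreducible hx) h0 (minpoly.monic hx)
  obtain ⟨σ, hσ⟩ := (IsConjRoot.exists_algEquiv (K := ℚ) (x := y) (y := x) h1.symm)
  exact ⟨σ, hσ.symm⟩

lemma minpoly_map_eq (x : QB) : (minpoly ℚ x).map (algebraMap ℚ QB) =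
    (((minpoly ℚ x).map (algebraMap ℚ QB)).roots.map (fun a => X - C a)).prod := by
  have hx : IsIntegral ℚ x := Algebra.IsIntegral.isIntegral x
  exact (IsAlgClosed.splits _).eq_prod_roots_of_monic ((minpoly.monic hx).map _)

lemma card_roots_minpoly (x : QB) :
    Multiset.card ((minpoly ℚ x).map (algebraMap ℚ QB)).roots = (minpoly ℚ x).natDegree := by
  rw [← (IsAlgClosed.splits ((minpoly ℚ x).map (algebraMap ℚ QB))).natDegree_eq_card_roots,
    natDegree_map]

/-- Liouville-type lower bound -/
lemma liouville (T : Finset ℕ) (b : ℝ) (hb : 1 ≤ b) (D : ℕ) (x : QB) (hx0 : x ≠ 0)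
    (hD : (minpoly ℚ x).natDegree ≤ D) (h : Ctl T b x) {v : AbsoluteValue QB ℝ} (hv : IsPl v) :
    (b ^ (D * (T.card + 2)))⁻¹ ≤ v x := by
  classical
  have hx : IsIntegral ℚ x := Algebra.IsIntegral.isIntegral x
  set R := ((minpoly ℚ x).map (algebraMap ℚ QB)).roots with hR
  have hxR : x ∈ R := by
    rw [hR, mem_roots', IsRoot.def, eval_map_algebraMap, minpoly.aeval]
    exact ⟨((minpoly.monic hx).map _).ne_zero, rfl⟩
  have hc : algebraMap ℚ QB ((-1) ^ R.card * (minpoly ℚ x).coeff 0) = R.prod := by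
    have h1 := congrArg (fun P => P.coeff 0) (minpoly_map_eq x)
    simp only [coeff_map] at h1
    rw [← hR] at h1
    rw [map_mul, h1, coeff_zero_eq_eval_zero, eval_multiset_prod, Multiset.map_map]
    simp only [Function.comp_def, eval_sub, eval_X, eval_C, zero_sub]
    rw [Multiset.prod_map_neg, map_pow, map_neg, map_one, ← mul_assoc, ← mul_pow]
    simp
  have hcard : R.card ≤ D := by rw [hR, card_roots_minpoly]; exact hD
  have hRc : ∀ y ∈ R, Ctl T b y := by
    intro y hy
    obtain ⟨σ, rfl⟩ := root_conj hy
    exact h.conj σ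
  have hb0 : (0 : ℝ) ≤ b := by linarith
  have hN : Ctl T (b ^ D) (algebraMap ℚ QB ((-1) ^ R.card * (minpoly ℚ x).coeff 0)) := by
    rw [hc]
    exact (Ctl.multiset_prod R hb0 hRc).mono (pow_le_pow_right₀ hb hcard)
  have hne : (-1) ^ R.card * (minpoly ℚ x).coeff 0 ≠ 0 := by
    refine mul_ne_zero (pow_ne_zero _ (by norm_num)) ?_
    exact minpoly.coeff_zero_ne_zero hx hx0
  have hlow := rat_lower T (b ^ D) (one_le_pow₀ hb) _ hne hN hv
  rw [hc, ← Multiset.prod_erase hxR, v.map_mul] at hlow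
  have hrest : v (R.erase x).prod ≤ b ^ D := by
    have := (Ctl.multiset_prod (R.erase x) hb0 fun y hy => hRc y (Multiset.mem_of_mem_erase hy))
    refine (this.pl (one_le_pow₀ hb) hv).trans (pow_le_pow_right₀ hb ?_)
    exact (Multiset.card_le_card (Multiset.erase_le x R)).trans hcard
  have hp : 0 < b ^ D := by positivity
  have e : b ^ (D * (T.card + 2)) = (b ^ D) ^ (T.card + 1) * b ^ D := by
    rw [← pow_mul, ← pow_add]; congr 1
  rw [e, mul_inv, ← div_eq_mul_inv, div_le_iff₀ hp]
  exact hlow.trans (mul_le_mul_of_nonneg_left hrest (v.nonneg x))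

lemma coeff_bound_arch (v : AbsoluteValue QB ℝ) (B : ℝ) (hB : 0 ≤ B) (s : Multiset QB)
    (h : ∀ x ∈ s, v x ≤ B) (i : ℕ) :
    v ((s.map (fun a => X - C a)).prod.coeff i) ≤ (1 + B) ^ Multiset.card s := by
  induction s using Multiset.induction_on generalizing i with
  | empty =>
    simp only [Multiset.map_zero, Multiset.prod_zero, Multiset.card_zero, pow_zero, coeff_one]
    split_ifs <;> simp
  | cons a s ih =>
    have ih' := ih (fun x hx => h x (Multiset.mem_cons_of_mem hx))
    have ha := h a (Multiset.mem_cons_self a s)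
    rw [Multiset.map_cons, Multiset.prod_cons, Multiset.card_cons, sub_mul, coeff_sub, coeff_C_mul]
    refine (v.sub_le_add _ _).trans ?_
    rw [v.map_mul, pow_succ, mul_add, mul_one, mul_comm (v a)]
    refine add_le_add ?_ (mul_le_mul (ih' i) ha (v.nonneg _) (by positivity))
    cases i with
    | zero => simp; positivity
    | succ i => rw [coeff_X_mul]; exact ih' i

lemma coeff_bound_nonarch (v : AbsoluteValue QB ℝ) (hna : ∀ x y, v (x + y) ≤ max (v x) (v y))
    (B : ℝ) (hB : 1 ≤ B) (s : Multiset QB)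
    (h : ∀ x ∈ s, v x ≤ B) (i : ℕ) :
    v ((s.map (fun a => X - C a)).prod.coeff i) ≤ B ^ Multiset.card s := by
  induction s using Multiset.induction_on generalizing i with
  | empty =>
    simp only [Multiset.map_zero, Multiset.prod_zero, Multiset.card_zero, pow_zero, coeff_one]
    split_ifs <;> simp
  | cons a s ih =>
    have ih' := ih (fun x hx => h x (Multiset.mem_cons_of_mem hx))
    have ha := h a (Multiset.mem_cons_self a s)
    rw [Multiset.map_cons, Multiset.prod_cons, Multiset.card_cons, sub_mul, coeff_sub, coeff_C_mul,
      sub_eq_add_neg]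
    refine (hna _ _).trans (max_le ?_ ?_)
    · cases i with
      | zero => simp; positivity
      | succ i =>
        rw [coeff_X_mul]
        exact (ih' i).trans (pow_le_pow_right₀ hB (Nat.le_succ _))
    · rw [v.map_neg, v.map_mul, pow_succ, mul_comm]
      exact mul_le_mul (ih' i) ha (v.nonneg _) (by positivity)


/-- elements of bounded degree with no large absolute value form a finite set -/
lemma northcott (D : ℕ) (B : ℝ) (hB : 1 ≤ B) (hBD : B ^ D < 2) :
    {x : QB | (minpoly ℚ x).natDegree ≤ D ∧ ∀ v, IsPl v → v x ≤ B}.Finite := by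
  classical
  -- the finite set of integral polynomials
  let N : ℕ := ⌈(1 + B) ^ D⌉₊
  have hfinp : {P : ℤ[X] | P.natDegree ≤ D ∧ ∀ i, |P.coeff i| ≤ N}.Finite := by
    have hinj : Set.InjOn (fun (P : ℤ[X]) (i : Fin (D + 1)) => P.coeff i)
        {P : ℤ[X] | P.natDegree ≤ D ∧ ∀ i, |P.coeff i| ≤ N} := by
      intro P hP Q hQ h
      ext i
      by_cases hi : i < D + 1
      · exact congrFun h ⟨i, hi⟩
      · rw [coeff_eq_zero_of_natDegree_lt (by have := hP.1; omega),
          coeff_eq_zero_of_natDegree_lt (by have := hQ.1; omega)]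
    refine Set.Finite.of_finite_image ?_ hinj
    refine (Set.Finite.pi' (fun _ : Fin (D + 1) => Set.finite_Icc (-(N : ℤ)) N)).subset ?_
    rintro _ ⟨P, hP, rfl⟩ i
    exact abs_le.1 (hP.2 i)
  refine ((hfinp.image (fun P => P.map (Int.castRingHom QB))).biUnion
    (t := fun P => {x | P ≠ 0 ∧ P.IsRoot x}) ?_).subset ?_
  · intro P _
    by_cases hP : P = 0
    · simp [hP]
    · refine (P.roots.toFinset.finite_toSet).subset ?_
      intro x hx
      simpa [hP] using hx.2
  · rintro x ⟨hD, hx⟩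
    have hxi : IsIntegral ℚ x := Algebra.IsIntegral.isIntegral x
    have hroots : ∀ y ∈ ((minpoly ℚ x).map (algebraMap ℚ QB)).roots, ∀ v, IsPl v → v y ≤ B := by
      intro y hy v hv
      obtain ⟨σ, rfl⟩ := root_conj hy
      refine hx (conjV v σ) ?_
      rcases hv with hv | ⟨p, hp, hv⟩
      · exact Or.inl (hv.conj σ)
      · exact Or.inr ⟨p, hp, hv.conj σ⟩
    have hcard := card_roots_minpoly x
    have hpad : ∀ i p, p.Prime → padicNorm p ((minpoly ℚ x).coeff i) ≤ 1 := by
      intro i p hp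
      have : Fact p.Prime := ⟨hp⟩
      obtain ⟨v, hv⟩ := exists_isAt p hp
      have h1 := coeff_bound_nonarch v (hv.nonarch hp) B hB _
        (fun y hy => hroots y hy v (Or.inr ⟨p, hp, hv⟩)) i
      rw [← minpoly_map_eq, coeff_map, hv, hcard] at h1
      have h2 : ((padicNorm p ((minpoly ℚ x).coeff i) : ℚ) : ℝ) < 2 :=
        lt_of_le_of_lt (h1.trans (pow_le_pow_right₀ hB hD)) hBD
      have h3 : padicNorm p ((minpoly ℚ x).coeff i) < 2 := by exact_mod_cast h2
      by_cases h0 : (minpoly ℚ x).coeff i = 0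
      · rw [h0]; simp
      · rw [padicNorm.eq_zpow_of_nonzero h0] at h3 ⊢
        by_contra hcon
        push Not at hcon
        have hp1 : (1 : ℚ) < p := by exact_mod_cast hp.one_lt
        have hpos : 0 < -padicValRat p ((minpoly ℚ x).coeff i) := by
          by_contra hle
          exact absurd hcon (not_lt.2 (zpow_le_one_of_nonpos₀ hp1.le (not_lt.1 hle)))
        have : (2 : ℚ) ≤ (p : ℚ) ^ (-padicValRat p ((minpoly ℚ x).coeff i)) := by
          calc (2 : ℚ) ≤ p := by exact_mod_cast hp.two_le
            _ = (p : ℚ) ^ (1 : ℤ) := (zpow_one _).symm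
            _ ≤ _ := zpow_le_zpow_right₀ hp1.le hpos
        linarith
    have hintg : ∀ i, ∃ n : ℤ, (minpoly ℚ x).coeff i = n ∧ |n| ≤ N := by
      intro i
      set q := (minpoly ℚ x).coeff i with hq
      have hden : q.den = 1 := by
        by_contra hne
        obtain ⟨p, hp, hpd⟩ := Nat.exists_prime_and_dvd hne
        have : Fact p.Prime := ⟨hp⟩
        have h1 := hpad i p hp
        rw [← hq] at h1
        have hnum : padicNorm p q.num = 1 := by
          rw [padicNorm.int_eq_one_iff]
          intro hd
          have h3 : p ∣ q.num.natAbs := Int.natCast_dvd.1 hd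
          exact hp.one_lt.ne' (Nat.dvd_one.1 (q.reduced ▸ Nat.dvd_gcd h3 hpd))
        have hd1 : padicNorm p (q.den : ℚ) < 1 := (padicNorm.nat_lt_one_iff _).2 hpd
        have hd0 : 0 < padicNorm p (q.den : ℚ) := lt_of_le_of_ne (padicNorm.nonneg _)
          (Ne.symm (padicNorm.nonzero (by exact_mod_cast q.den_ne_zero)))
        rw [← Rat.num_div_den q, padicNorm.div, hnum, div_le_one hd0] at h1
        linarith
      refine ⟨q.num, (Rat.den_eq_one_iff q).1 hden |>.symm, ?_⟩
      have hqn : (q.num : ℚ) = q := (Rat.den_eq_one_iff q).1 hden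
      obtain ⟨v, hv⟩ := exists_isInf
      have h1 := coeff_bound_arch v B (by linarith) _
        (fun y hy => hroots y hy v (Or.inl hv)) i
      rw [← minpoly_map_eq, coeff_map, hv, hcard, ← hq, ← hqn] at h1
      have h2 : |((q.num : ℚ) : ℝ)| ≤ N :=
        (h1.trans (pow_le_pow_right₀ (by linarith) hD)).trans (Nat.le_ceil _)
      exact_mod_cast h2
    choose n hn hnN using hintg
    have hlift : minpoly ℚ x ∈ lifts (Int.castRingHom ℚ) := by
      rw [lifts_iff_coeff_lifts]
      intro i
      exact ⟨n i, by simp [hn i]⟩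
    obtain ⟨P, hP, hPd, hPm⟩ := lifts_and_natDegree_eq_and_monic hlift (minpoly.monic hxi)
    refine Set.mem_biUnion (x := P.map (Int.castRingHom QB)) ⟨P, ⟨by omega, fun i => ?_⟩, rfl⟩ ⟨?_, ?_⟩
    · have : (P.coeff i : ℚ) = n i := by rw [← hn i, ← hP, coeff_map]; rfl
      have : P.coeff i = n i := by exact_mod_cast this
      rw [this]; exact hnN i
    · exact (hPm.map _).ne_zero
    · have : P.map (Int.castRingHom QB) = (minpoly ℚ x).map (algebraMap ℚ QB) := by
        rw [← hP, Polynomial.map_map]; congr 1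
      rw [this, IsRoot.def, eval_map_algebraMap, minpoly.aeval]

lemma natDegree_minpoly_pow (x : QB) (k : ℕ) :
    (minpoly ℚ (x ^ k)).natDegree ≤ (minpoly ℚ x).natDegree := by
  have hx : IsIntegral ℚ x := Algebra.IsIntegral.isIntegral x
  have : FiniteDimensional ℚ (IntermediateField.adjoin ℚ {x}) :=
    IntermediateField.adjoin.finiteDimensional hx
  rw [← IntermediateField.adjoin.finrank hx]
  have hmem : x ∈ IntermediateField.adjoin ℚ {x} := IntermediateField.mem_adjoin_simple_self ℚ x
  have h := minpoly.natDegree_le (A := ℚ) ((⟨x, hmem⟩ : IntermediateField.adjoin ℚ {x}) ^ k)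
  refine le_trans (le_of_eq ?_) h
  congr 1
  rw [← minpoly.algebraMap_eq (B' := QB) (algebraMap (IntermediateField.adjoin ℚ {x}) QB).injective]
  rfl

/-- a uniform gap -/
lemma gap (D : ℕ) : ∃ ε : ℝ, 0 < ε ∧ ∀ x : QB, x ≠ 0 → (minpoly ℚ x).natDegree ≤ D →
    (∀ k : ℕ, 0 < k → x ^ k ≠ 1) → ∃ v, IsPl v ∧ 1 + ε ≤ v x := by
  -- threshold
  obtain ⟨δ, hδ, hδD⟩ : ∃ δ : ℝ, 0 < δ ∧ (1 + δ) ^ D < 2 := by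
    have hc : Tendsto (fun δ : ℝ => (1 + δ) ^ D) (nhdsWithin 0 (Set.Ioi 0)) (nhds ((1 + 0) ^ D)) := by
      apply Tendsto.mono_left _ nhdsWithin_le_nhds
      exact (Continuous.tendsto (by fun_prop) 0)
    have h2 := hc.eventually_lt_const (u := 2) (by norm_num)
    obtain ⟨δ, h3, h4⟩ := (h2.and self_mem_nhdsWithin).exists
    exact ⟨δ, h4, h3⟩
  set F := {x : QB | (minpoly ℚ x).natDegree ≤ D ∧ ∀ v, IsPl v → v x ≤ 1 + δ} with hF
  have hFfin : F.Finite := northcott D (1 + δ) (by linarith) hδD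
  -- each element has a place above 1
  have hone : ∀ x : QB, x ≠ 0 → (minpoly ℚ x).natDegree ≤ D →
    (∀ k : ℕ, 0 < k → x ^ k ≠ 1) → ∃ v, IsPl v ∧ 1 < v x := by
    intro x hx0 hxD hx
    by_contra hcon
    push Not at hcon
    have hmem : ∀ k : ℕ, x ^ k ∈ F := fun k => ⟨(natDegree_minpoly_pow x k).trans hxD, fun v hv => by
      rw [map_pow]
      exact (pow_le_one₀ (v.nonneg x) (hcon v hv)).trans (by linarith)⟩
    have : ¬ Function.Injective (fun k : ℕ => (⟨x ^ k, hmem k⟩ : F)) := by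
      have := hFfin.to_subtype
      exact not_injective_infinite_finite _
    rw [Function.Injective] at this
    push Not at this
    obtain ⟨i, j, hij, hne⟩ := this
    have hij' : x ^ i = x ^ j := congrArg Subtype.val hij
    rcases lt_or_gt_of_ne hne with h | h
    · apply hx (j - i) (by omega)
      have : x ^ j = x ^ i * x ^ (j - i) := by rw [← pow_add]; congr 1; omega
      rw [this] at hij'
      exact (mul_eq_left₀ (pow_ne_zero i hx0)).1 hij'.symm
    · apply hx (i - j) (by omega)
      have : x ^ i = x ^ j * x ^ (i - j) := by rw [← pow_add]; congr 1; omega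
      rw [this] at hij'
      exact (mul_eq_left₀ (pow_ne_zero j hx0)).1 hij'
  set F' := {x ∈ F | x ≠ 0 ∧ ∀ k : ℕ, 0 < k → x ^ k ≠ 1} with hF'
  have hF'fin : F'.Finite := hFfin.subset (Set.sep_subset _ _)
  have hch : ∀ x : QB, ∃ e : ℝ, 0 < e ∧ (x ∈ F' → ∃ v, IsPl v ∧ 1 + e ≤ v x) := by
    intro x
    by_cases hx : x ∈ F'
    · obtain ⟨v, hv, h1⟩ := hone x hx.2.1 hx.1.1 hx.2.2
      exact ⟨v x - 1, by linarith, fun _ => ⟨v, hv, by linarith⟩⟩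
    · exact ⟨1, one_pos, fun h => absurd h hx⟩
  choose e he0 he using hch
  obtain ⟨m, hm0, hm⟩ : ∃ m : ℝ, 0 < m ∧ ∀ x ∈ F', m ≤ e x := by
    by_cases hne : F'.Nonempty
    · obtain ⟨x0, hx0, hmin⟩ := Set.exists_min_image F' e hF'fin hne
      exact ⟨e x0, he0 x0, hmin⟩
    · exact ⟨1, one_pos, fun x hx => absurd ⟨x, hx⟩ hne⟩
  refine ⟨min m δ, lt_min hm0 hδ, fun x hx0 hxD hx => ?_⟩
  by_cases hxF : x ∈ F
  · have hxF' : x ∈ F' := ⟨hxF, hx0, hx⟩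
    obtain ⟨v, hv, h1⟩ := he x hxF'
    exact ⟨v, hv, by have := hm x hxF'; have := min_le_left m δ; linarith⟩
  · have : ¬ ∀ v, IsPl v → v x ≤ 1 + δ := fun h => hxF ⟨hxD, h⟩
    push Not at this
    obtain ⟨v, hv, h1⟩ := this
    exact ⟨v, hv, by have := min_le_right m δ; linarith⟩

end UG

namespace UG
open Filter Polynomial
set_option autoImplicit false
set_option linter.unusedVariables false
lemma exists_numfield (s : Set QB) (hs : s.Finite) :
    ∃ L : IntermediateField ℚ QB, FiniteDimensional ℚ L ∧ s ⊆ L := by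
  refine ⟨IntermediateField.adjoin ℚ s, ?_, IntermediateField.subset_adjoin ℚ s⟩
  have := hs.to_subtype
  exact IntermediateField.finiteDimensional_adjoin (fun x _ => Algebra.IsIntegral.isIntegral x)

lemma deg_le_of_mem (L : IntermediateField ℚ QB) [FiniteDimensional ℚ L] {x : QB} (hx : x ∈ L) :
    (minpoly ℚ x).natDegree ≤ Module.finrank ℚ L := by
  have h := minpoly.natDegree_le (A := ℚ) (⟨x, hx⟩ : L)
  refine le_trans (le_of_eq ?_) h
  congr 1
  rw [← minpoly.algebraMap_eq (B' := QB) (algebraMap L QB).injective]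
  rfl

section
variable {H : Type*} [Group H]

lemma units_numfield [Group.FG H] (lam : H →* QBˣ) :
    ∃ D : ℕ, ∀ h : H, (minpoly ℚ (lam h : QB)).natDegree ≤ D := by
  obtain ⟨S, hS⟩ := Group.fg_def.1 (inferInstance : Group.FG H)
  obtain ⟨L, hL, hsub⟩ := exists_numfield ((fun h => (lam h : QB)) '' S) (S.finite_toSet.image _)
  refine ⟨Module.finrank ℚ L, fun h => deg_le_of_mem L ?_⟩
  have hh : h ∈ Subgroup.closure (S : Set H) := by rw [hS]; trivial
  induction hh using Subgroup.closure_induction with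
  | mem x hx => exact hsub ⟨x, hx, rfl⟩
  | one => simp
  | mul x y _ _ hx hy => rw [map_mul, Units.val_mul]; exact mul_mem hx hy
  | inv x _ hx => rw [map_inv, Units.val_inv_eq_inv_val]; exact inv_mem hx

theorem affine_case [Group.FG H] (lam : H →* QBˣ) (c : H → QB)
    (hc : ∀ g h, c (g * h) = c g + lam g * c h)
    (htf : ∀ h, ∀ k : ℕ, 0 < k → lam h ^ k = 1 → lam h = 1)
    (hnt : ∃ h, lam h ≠ 1) (hfix : ¬ ∃ y, ∀ h, lam h * y + c h = y) : UFS H := by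
  obtain ⟨D, hD⟩ := units_numfield lam
  obtain ⟨ε, hε, hgap⟩ := gap D
  obtain ⟨N, hN⟩ : ∃ N : ℕ, (8 : ℝ) < (1 + ε) ^ N := pow_unbounded_of_one_lt 8 (by linarith)
  refine ⟨1 + N + 1, fun S hS => ?_⟩
  set act : H → QB → QB := fun h y => lam h * y + c h with hact
  have act_mul : ∀ g h y, act (g * h) y = act g (act h y) := by
    intro g h y; simp only [hact, hc, map_mul, Units.val_mul]; ring
  have act_one : ∀ y, act 1 y = y := by
    have := hc 1 1
    simp at this
    intro y; simp [hact, this]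
  -- s with nontrivial multiplier
  obtain ⟨s, hs, hls⟩ : ∃ s ∈ S, lam s ≠ 1 := by
    by_contra hcon
    push Not at hcon
    obtain ⟨h, hh⟩ := hnt
    apply hh
    have hm : h ∈ Subgroup.closure (S : Set H) := by rw [hS]; trivial
    have hle : Subgroup.closure (S : Set H) ≤ lam.ker := by
      rw [Subgroup.closure_le]; intro x hx; exact hcon x hx
    exact hle hm
  have hls' : (lam s : QB) ≠ 1 := fun h => hls (Units.ext h)
  have h1s : (1 : QB) - lam s ≠ 0 := sub_ne_zero.2 (Ne.symm hls')
  obtain ⟨x0, hx0⟩ : ∃ x0, act s x0 = x0 := by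
    refine ⟨c s / (1 - lam s), ?_⟩
    simp only [hact]
    field_simp
    ring
  obtain ⟨t, ht, htx⟩ : ∃ t ∈ S, act t x0 ≠ x0 := by
    by_contra hcon
    push Not at hcon
    apply hfix
    refine ⟨x0, fun h => ?_⟩
    have hm : h ∈ Subgroup.closure (S : Set H) := by rw [hS]; trivial
    change act h x0 = x0
    induction hm using Subgroup.closure_induction with
    | mem x hx => exact hcon x hx
    | one => exact act_one x0
    | mul x y _ _ hx hy => rw [act_mul, hy, hx]
    | inv x _ hx =>
      have := act_mul x⁻¹ x x0
      rw [inv_mul_cancel, act_one, hx] at this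
      exact this.symm
  obtain ⟨v, hv, hvs⟩ := hgap (lam s : QB) (lam s).ne_zero (hD s) (fun k hk h1 => by
    apply hls
    exact htf s k hk (Units.ext (by simpa using h1)))
  set a := (s⁻¹) ^ N with ha
  set b := t * a * t⁻¹ with hb
  set e : QB := (lam a : QB) with he
  have hlb : (lam b : QB) = e := by
    rw [hb, map_mul, map_mul, map_inv, mul_comm (lam t), mul_inv_cancel_right]
  have hve : v e ≤ 1 / 8 := by
    rw [he, ha, map_pow, map_inv, Units.val_pow_eq_pow_val, Units.val_inv_eq_inv_val, map_pow,
      map_inv₀, inv_pow, one_div]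
    apply inv_anti₀ (by norm_num)
    exact hN.le.trans (pow_le_pow_left₀ (by linarith) hvs N)
  have hainv : ∀ k : ℕ, act ((s⁻¹) ^ k) x0 = x0 := by
    intro k
    induction k with
    | zero => rw [pow_zero, act_one]
    | succ k ih =>
      rw [pow_succ, act_mul]
      have := act_mul s⁻¹ s x0
      rw [inv_mul_cancel, act_one, hx0] at this
      rw [← this, ih]
  have hax : act a x0 = x0 := hainv N
  set x1 := act t x0 with hx1
  have hbx : act b x1 = x1 := by
    rw [hb, hx1, ← act_mul, inv_mul_cancel_right, act_mul, hax]
  have haff : ∀ g y z, act g y - act g z = lam g * (y - z) := by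
    intro g y z; simp only [hact]; ring
  have hra : ∀ y, v (act a y - x0) = v e * v (y - x0) := by
    intro y
    conv_lhs => rw [← hax]
    rw [haff, v.map_mul]
  have hrb : ∀ y, v (act b y - x1) = v e * v (y - x1) := by
    intro y
    conv_lhs => rw [← hbx]
    rw [haff, v.map_mul, hlb]
  set r := v (x1 - x0) with hr
  have hr0 : 0 < r := v.pos (sub_ne_zero.2 htx)
  have he0 : 0 ≤ v e := v.nonneg _
  have hA : ∀ y, v (y - x0) ≤ 2 * r → v (act a y - x0) ≤ r / 4 := by
    intro y hy; rw [hra]; nlinarith [v.nonneg (y - x0)]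
  have hB : ∀ y, v (y - x0) ≤ 2 * r → v (act b y - x1) ≤ 3 * r / 8 := by
    intro y hy; rw [hrb]
    have : v (y - x1) ≤ v (y - x0) + v (x1 - x0) := by
      have := v.sub_le y x0 x1
      rwa [v.map_sub x0 x1] at this
    nlinarith [v.nonneg (y - x1)]
  have hB' : ∀ y, v (y - x0) ≤ 2 * r → v (act b y - x0) ≤ 2 * r := by
    intro y hy
    have := v.sub_le (act b y) x1 x0
    have := hB y hy
    linarith
  have hw : ∀ u : List Bool, v (act (wd a b u) x0 - x0) ≤ 2 * r := by
    intro u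
    induction u with
    | nil => simp [wd, act_one]; positivity
    | cons x u ih =>
      simp only [wd, List.map_cons, List.prod_cons, act_mul] at ih ⊢
      cases x
      · exact hB' _ ih
      · exact (hA _ ih).trans (by linarith)
  refine ⟨a, b, ?_, ?_, ?_⟩
  · exact (((InBall.of_mem (show s ∈ (S : Set H) from hs)).inv.pow N)).mono (by omega)
  · have h1 := (InBall.of_mem (show t ∈ (S : Set H) from ht)).mul
      (((InBall.of_mem (show s ∈ (S : Set H) from hs)).inv.pow N))
    have h2 := h1.mul (InBall.of_mem (show t ∈ (S : Set H) from ht)).inv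
    exact h2.mono (by omega)
  · intro u u' _ heq
    have h1 := congrArg (fun g => act g x0) heq
    simp only [act_mul] at h1
    have h2 := hA _ (hw u)
    have h3 := hB _ (hw u')
    rw [← h1] at h3
    have h4 := v.sub_le x1 (act a (act (wd a b u) x0)) x0
    rw [v.map_sub x1 (act a (act (wd a b u) x0))] at h4
    linarith

end

end UG

namespace UG
open Filter Polynomial
set_option autoImplicit false
set_option linter.unusedVariables false
set_option linter.unusedSectionVars false
/-- a family of situations with size parameter `Lam`, a place and a field of bounded degree -/
structure Fam (I : Type*) where
  T : Finset ℕ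
  D : ℕ
  Lam : I → ℝ
  hLam : ∀ i, 2 ≤ Lam i
  L : I → IntermediateField ℚ QB
  hL : ∀ i (x : QB), x ∈ L i → (minpoly ℚ x).natDegree ≤ D
  v : I → AbsoluteValue QB ℝ
  hv : ∀ i, IsPl (v i)

section
variable {I : Type*} (F : Fam I)

/-- controlled integral elements -/
def Fam.O (i : I) (C : ℕ) (a : QB) : Prop := a ∈ F.L i ∧ Ctl F.T (F.Lam i ^ C) a

lemma Fam.one_le (i : I) : 1 ≤ F.Lam i := by linarith [F.hLam i]

lemma Fam.O.mono {F : Fam I} {i : I} {C C' : ℕ} {a : QB} (h : F.O i C a) (hC : C ≤ C') : F.O i C' a :=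
  ⟨h.1, h.2.mono (pow_le_pow_right₀ (F.one_le i) hC)⟩

lemma Fam.O.mul {F : Fam I} {i : I} {C C' : ℕ} {a b : QB} (h : F.O i C a) (h' : F.O i C' b) :
    F.O i (C + C') (a * b) := ⟨mul_mem h.1 h'.1, by rw [pow_add]; exact h.2.mul h'.2⟩

lemma Fam.O.add {F : Fam I} {i : I} {C : ℕ} {a b : QB} (h : F.O i C a) (h' : F.O i C b) :
    F.O i (C + 1) (a + b) := ⟨add_mem h.1 h'.1, by
      refine (h.2.add h'.2).mono ?_
      rw [pow_succ]
      have := F.hLam i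
      have : 0 < F.Lam i ^ C := by positivity
      nlinarith⟩

lemma Fam.O.neg {F : Fam I} {i : I} {C : ℕ} {a : QB} (h : F.O i C a) : F.O i C (-a) :=
  ⟨neg_mem h.1, h.2.neg⟩

lemma Fam.O.one {F : Fam I} {i : I} (C : ℕ) : F.O i C 1 :=
  ⟨one_mem _, Ctl.one (one_le_pow₀ (F.one_le i))⟩

lemma Fam.O.zero {F : Fam I} {i : I} (C : ℕ) : F.O i C 0 :=
  ⟨zero_mem _, Ctl.zero (by have := F.hLam i; positivity)⟩

/-- controlled families -/
def Fam.CF (x : I → QB) : Prop :=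
  ∃ C : ℕ, ∀ i, ∃ a b, F.O i C a ∧ F.O i C b ∧ b ≠ 0 ∧ x i = a / b

variable {F}

lemma Fam.CF.zero : F.CF (fun _ => 0) := ⟨0, fun i => ⟨0, 1, .zero 0, .one 0, one_ne_zero, by simp⟩⟩
lemma Fam.CF.one : F.CF (fun _ => 1) := ⟨0, fun i => ⟨1, 1, .one 0, .one 0, one_ne_zero, by simp⟩⟩

lemma Fam.CF.of_O {x : I → QB} (C : ℕ) (h : ∀ i, F.O i C (x i)) : F.CF x :=
  ⟨C, fun i => ⟨x i, 1, h i, .one C, one_ne_zero, by simp⟩⟩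

lemma Fam.CF.neg {x : I → QB} (hx : F.CF x) : F.CF (fun i => - x i) := by
  obtain ⟨C, h⟩ := hx
  refine ⟨C, fun i => ?_⟩
  obtain ⟨a, b, ha, hb, hb0, he⟩ := h i
  exact ⟨-a, b, ha.neg, hb, hb0, by beta_reduce; rw [he, neg_div]⟩

lemma Fam.CF.mul {x y : I → QB} (hx : F.CF x) (hy : F.CF y) : F.CF (fun i => x i * y i) := by
  obtain ⟨C, h⟩ := hx
  obtain ⟨C', h'⟩ := hy
  refine ⟨C + C', fun i => ?_⟩
  obtain ⟨a, b, ha, hb, hb0, he⟩ := h i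
  obtain ⟨a', b', ha', hb', hb0', he'⟩ := h' i
  exact ⟨a * a', b * b', ha.mul ha', hb.mul hb', mul_ne_zero hb0 hb0', by beta_reduce; rw [he, he', div_mul_div_comm]⟩

lemma Fam.CF.add {x y : I → QB} (hx : F.CF x) (hy : F.CF y) : F.CF (fun i => x i + y i) := by
  obtain ⟨C, h⟩ := hx
  obtain ⟨C', h'⟩ := hy
  refine ⟨C + C' + 1, fun i => ?_⟩
  obtain ⟨a, b, ha, hb, hb0, he⟩ := h i
  obtain ⟨a', b', ha', hb', hb0', he'⟩ := h' i
  exact ⟨a * b' + b * a', b * b', (ha.mul hb').add (hb.mul ha'), (hb.mul hb').mono (Nat.le_succ _),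
    mul_ne_zero hb0 hb0', by beta_reduce; rw [he, he', div_add_div _ _ hb0 hb0']⟩

lemma Fam.CF.sub {x y : I → QB} (hx : F.CF x) (hy : F.CF y) : F.CF (fun i => x i - y i) := by
  simpa only [sub_eq_add_neg] using hx.add hy.neg

lemma Fam.CF.inv {x : I → QB} (hx : F.CF x) : F.CF (fun i => (x i)⁻¹) := by
  obtain ⟨C, h⟩ := hx
  refine ⟨C, fun i => ?_⟩
  obtain ⟨a, b, ha, hb, hb0, he⟩ := h i
  by_cases ha0 : a = 0
  · exact ⟨0, 1, .zero C, .one C, one_ne_zero, by simp [he, ha0]⟩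
  · exact ⟨b, a, hb, ha, ha0, by beta_reduce; rw [he, inv_div]⟩

lemma Fam.CF.ite (p : I → Prop) [DecidablePred p] {x y : I → QB} (hx : F.CF x) (hy : F.CF y) :
    F.CF (fun i => if p i then x i else y i) := by
  obtain ⟨C, h⟩ := hx
  obtain ⟨C', h'⟩ := hy
  refine ⟨C + C', fun i => ?_⟩
  obtain ⟨a, b, ha, hb, hb0, he⟩ := h i
  obtain ⟨a', b', ha', hb', hb0', he'⟩ := h' i
  by_cases hp : p i
  · exact ⟨a, b, ha.mono (by omega), hb.mono (by omega), hb0, by simp [hp, he]⟩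
  · exact ⟨a', b', ha'.mono (by omega), hb'.mono (by omega), hb0', by simp [hp, he']⟩

lemma Fam.CF.sum {J : Type*} (s : Finset J) (x : J → I → QB) (hx : ∀ j ∈ s, F.CF (x j)) :
    F.CF (fun i => ∑ j ∈ s, x j i) := by
  classical
  induction s using Finset.induction_on with
  | empty => simpa using Fam.CF.zero
  | insert a s ha ih =>
    simp only [Finset.sum_insert ha]
    exact (hx a (by simp)).add (ih fun j hj => hx j (by simp [hj]))

lemma Fam.CF.prod {J : Type*} (s : Finset J) (x : J → I → QB) (hx : ∀ j ∈ s, F.CF (x j)) :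
    F.CF (fun i => ∏ j ∈ s, x j i) := by
  classical
  induction s using Finset.induction_on with
  | empty => simpa using Fam.CF.one
  | insert a s ha ih =>
    simp only [Finset.prod_insert ha]
    exact (hx a (by simp)).mul (ih fun j hj => hx j (by simp [hj]))

/-- size bound -/
lemma Fam.CF.bound {x : I → QB} (hx : F.CF x) : ∃ C : ℕ, ∀ i, F.v i (x i) ≤ F.Lam i ^ C := by
  obtain ⟨C, h⟩ := hx
  refine ⟨C + C * (F.D * (F.T.card + 2)), fun i => ?_⟩
  obtain ⟨a, b, ha, hb, hb0, he⟩ := h i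
  have h1 : 1 ≤ F.Lam i ^ C := one_le_pow₀ (F.one_le i)
  have hlow := liouville F.T _ h1 F.D b hb0 (F.hL i b hb.1) hb.2 (F.hv i)
  have hup := ha.2.pl h1 (F.hv i)
  rw [he, map_div₀, div_eq_mul_inv, pow_add, pow_mul]
  have h2 : 0 < (F.Lam i ^ C) ^ (F.D * (F.T.card + 2)) := by positivity
  refine mul_le_mul hup ?_ (inv_nonneg.2 ((F.v i).nonneg b)) (by positivity)
  rw [inv_le_comm₀ ((F.v i).pos hb0) h2]
  exact hlow

variable {ι : Type*} [Fintype ι] [DecidableEq ι]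

variable (F) in
/-- controlled matrix families -/
def Fam.CM (x : I → Matrix ι ι QB) : Prop := ∀ a b, F.CF (fun i => x i a b)

lemma Fam.CM.one : F.CM (fun _ => (1 : Matrix ι ι QB)) := by
  intro a b
  by_cases h : a = b
  · subst h; simpa using Fam.CF.one
  · simpa [h] using Fam.CF.zero

lemma Fam.CM.mul {x y : I → Matrix ι ι QB} (hx : F.CM x) (hy : F.CM y) :
    F.CM (fun i => x i * y i) := by
  intro a b
  simp only [Matrix.mul_apply]
  exact Fam.CF.sum _ (fun c i => x i a c * y i c b) fun c _ => (hx a c).mul (hy c b)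

lemma Fam.CM.add {x y : I → Matrix ι ι QB} (hx : F.CM x) (hy : F.CM y) :
    F.CM (fun i => x i + y i) := fun a b => (hx a b).add (hy a b)

lemma Fam.CM.sub {x y : I → Matrix ι ι QB} (hx : F.CM x) (hy : F.CM y) :
    F.CM (fun i => x i - y i) := fun a b => (hx a b).sub (hy a b)

lemma Fam.CM.smul {c : I → QB} {x : I → Matrix ι ι QB} (hc : F.CF c) (hx : F.CM x) :
    F.CM (fun i => c i • x i) := fun a b => hc.mul (hx a b)

lemma Fam.CM.ite (p : I → Prop) [DecidablePred p] {x y : I → Matrix ι ι QB}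
    (hx : F.CM x) (hy : F.CM y) : F.CM (fun i => if p i then x i else y i) := by
  intro a b
  have := Fam.CF.ite p (hx a b) (hy a b)
  convert this using 2 with i
  beta_reduce
  split_ifs <;> rfl

lemma Fam.CM.pow {x : I → Matrix ι ι QB} (hx : F.CM x) (n : ℕ) : F.CM (fun i => x i ^ n) := by
  induction n with
  | zero => simpa using Fam.CM.one
  | succ n ih => simp only [pow_succ]; exact ih.mul hx

lemma Fam.CM.det {x : I → Matrix ι ι QB} (hx : F.CM x) : F.CF (fun i => (x i).det) := by
  simp only [Matrix.det_apply']
  refine Fam.CF.sum _ (fun (σ : Equiv.Perm ι) i => ((Equiv.Perm.sign σ : ℤ) : QB) * ∏ j, x i (σ j) j)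
    fun σ _ => Fam.CF.mul ?_ (Fam.CF.prod _ (fun j i => x i (σ j) j) fun j _ => hx _ _)
  rcases Int.units_eq_one_or (Equiv.Perm.sign σ) with h | h
  · simpa [h] using Fam.CF.one
  · simpa [h] using Fam.CF.one.neg

lemma Fam.CM.inv {x : I → Matrix ι ι QB} (hx : F.CM x) : F.CM (fun i => (x i)⁻¹) := by
  intro a b
  have hadj : F.CF (fun i => (x i).adjugate a b) := by
    simp only [Matrix.adjugate_apply]
    refine Fam.CM.det (x := fun i => (x i).updateRow b (Pi.single a 1)) fun c e => ?_
    by_cases h : c = b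
    · subst h
      by_cases h' : e = a
      · subst h'; simpa using Fam.CF.one
      · simpa [h'] using Fam.CF.zero
    · simpa [Matrix.updateRow_ne h] using hx c e
  simp only [Matrix.inv_def, Matrix.smul_apply, smul_eq_mul, Ring.inverse_eq_inv']
  exact hx.det.inv.mul hadj

/-- choice among finitely many controlled families -/
lemma Fam.CF.choose {J : Type*} [Fintype J] (x : J → I → QB) (hx : ∀ j, F.CF (x j)) (f : I → J) :
    F.CF (fun i => x (f i) i) := by
  classical
  have h := Fam.CF.sum (F := F) Finset.univ (fun j i => if f i = j then x j i else 0)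
    (fun j _ => Fam.CF.ite (fun i => f i = j) (hx j) Fam.CF.zero)
  simpa using h

/-- sum norm -/
noncomputable def nu (v : AbsoluteValue QB ℝ) (x : Matrix ι ι QB) : ℝ := ∑ a, ∑ b, v (x a b)

lemma nu_nonneg (v : AbsoluteValue QB ℝ) (x : Matrix ι ι QB) : 0 ≤ nu v x :=
  Finset.sum_nonneg fun a _ => Finset.sum_nonneg fun b _ => v.nonneg _

lemma nu_add (v : AbsoluteValue QB ℝ) (x y : Matrix ι ι QB) : nu v (x + y) ≤ nu v x + nu v y := by
  simp only [nu, ← Finset.sum_add_distrib]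
  exact Finset.sum_le_sum fun a _ => Finset.sum_le_sum fun b _ => v.add_le _ _

lemma nu_neg (v : AbsoluteValue QB ℝ) (x : Matrix ι ι QB) : nu v (-x) = nu v x := by
  simp [nu]

lemma nu_sub (v : AbsoluteValue QB ℝ) (x y : Matrix ι ι QB) : nu v (x - y) ≤ nu v x + nu v y := by
  rw [sub_eq_add_neg, ← nu_neg v y]; exact nu_add v x (-y)

lemma nu_smul (v : AbsoluteValue QB ℝ) (c : QB) (x : Matrix ι ι QB) : nu v (c • x) = v c * nu v x := by
  simp [nu, Finset.mul_sum]

lemma le_nu (v : AbsoluteValue QB ℝ) (x : Matrix ι ι QB) (a b : ι) : v (x a b) ≤ nu v x := by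
  refine le_trans ?_ (Finset.single_le_sum (f := fun a => ∑ b, v (x a b))
    (fun a _ => Finset.sum_nonneg fun b _ => v.nonneg _) (Finset.mem_univ a))
  exact Finset.single_le_sum (f := fun b => v (x a b)) (fun b _ => v.nonneg _) (Finset.mem_univ b)

lemma nu_mul (v : AbsoluteValue QB ℝ) (x y : Matrix ι ι QB) : nu v (x * y) ≤ nu v x * nu v y := by
  have h1 : ∀ a b, v ((x * y) a b) ≤ ∑ c, v (x a c) * v (y c b) := by
    intro a b
    rw [Matrix.mul_apply]
    refine (v.sum_le _ _).trans (le_of_eq ?_)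
    simp
  calc nu v (x * y) ≤ ∑ a, ∑ b, ∑ c, v (x a c) * v (y c b) :=
        Finset.sum_le_sum fun a _ => Finset.sum_le_sum fun b _ => h1 a b
    _ = ∑ a, ∑ c, v (x a c) * ∑ b, v (y c b) := by
        refine Finset.sum_congr rfl fun a _ => ?_
        rw [Finset.sum_comm]
        simp only [Finset.mul_sum]
    _ ≤ ∑ a, ∑ c, v (x a c) * nu v y := by
        refine Finset.sum_le_sum fun a _ => Finset.sum_le_sum fun c _ => ?_
        refine mul_le_mul_of_nonneg_left ?_ (v.nonneg _)
        exact Finset.single_le_sum (f := fun c => ∑ b, v (y c b))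
          (fun a _ => Finset.sum_nonneg fun b _ => v.nonneg _) (Finset.mem_univ c)
    _ = nu v x * nu v y := by simp only [nu, ← Finset.sum_mul]

lemma nu_eq_zero (v : AbsoluteValue QB ℝ) (x : Matrix ι ι QB) (h : nu v x ≤ 0) : x = 0 := by
  ext a b
  have := (le_nu v x a b).trans h
  exact v.eq_zero.1 (le_antisymm this (v.nonneg _))

lemma pow_sum_bound {J : Type*} (Lam : J → ℝ) (hLam : ∀ i, 2 ≤ Lam i) (K : Type*) [Fintype K]
    (f : K → J → ℝ) (h : ∀ k, ∃ C : ℕ, ∀ i, f k i ≤ Lam i ^ C) :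
    ∃ C : ℕ, ∀ i, ∑ k, f k i ≤ Lam i ^ C := by
  choose C hC using h
  refine ⟨Fintype.card K + ∑ k, C k, fun i => ?_⟩
  have h1 : 1 ≤ Lam i := by linarith [hLam i]
  calc ∑ k, f k i ≤ ∑ k : K, Lam i ^ (∑ k, C k) := Finset.sum_le_sum fun k _ =>
        (hC k i).trans (pow_le_pow_right₀ h1 (Finset.single_le_sum (f := C) (fun _ _ => Nat.zero_le _) (Finset.mem_univ k)))
    _ = Fintype.card K * Lam i ^ (∑ k, C k) := by simp
    _ ≤ Lam i ^ Fintype.card K * Lam i ^ (∑ k, C k) := by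
        refine mul_le_mul_of_nonneg_right ?_ (by positivity)
        calc (Fintype.card K : ℝ) ≤ 2 ^ Fintype.card K := by
              exact_mod_cast (Nat.lt_two_pow_self).le
          _ ≤ _ := pow_le_pow_left₀ (by norm_num) (hLam i) _
    _ = _ := by rw [pow_add]

lemma Fam.CM.bound {x : I → Matrix ι ι QB} (hx : F.CM x) :
    ∃ C : ℕ, ∀ i, nu (F.v i) (x i) ≤ F.Lam i ^ C := by
  unfold nu
  exact pow_sum_bound F.Lam F.hLam ι (fun a i => ∑ b, F.v i (x i a b)) fun a =>
    pow_sum_bound F.Lam F.hLam ι (fun b i => F.v i (x i a b)) fun b => (hx a b).bound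

/-- lower bounds for nonzero controlled matrices -/
lemma Fam.CM.lower {x : I → Matrix ι ι QB} (hx : F.CM x) (h0 : ∀ i, x i ≠ 0) :
    ∃ C : ℕ, ∀ i, 1 ≤ F.Lam i ^ C * nu (F.v i) (x i) := by
  have h1 : ∀ i, ∃ p : ι × ι, x i p.1 p.2 ≠ 0 := by
    intro i
    by_contra hcon
    push Not at hcon
    exact h0 i (by ext a b; exact hcon (a, b))
  choose p hp using h1
  have h2 : F.CF (fun i => x i (p i).1 (p i).2) :=
    Fam.CF.choose (fun (q : ι × ι) i => x i q.1 q.2) (fun q => hx q.1 q.2) p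
  obtain ⟨C, hC⟩ := h2.inv.bound
  refine ⟨C, fun i => ?_⟩
  have hpos := (F.v i).pos (hp i)
  have h3 := hC i
  rw [map_inv₀] at h3
  calc (1 : ℝ) = ((F.v i) (x i (p i).1 (p i).2))⁻¹ * F.v i (x i (p i).1 (p i).2) :=
        (inv_mul_cancel₀ hpos.ne').symm
    _ ≤ F.Lam i ^ C * nu (F.v i) (x i) :=
        mul_le_mul h3 (le_nu _ _ _ _) hpos.le (by have := F.one_le i; positivity)

end

end UG

namespace UG
open Filter Polynomial
set_option autoImplicit false
set_option linter.unusedVariables false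
set_option linter.unusedSectionVars false
section
variable {ι : Type*} [Fintype ι] [DecidableEq ι]

lemma nu_small_inv (v : AbsoluteValue QB ℝ) (z : Matrix ι ι QB) (hz : nu v z ≤ 1/2) :
    ∃ u, u * (1 + z) = 1 ∧ (1 + z) * u = 1 ∧ nu v u ≤ 2 * nu v (1 : Matrix ι ι QB) := by
  have hdet : IsUnit (1 + z).det := by
    rw [isUnit_iff_ne_zero]
    intro h0
    obtain ⟨x, hx0, hx⟩ := Matrix.exists_mulVec_eq_zero_iff.2 h0
    have h1 : (1 + z) * (Matrix.of fun i (_ : ι) => x i) = 0 := by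
      ext i j
      have := congrFun hx i
      simpa [Matrix.mul_apply, Matrix.mulVec, dotProduct] using this
    set X : Matrix ι ι QB := Matrix.of fun i (_ : ι) => x i with hX
    have h2 : X = - (z * X) := by
      rw [add_mul, one_mul] at h1
      exact eq_neg_of_add_eq_zero_left h1
    have h3 : nu v X ≤ nu v z * nu v X := by
      conv_lhs => rw [h2, nu_neg]
      exact nu_mul _ _ _
    have h4 := nu_nonneg v X
    have h5 : X = 0 := nu_eq_zero v X (by nlinarith)
    apply hx0
    ext i
    exact congrFun (congrFun h5 i) i
  refine ⟨(1 + z)⁻¹, Matrix.nonsing_inv_mul _ hdet, Matrix.mul_nonsing_inv _ hdet, ?_⟩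
  have h1 := Matrix.mul_nonsing_inv _ hdet
  set u := (1 + z)⁻¹
  have h2 : u = 1 - z * u := by
    rw [add_mul, one_mul] at h1
    exact eq_sub_of_add_eq h1
  have h3 : nu v u ≤ nu v (1 : Matrix ι ι QB) + nu v z * nu v u := by
    conv_lhs => rw [h2]
    exact (nu_sub _ _ _).trans (by gcongr; exact nu_mul _ _ _)
  have h4 := nu_nonneg v u
  nlinarith

/-- state of a word: the image of `P` is a graph of slope `m` -/
def Slope (P Q w m : Matrix ι ι QB) : Prop :=
  Q * m = m ∧ m * P = m ∧ ∃ a a', P * a = a ∧ a * P = a ∧ P * a' = a' ∧ a' * P = a' ∧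
    a * a' = P ∧ w * P = (P + m) * a

lemma Slope.unique {P Q w m m' : Matrix ι ι QB} (hPQ : P * Q = 0) (hPP : P * P = P)
    (h : Slope P Q w m) (h' : Slope P Q w m') : m = m' := by
  obtain ⟨h1, h2, a, a', ha1, ha2, ha3, ha4, ha5, hw⟩ := h
  obtain ⟨h1', h2', b, b', hb1, hb2, hb3, hb4, hb5, hw'⟩ := h'
  have hPm : P * m = 0 := by rw [← h1, ← mul_assoc, hPQ, zero_mul]
  have hPm' : P * m' = 0 := by rw [← h1', ← mul_assoc, hPQ, zero_mul]
  have e := hw.symm.trans hw'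
  have e1 : a = b := by
    have := congrArg (fun X => P * X) e
    simpa only [← mul_assoc, mul_add, hPP, hPm, hPm', add_zero, ha1, hb1] using this
  subst e1
  rw [add_mul, add_mul] at e
  have e2 := add_left_cancel e
  calc m = m * a * a' := by rw [mul_assoc, ha5, h2]
    _ = m' * a * a' := by rw [e2]
    _ = m' := by rw [mul_assoc, ha5, h2']

lemma Slope.stepA {P Q w m A A' : Matrix ι ι QB} (hAA' : A * A' = 1) (hA'A : A' * A = 1)
    (hPP : P * P = P) (hAP : A * P = P * A) (hAQ : A * Q = Q * A) (h : Slope P Q w m) :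
    Slope P Q (A * w) (A * Q * m * (A' * P)) := by
  obtain ⟨h1, h2, a, a', ha1, ha2, ha3, ha4, ha5, hw⟩ := h
  have hA'P : A' * P = P * A' := by
    calc A' * P = A' * (P * (A * A')) := by rw [hAA', mul_one]
      _ = A' * (A * P) * A' := by rw [hAP]; simp only [mul_assoc]
      _ = P * A' := by rw [← mul_assoc, hA'A, one_mul]
  have hm : A * Q * m = A * m := by rw [mul_assoc, h1]
  rw [hm]
  refine ⟨?_, ?_, A * a, a' * A', ?_, ?_, ?_, ?_, ?_, ?_⟩
  · rw [← mul_assoc Q, ← mul_assoc Q A, ← hAQ, mul_assoc A Q m, h1]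
  · rw [mul_assoc, mul_assoc A', hPP]
  · rw [← mul_assoc, ← hAP, mul_assoc, ha1]
  · rw [mul_assoc, ha2]
  · rw [← mul_assoc, ha3]
  · rw [mul_assoc, hA'P, ← mul_assoc, ha4]
  · rw [mul_assoc, ← mul_assoc a, ha5, ← mul_assoc, hAP, mul_assoc, hAA', mul_one]
  · rw [mul_assoc, hw, add_mul, add_mul, mul_add]
    congr 1
    · rw [← mul_assoc P, ← hAP, mul_assoc]
    · calc A * (m * a) = A * m * (P * a) := by rw [ha1, mul_assoc]
        _ = A * m * (P * (A' * A) * a) := by rw [hA'A, mul_one]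
        _ = A * m * (A' * P) * (A * a) := by rw [hA'P]; simp only [mul_assoc]

lemma Slope.stepH {P Q w m h y u : Matrix ι ι QB}
    (hPP : P * P = P) (hPQ1 : P + Q = 1) (hQP : Q * P = 0) (hPQ : P * Q = 0) (hQQ : Q * Q = Q)
    (hy1 : P * y = y) (hy2 : y * P = y)
    (hy3 : P * h * P * y = P) (hy4 : y * (P * h * P) = P)
    (hu1 : u * (1 + y * h * m) = 1) (hu2 : (1 + y * h * m) * u = 1)
    (hs : Slope P Q w m) :
    Slope P Q (h * w) ((Q * h * P + Q * h * m) * u * y) ∧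
    ((Q * h * P + Q * h * m) * u * y) * (P * h * P + P * h * m) = Q * h * P + Q * h * m := by
  obtain ⟨h1, h2, a, a', ha1, ha2, ha3, ha4, ha5, hw⟩ := hs
  have hPz : P * (y * h * m) = y * h * m := by rw [← mul_assoc, ← mul_assoc, hy1]
  have hzP : (y * h * m) * P = y * h * m := by rw [mul_assoc, h2]
  set z := y * h * m with hz
  have hcomm : P * (1 + z) = (1 + z) * P := by rw [mul_add, add_mul, hPz, hzP, mul_one, one_mul]
  have huP : u * P = P * u := by
    calc u * P = u * (P * ((1 + z) * u)) := by rw [hu2, mul_one]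
      _ = u * (P * (1 + z)) * u := by simp only [mul_assoc]
      _ = (u * (1 + z)) * P * u := by rw [hcomm]; simp only [mul_assoc]
      _ = P * u := by rw [hu1, one_mul]
  have hfac : P * h * P + P * h * m = P * h * P * (1 + z) := by
    rw [mul_add, mul_one, hz]
    congr 1
    calc P * h * m = P * h * P * y * h * m := by rw [hy3]
      _ = _ := by simp only [mul_assoc]
  have hphp : P * (P * h * P) = P * h * P := by simp only [← mul_assoc, hPP]
  have hM : (Q * h * P + Q * h * m) * P = Q * h * P + Q * h * m := by
    rw [add_mul, mul_assoc (Q * h), hPP, mul_assoc (Q * h), h2]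
  have key : ((Q * h * P + Q * h * m) * u * y) * (P * h * P + P * h * m) = Q * h * P + Q * h * m := by
    rw [hfac]
    calc (Q * h * P + Q * h * m) * u * y * (P * h * P * (1 + z))
        = (Q * h * P + Q * h * m) * u * (y * (P * h * P)) * (1 + z) := by simp only [mul_assoc]
      _ = (Q * h * P + Q * h * m) * (u * P) * (1 + z) := by rw [hy4]; simp only [mul_assoc]
      _ = (Q * h * P + Q * h * m) * P * (u * (1 + z)) := by rw [huP]; simp only [mul_assoc]
      _ = _ := by rw [hu1, mul_one, hM]
  refine ⟨⟨?_, ?_, (P * h * P + P * h * m) * a, a' * u * y, ?_, ?_, ?_, ?_, ?_, ?_⟩, key⟩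
  · simp only [← mul_assoc, mul_add, hQQ]
  · rw [mul_assoc, hy2]
  · simp only [← mul_assoc, mul_add, hPP]
  · rw [mul_assoc, ha2]
  · simp only [← mul_assoc, ha3]
  · rw [mul_assoc, hy2]
  · rw [hfac]
    calc P * h * P * (1 + z) * a * (a' * u * y) = P * h * P * (1 + z) * (a * a') * u * y := by
          simp only [mul_assoc]
      _ = P * h * P * (1 + z) * (P * u) * y := by rw [ha5]; simp only [mul_assoc]
      _ = P * h * P * ((1 + z) * u) * (P * y) := by rw [← huP]; simp only [mul_assoc]
      _ = P := by rw [hu2, mul_one, hy1, hy3]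
  · rw [mul_assoc, hw, add_mul (P) (_ * u * y), ← mul_assoc (_ * u * y), key]
    have : h * ((P + m) * a) = (P + Q) * (h * ((P + m) * a)) := by rw [hPQ1, one_mul]
    rw [this]
    simp only [mul_add, add_mul, ← mul_assoc, hPP]
    abel

theorem pingpong (v : AbsoluteValue QB ℝ) {P Q A A' h y : Matrix ι ι QB} {K α : ℝ}
    (hAA' : A * A' = 1) (hA'A : A' * A = 1)
    (hPP : P * P = P) (hPQ1 : P + Q = 1) (hAP : A * P = P * A)
    (hy1 : P * y = y) (hy2 : y * P = y)
    (hy3 : P * h * P * y = P) (hy4 : y * (P * h * P) = P)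
    (hK : 1 ≤ K) (k1 : nu v (1 : Matrix ι ι QB) ≤ K) (k2 : nu v (y * h) ≤ K)
    (k3 : nu v (Q * h) ≤ K) (k4 : nu v (Q * h * P) ≤ K) (k5 : nu v (P * h) ≤ K)
    (k6 : nu v (P * h * P) ≤ K) (k7 : nu v y ≤ K) (k8 : 1 ≤ K * nu v (Q * h * P))
    (hα0 : nu v (A * Q) * nu v (A' * P) ≤ α) (hα : α * (16 * K ^ 5) < 1) :
    FreePair A (h * A) := by
  have hQ : Q = 1 - P := by rw [← hPQ1]; abel
  have hQP : Q * P = 0 := by rw [hQ, sub_mul, hPP, one_mul, sub_self]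
  have hPQ : P * Q = 0 := by rw [hQ, mul_sub, hPP, mul_one, sub_self]
  have hQQ : Q * Q = Q := by rw [hQ, mul_sub, mul_one, ← hQ, hQP, sub_zero]
  have hAQ : A * Q = Q * A := by rw [hQ, mul_sub, sub_mul, hAP, mul_one, one_mul]
  have hα1 : 0 ≤ α := (mul_nonneg (nu_nonneg _ _) (nu_nonneg _ _)).trans hα0
  set κ : ℝ := 4 * K ^ 3 with hκ
  have hακ : α * κ * (4 * K ^ 2) < 1 := by
    calc α * κ * (4 * K ^ 2) = α * (16 * K ^ 5) := by rw [hκ]; ring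
      _ < 1 := hα
  have hακ0 : 0 ≤ α * κ := by positivity
  have hK2 : 1 ≤ K ^ 2 := one_le_pow₀ hK
  have hακ1 : α * κ ≤ 1 := by nlinarith
  -- A step
  have stA : ∀ w m, Slope P Q w m → nu v m ≤ κ → ∃ m', Slope P Q (A * w) m' ∧ nu v m' ≤ α * κ := by
    intro w m hs hm
    refine ⟨_, hs.stepA hAA' hA'A hPP hAP hAQ, ?_⟩
    calc nu v (A * Q * m * (A' * P)) ≤ nu v (A * Q) * nu v m * nu v (A' * P) :=
          (nu_mul _ _ _).trans (mul_le_mul_of_nonneg_right (nu_mul _ _ _) (nu_nonneg _ _))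
      _ = (nu v (A * Q) * nu v (A' * P)) * nu v m := by ring
      _ ≤ α * κ := mul_le_mul hα0 hm (nu_nonneg _ _) hα1
  have stH : ∀ w m, Slope P Q w m → nu v m ≤ α * κ → ∃ m', Slope P Q (h * w) m' ∧ nu v m' ≤ κ ∧
      α * κ < nu v m' := by
    intro w m hs hm
    have hz : nu v (y * h * m) ≤ 1 / 2 := by
      have h1 : nu v (y * h * m) ≤ K * (α * κ) :=
        (nu_mul _ _ _).trans (mul_le_mul k2 hm (nu_nonneg _ _) (by linarith))
      nlinarith
    obtain ⟨u, hu1, hu2, hu3⟩ := nu_small_inv v _ hz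
    obtain ⟨hs', key⟩ := Slope.stepH hPP hPQ1 hQP hPQ hQQ hy1 hy2 hy3 hy4 hu1 hu2 hs
    have hqm : nu v (Q * h * m) ≤ K * (α * κ) :=
      (nu_mul _ _ _).trans (mul_le_mul k3 hm (nu_nonneg _ _) (by linarith))
    have hpm : nu v (P * h * m) ≤ K * (α * κ) :=
      (nu_mul _ _ _).trans (mul_le_mul k5 hm (nu_nonneg _ _) (by linarith))
    have hM : nu v (Q * h * P + Q * h * m) ≤ 2 * K := (nu_add _ _ _).trans (by nlinarith)
    have hN : nu v (P * h * P + P * h * m) ≤ 2 * K := (nu_add _ _ _).trans (by nlinarith)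
    refine ⟨_, hs', ?_, ?_⟩
    · calc _ ≤ nu v (Q * h * P + Q * h * m) * nu v u * nu v y :=
          (nu_mul _ _ _).trans (mul_le_mul_of_nonneg_right (nu_mul _ _ _) (nu_nonneg _ _))
        _ ≤ (2 * K) * (2 * K) * K := by
          refine mul_le_mul (mul_le_mul hM (hu3.trans (by linarith)) (nu_nonneg _ _) (by linarith)) k7
            (nu_nonneg _ _) (by nlinarith)
        _ = κ := by rw [hκ]; ring
    · by_contra hcon
      push Not at hcon
      set m2 := (Q * h * P + Q * h * m) * u * y
      have e : Q * h * P = m2 * (P * h * P + P * h * m) - Q * h * m := by rw [key]; abel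
      have h1 : nu v (Q * h * P) ≤ (α * κ) * (2 * K) + K * (α * κ) := by
        rw [e]
        refine (nu_sub _ _ _).trans (add_le_add ((nu_mul _ _ _).trans ?_) hqm)
        exact mul_le_mul hcon hN (nu_nonneg _ _) hακ0
      have h2 : K * nu v (Q * h * P) ≤ α * κ * (3 * K ^ 2) := by
        calc _ ≤ K * ((α * κ) * (2 * K) + K * (α * κ)) := by gcongr
          _ = _ := by ring
      nlinarith
  have hκα : α * κ ≤ κ := by
    have : (1:ℝ) ≤ K ^ 3 := one_le_pow₀ hK
    have : (1 : ℝ) ≤ κ := by rw [hκ]; linarith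
    linarith
  have words : ∀ l : List Bool, ∃ m, Slope P Q (wd A (h * A) l) m ∧ nu v m ≤ κ := by
    intro l
    induction l with
    | nil =>
      refine ⟨0, ⟨by simp, by simp, P, P, hPP, hPP, hPP, hPP, hPP, by simp [wd, hPP]⟩, ?_⟩
      have : nu v (0 : Matrix ι ι QB) = 0 := by simp [nu]
      rw [this]; positivity
    | cons c l ih =>
      obtain ⟨m, hs, hm⟩ := ih
      obtain ⟨m1, hs1, hm1⟩ := stA _ _ hs hm
      cases c with
      | true => exact ⟨m1, by simpa [wd] using hs1, hm1.trans hκα⟩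
      | false =>
        obtain ⟨m2, hs2, hm2, _⟩ := stH _ _ hs1 hm1
        exact ⟨m2, by simpa [wd, mul_assoc] using hs2, hm2⟩
  intro l l' _ heq
  obtain ⟨m, hs, hm⟩ := words l
  obtain ⟨m1, hs1, hm1⟩ := stA _ _ hs hm
  obtain ⟨n, hs', hn⟩ := words l'
  obtain ⟨n1, hs1', hn1⟩ := stA _ _ hs' hn
  obtain ⟨n2, hs2', _, hn2⟩ := stH _ _ hs1' hn1
  rw [heq] at hs1
  rw [mul_assoc] at hs1
  have := hs1.unique hPQ hPP hs2'
  rw [this] at hm1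
  linarith

end

end UG

namespace UG
open Filter Polynomial
set_option autoImplicit false
set_option linter.unusedVariables false
set_option linter.unusedSectionVars false
lemma gap_lemma (F : Finset ℝ) (t b : ℝ) (ht : 1 ≤ t) (hb : b ∈ F) (n : ℕ) :
    ∀ a ∈ F, 0 < a → (F.filter (fun y => a < y)).card ≤ n → a * t ^ n < b →
    ∃ r ∈ F, a ≤ r ∧ (∀ x ∈ F, x ≤ r ∨ t * r < x) ∧ ∃ x ∈ F, t * r < x := by
  induction n with
  | zero =>
    intro a ha ha0 hc hab
    exfalso
    have : b ∈ F.filter (fun y => a < y) := by simp [hb]; simpa using hab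
    rw [Nat.le_zero, Finset.card_eq_zero] at hc
    simp [hc] at this
  | succ n ih =>
    intro a ha ha0 hc hab
    by_cases h : ∃ x ∈ F, a < x ∧ x ≤ t * a
    · obtain ⟨x, hx, hax, hxt⟩ := h
      obtain ⟨r, hr, hxr, h1⟩ := ih x hx (ha0.trans hax) (by
        have : (F.filter (fun y => x < y)).card < (F.filter (fun y => a < y)).card := by
          apply Finset.card_lt_card
          rw [Finset.ssubset_iff_of_subset]
          · exact ⟨x, by simp [hx, hax], by simp⟩
          · intro y hy
            simp only [Finset.mem_filter] at hy ⊢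
            exact ⟨hy.1, hax.trans hy.2⟩
        omega) (by
          calc x * t ^ n ≤ t * a * t ^ n := by gcongr
            _ = a * t ^ (n + 1) := by ring
            _ < b := hab)
      exact ⟨r, hr, hax.le.trans hxr, h1⟩
    · push Not at h
      refine ⟨a, ha, le_rfl, ?_, b, hb, ?_⟩
      · intro x hx
        by_cases hxa : a < x
        · exact Or.inr (h x hx hxa)
        · exact Or.inl (not_lt.1 hxa)
      · refine h b hb ?_
        have : 1 ≤ t ^ (n + 1) := one_le_pow₀ ht
        nlinarith

section
variable {ι : Type*} [Fintype ι] [DecidableEq ι]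

lemma pow_expand {R : Type*} [Ring R] [Algebra QB R] (x : R) (μ : QB) (y : R) (N : ℕ) :
    x ^ N * y = μ ^ N • y + ∑ i ∈ Finset.range N, μ ^ (N - 1 - i) • (x ^ i * ((x - algebraMap QB R μ) * y)) := by
  induction N with
  | zero => simp
  | succ N ih =>
    have h1 : x ^ (N + 1) * y = x ^ N * ((x - algebraMap QB R μ) * y) + μ • (x ^ N * y) := by
      rw [sub_mul, mul_sub, ← mul_assoc, ← pow_succ, Algebra.smul_def,
        ← mul_assoc (x ^ N), ← mul_assoc _ (x ^ N), Algebra.commutes]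
      abel
    rw [h1, ih, smul_add, Finset.sum_range_succ, Finset.smul_sum, smul_smul, ← pow_succ']
    have : ∀ i ∈ Finset.range N, μ • μ ^ (N - 1 - i) • (x ^ i * ((x - algebraMap QB R μ) * y)) =
        μ ^ (N + 1 - 1 - i) • (x ^ i * ((x - algebraMap QB R μ) * y)) := by
      intro i hi
      rw [Finset.mem_range] at hi
      rw [smul_smul, ← pow_succ']
      congr 2
      omega
    rw [Finset.sum_congr rfl this]
    simp
    abel

lemma power_bound (v : AbsoluteValue QB ℝ) (x : Matrix ι ι QB) (r τ : ℝ) (hr : 0 ≤ r) (hτ : 1 ≤ τ)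
    (l : List QB) : ∀ (y : Matrix ι ι QB), (∀ μ ∈ l, v μ ≤ r ∧ nu v (x - algebraMap QB _ μ) ≤ r * τ) →
    aeval x ((l.map (fun μ => X - C μ)).prod) * y = 0 → ∀ N : ℕ,
    nu v (x ^ N * y) ≤ (N + 1 : ℝ) ^ l.length * r ^ N * τ ^ l.length * nu v y := by
  induction l with
  | nil =>
    intro y _ hy N
    have : y = 0 := by simpa using hy
    simp [this, nu]
  | cons μ l ih =>
    intro y hl hy N
    have hμ := hl μ (by simp)
    have hy' : aeval x ((l.map (fun μ => X - C μ)).prod) * ((x - algebraMap QB _ μ) * y) = 0 := by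
      rw [← mul_assoc, ← hy]
      congr 1
      rw [List.map_cons, List.prod_cons, mul_comm, map_mul]
      congr 1
      simp
    have ih' := ih _ (fun μ hμ => hl μ (by simp [hμ])) hy'
    have hy2 : nu v ((x - algebraMap QB _ μ) * y) ≤ r * τ * nu v y :=
      (nu_mul _ _ _).trans (mul_le_mul_of_nonneg_right hμ.2 (nu_nonneg _ _))
    have sum_nu : ∀ (s : Finset ℕ) (f : ℕ → Matrix ι ι QB), nu v (∑ i ∈ s, f i) ≤ ∑ i ∈ s, nu v (f i) := by
      intro s f
      induction s using Finset.induction_on with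
      | empty => simp [nu]
      | insert a s ha ih => 
        rw [Finset.sum_insert ha, Finset.sum_insert ha]
        exact (nu_add _ _ _).trans (by gcongr)
    set n := l.length
    have hyn := nu_nonneg v y
    have hterm : ∀ i ∈ Finset.range N, nu v (μ ^ (N - 1 - i) • (x ^ i * ((x - algebraMap QB _ μ) * y)))
        ≤ (N + 1 : ℝ) ^ n * r ^ N * τ ^ (n + 1) * nu v y := by
      intro i hi
      rw [Finset.mem_range] at hi
      rw [nu_smul, map_pow]
      calc v μ ^ (N - 1 - i) * nu v (x ^ i * ((x - algebraMap QB _ μ) * y))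
          ≤ r ^ (N - 1 - i) * ((i + 1 : ℝ) ^ n * r ^ i * τ ^ n * (r * τ * nu v y)) := by
            refine mul_le_mul (pow_le_pow_left₀ (v.nonneg _) hμ.1 _) ((ih' i).trans ?_) (nu_nonneg _ _) (by positivity)
            gcongr
        _ = (i + 1 : ℝ) ^ n * (r ^ (N - 1 - i) * r ^ i * r) * τ ^ (n + 1) * nu v y := by ring
        _ = (i + 1 : ℝ) ^ n * r ^ N * τ ^ (n + 1) * nu v y := by
            rw [← pow_add, ← pow_succ]; congr 4; omega
        _ ≤ _ := by
            gcongr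
    rw [pow_expand x μ y N]
    calc _ ≤ r ^ N * nu v y + N * ((N + 1 : ℝ) ^ n * r ^ N * τ ^ (n + 1) * nu v y) := by
          refine (nu_add _ _ _).trans (add_le_add ?_ ?_)
          · rw [nu_smul, map_pow]
            gcongr
            exact hμ.1
          · refine (sum_nu _ _).trans ((Finset.sum_le_sum hterm).trans ?_)
            simp
      _ ≤ (N + 1 : ℝ) ^ (n + 1) * r ^ N * τ ^ (n + 1) * nu v y := by
          have h1 : (1 : ℝ) ≤ (N + 1 : ℝ) ^ n * τ ^ (n + 1) := 
            one_le_mul_of_one_le_of_one_le (one_le_pow₀ (by simp)) (one_le_pow₀ hτ)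
          have h2 : 0 ≤ r ^ N * nu v y := by positivity
          calc _ ≤ (r ^ N * nu v y) * ((N + 1 : ℝ) ^ n * τ ^ (n + 1)) + N * ((N + 1 : ℝ) ^ n * r ^ N * τ ^ (n + 1) * nu v y) := by
                nlinarith
            _ = _ := by ring
      _ = _ := by simp [n]

end

/-- separating polynomial -/
noncomputable def sepPoly {d : ℕ} (μ : Fin d → QB) (B : Finset (Fin d)) : QB[X] :=
  ∏ j ∈ Bᶜ, (1 - ∏ l ∈ B, C (μ j - μ l)⁻¹ * (X - C (μ l)))

lemma sep_top {d : ℕ} (μ : Fin d → QB) (B : Finset (Fin d)) (h : ∀ j ∈ Bᶜ, ∀ l ∈ B, μ j ≠ μ l) :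
    (∏ j ∈ Bᶜ, (X - C (μ j))) ∣ sepPoly μ B := by
  refine Finset.prod_dvd_prod_of_dvd _ _ fun j hj => ?_
  rw [dvd_iff_isRoot, IsRoot.def, eval_sub, eval_one, eval_prod]
  rw [sub_eq_zero]
  symm
  refine Finset.prod_eq_one fun l hl => ?_
  have := sub_ne_zero.2 (h j hj l hl)
  simp [this]

lemma sep_bot {d : ℕ} (μ : Fin d → QB) (B : Finset (Fin d)) (hB : B.Nonempty) :
    (∏ l ∈ B, (X - C (μ l))) ∣ 1 - sepPoly μ B := by
  have key : ∀ s : Finset (Fin d), (∏ l ∈ B, (X - C (μ l))) ∣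
      1 - ∏ j ∈ s, (1 - ∏ l ∈ B, C (μ j - μ l)⁻¹ * (X - C (μ l))) := by
    intro s
    induction s using Finset.induction_on with
    | empty => simp
    | insert a s ha ih =>
      rw [Finset.prod_insert ha]
      set p := ∏ j ∈ s, (1 - ∏ l ∈ B, C (μ j - μ l)⁻¹ * (X - C (μ l)))
      have : 1 - (1 - ∏ l ∈ B, C (μ a - μ l)⁻¹ * (X - C (μ l))) * p =
        (1 - p) + (∏ l ∈ B, C (μ a - μ l)⁻¹ * (X - C (μ l))) * p := by ring
      rw [this]
      refine dvd_add ih (Dvd.dvd.mul_right ?_ _)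
      rw [Finset.prod_mul_distrib]
      exact Dvd.intro_left _ rfl
  exact key _

/-- root multiplicities of `p(X^j)` -/
lemma rootMult_expand (p : QB[X]) (hp : p ≠ 0) (μ : QB) (hμ : μ ≠ 0) (j : ℕ) (hj : 0 < j) :
    (expand QB j p).rootMultiplicity μ ≤ p.rootMultiplicity (μ ^ j) := by
  classical
  obtain ⟨r, hr, hr0⟩ := exists_eq_pow_rootMultiplicity_mul_and_not_dvd p hp (μ ^ j)
  set e := p.rootMultiplicity (μ ^ j)
  have hr1 : eval (μ ^ j) r ≠ 0 := by
    intro h; exact hr0 (dvd_iff_isRoot.2 h)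
  have hne : expand QB j p ≠ 0 := by rwa [Ne, expand_eq_zero hj]
  have h1 : expand QB j p = (X ^ j - C (μ ^ j)) ^ e * expand QB j r := by
    conv_lhs => rw [hr]
    simp
  have hq : (X ^ j - C (μ ^ j) : QB[X]).rootMultiplicity μ ≤ 1 := by
    have hn0 : (X ^ j - C (μ ^ j) : QB[X]) ≠ 0 := X_pow_sub_C_ne_zero hj _
    by_contra hcon
    push Not at hcon
    have := (one_lt_rootMultiplicity_iff_isRoot hn0).1 hcon
    have h2 := this.2
    rw [IsRoot.def, derivative_sub, derivative_X_pow, derivative_C, sub_zero] at h2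
    simp [hμ, hj.ne'] at h2
  have hr2 : (expand QB j r).rootMultiplicity μ = 0 := by
    apply rootMultiplicity_eq_zero
    rw [IsRoot.def, expand_eval]; exact hr1
  have hne' := hne
  rw [h1] at hne'
  rw [h1, rootMultiplicity_mul hne', hr2, ← count_roots, roots_pow, Multiset.count_nsmul, count_roots, add_zero]
  calc e * _ ≤ e * 1 := Nat.mul_le_mul_left _ hq
    _ = e := mul_one _

lemma neat_pow {d : ℕ} (s : Matrix (Fin d) (Fin d) QB) (hs : ∀ μ, s.charpoly.IsRoot μ → μ ≠ 0)
    (hN : ∀ μ μ', s.charpoly.IsRoot μ → s.charpoly.IsRoot μ' → ∀ k : ℕ, 0 < k → μ ^ k = μ' ^ k → μ = μ')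
    (j : ℕ) (hj : 0 < j) : ∃ f : QB[X], aeval (s ^ j) f = s := by
  classical
  have hintg : IsIntegral QB s := IsIntegral.of_finite QB s
  have hintj : IsIntegral QB (s ^ j) := IsIntegral.of_finite QB _
  set m := minpoly QB s with hm
  set p := minpoly QB (s ^ j) with hp
  have hp0 : p ≠ 0 := minpoly.ne_zero hintj
  have hm0 : m ≠ 0 := minpoly.ne_zero hintg
  have hdvd : m ∣ expand QB j p := by
    apply minpoly.dvd
    rw [expand_aeval]
    exact minpoly.aeval _ _
  have he0 : expand QB j p ≠ 0 := by rwa [Ne, expand_eq_zero hj]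
  have hroot : ∀ μ ∈ m.roots, s.charpoly.IsRoot μ := by
    intro μ hμ
    exact (isRoot_of_mem_roots hμ).dvd (minpoly.dvd _ _ (Matrix.aeval_self_charpoly s))
  have hdeg : m.natDegree ≤ p.natDegree := by
    classical
    rw [← (IsAlgClosed.splits m).natDegree_eq_card_roots.symm]
    rw [← Multiset.toFinset_sum_count_eq]
    calc ∑ μ ∈ m.roots.toFinset, m.roots.count μ
        ≤ ∑ μ ∈ m.roots.toFinset, p.roots.count (μ ^ j) := by
          refine Finset.sum_le_sum fun μ hμ => ?_
          rw [Multiset.mem_toFinset] at hμ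
          rw [count_roots, count_roots]
          exact (rootMultiplicity_le_rootMultiplicity_of_dvd he0 hdvd μ).trans
            (rootMult_expand p hp0 μ (hs μ (hroot μ hμ)) j hj)
      _ = ∑ ν ∈ m.roots.toFinset.image (fun μ => μ ^ j), p.roots.count ν := by
          rw [Finset.sum_image]
          intro a ha b hb hab
          simp only [Finset.mem_coe, Multiset.mem_toFinset] at ha hb
          exact hN a b (hroot a ha) (hroot b hb) j hj hab
      _ ≤ ∑ ν ∈ p.roots.toFinset, p.roots.count ν :=
          Finset.sum_le_sum_of_ne_zero fun ν _ h => Multiset.mem_toFinset.2 (Multiset.count_ne_zero.1 h)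
      _ = Multiset.card p.roots := Multiset.toFinset_sum_count_eq _
      _ ≤ p.natDegree := card_roots' p
  have hle : Algebra.adjoin QB {s ^ j} ≤ Algebra.adjoin QB {s} := by
    rw [Algebra.adjoin_le_iff, Set.singleton_subset_iff]
    exact pow_mem (Algebra.self_mem_adjoin_singleton QB s) j
  have h1 : Module.finrank QB (Algebra.adjoin QB {s}) ≤ m.natDegree := by
    have := Submodule.span_range_natDegree_eq_adjoin (minpoly.monic hintg) (minpoly.aeval QB s)
    have h2 : Module.finrank QB (Subalgebra.toSubmodule (Algebra.adjoin QB {s})) ≤ m.natDegree := by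
      rw [← this]
      exact le_trans (finrank_span_finset_le_card _) (le_trans (@Finset.card_image_le _ _ _ _ (fun a b => Classical.propDecidable (a = b)))
        (le_of_eq (Finset.card_range _)))
    exact h2
  have h2 : p.natDegree ≤ Module.finrank QB (Algebra.adjoin QB {s ^ j}) := by
    have hli := linearIndependent_pow (K := QB) (s ^ j)
    let w : Fin p.natDegree → Algebra.adjoin QB {s ^ j} := fun i =>
      ⟨(s ^ j) ^ (i : ℕ), pow_mem (Algebra.self_mem_adjoin_singleton QB _) _⟩
    have hw : LinearIndependent QB w := by
      apply LinearIndependent.of_comp (Algebra.adjoin QB {s ^ j}).val.toLinearMap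
      exact hli
    simpa using hw.fintype_card_le_finrank
  have heq := Subalgebra.eq_of_le_of_finrank_le hle (h1.trans (hdeg.trans h2))
  have hmem : s ∈ Algebra.adjoin QB {s ^ j} := by
    rw [heq]; exact Algebra.self_mem_adjoin_singleton QB s
  rw [Algebra.adjoin_singleton_eq_range_aeval] at hmem
  exact hmem

lemma neat_block {d : ℕ} (s P Q : Matrix (Fin d) (Fin d) QB) (hs : ∀ μ, s.charpoly.IsRoot μ → μ ≠ 0)
    (hN : ∀ μ μ', s.charpoly.IsRoot μ → s.charpoly.IsRoot μ' → ∀ k : ℕ, 0 < k → μ ^ k = μ' ^ k → μ = μ')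
    (hPQ : P + Q = 1) (hPP : P * P = P) (hne : Q * s * P ≠ 0)
    (j : ℕ) (hj : 0 < j) : Q * s ^ j * P ≠ 0 := by
  intro h0
  obtain ⟨f, hf⟩ := neat_pow s hs hN j hj
  have hQ : Q = 1 - P := by rw [← hPQ]; abel
  have hQP : Q * P = 0 := by rw [hQ, sub_mul, hPP, one_mul, sub_self]
  set T := s ^ j
  have hT : T * P = P * T * P := by
    rw [hQ, sub_mul, sub_mul, one_mul, sub_eq_zero] at h0
    exact h0
  have hpow : ∀ i : ℕ, Q * T ^ i * P = 0 := by
    intro i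
    induction i with
    | zero => simpa using hQP
    | succ i ih =>
      rw [pow_succ, mul_assoc, mul_assoc, hT]
      simp only [← mul_assoc]
      rw [ih, zero_mul, zero_mul]
  apply hne
  rw [← hf, aeval_eq_sum_range, Finset.mul_sum, Finset.sum_mul]
  refine Finset.sum_eq_zero fun i _ => ?_
  rw [mul_smul_comm, smul_mul_assoc, hpow, smul_zero]

section
variable {ι : Type*} [Fintype ι] [DecidableEq ι]

/-- degree one functions -/
noncomputable def V1 (ι : Type*) : Submodule QB (Matrix ι ι QB → QB) :=
  Submodule.span QB (insert 1 (Set.range (fun p : ι × ι => fun X : Matrix ι ι QB => X p.1 p.2)))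

lemma V1_entry (A B Q : Matrix ι ι QB) (a b : ι) :
    (fun X : Matrix ι ι QB => (A * X * B + Q) a b) ∈ V1 ι := by
  have h : (fun X : Matrix ι ι QB => (A * X * B + Q) a b) =
      (∑ c, ∑ e, (A a e * B c b) • (fun X : Matrix ι ι QB => X e c)) + Q a b • 1 := by
    ext X
    simp only [Matrix.add_apply, Matrix.mul_apply, Pi.add_apply, Finset.sum_apply, Pi.smul_apply,
      smul_eq_mul, Pi.one_apply, mul_one, Finset.sum_mul]
    congr 1
    refine Finset.sum_congr rfl fun c _ => Finset.sum_congr rfl fun e _ => ?_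
    ring
  rw [h]
  refine add_mem (sum_mem fun c _ => sum_mem fun e _ => Submodule.smul_mem _ _ (Submodule.subset_span ?_))
    (Submodule.smul_mem _ _ (Submodule.subset_span (by simp)))
  exact Or.inr ⟨(e, c), rfl⟩

lemma prod_mem_pow {A J : Type*} [CommRing A] [Algebra QB A] (M : Submodule QB A) (s : Finset J) (f : J → A)
    (h : ∀ j ∈ s, f j ∈ M) : ∏ j ∈ s, f j ∈ M ^ s.card := by
  classical
  induction s using Finset.induction_on with
  | empty => simpa using ⟨1, map_one _⟩
  | insert a s ha ih =>
    rw [Finset.prod_insert ha, Finset.card_insert_of_notMem ha, pow_succ']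
    exact Submodule.mul_mem_mul (h a (by simp)) (ih fun j hj => h j (by simp [hj]))

instance V1pow_fin (n : ℕ) : FiniteDimensional QB (V1 ι ^ n : Submodule QB (Matrix ι ι QB → QB)) := by
  apply Module.Finite.of_fg
  apply Submodule.FG.pow
  exact Submodule.fg_span (Set.Finite.insert _ (Set.finite_range _))

/-- right translation -/
noncomputable def rtr (s : Matrix ι ι QB) : (Matrix ι ι QB → QB) →ₐ[QB] (Matrix ι ι QB → QB) where
  toFun f := fun X => f (X * s)
  map_one' := rfl
  map_mul' _ _ := rfl
  map_zero' := rfl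
  map_add' _ _ := rfl
  commutes' _ := rfl

theorem transversal (s s' P Q : Matrix ι ι QB) (hs : s' * s = 1) (hPQ : P + Q = 1) (hPP : P * P = P) :
    ∃ j : ℕ, 0 < j ∧ j ≤ Module.finrank QB (V1 ι ^ (Fintype.card ι) : Submodule QB (Matrix ι ι QB → QB)) ∧
      (P * s ^ j * P + Q).det ≠ 0 := by
  set V := (V1 ι ^ (Fintype.card ι) : Submodule QB (Matrix ι ι QB → QB)) with hV
  let f : Matrix ι ι QB → QB := fun X => (P * X * P + Q).det
  have hf : f ∈ V := by
    have : f = ∑ σ : Equiv.Perm ι, ((Equiv.Perm.sign σ : ℤ) : QB) •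
        ∏ a, (fun X : Matrix ι ι QB => (P * X * P + Q) (σ a) a) := by
      ext X
      simp only [f, Matrix.det_apply', Finset.sum_apply, Pi.smul_apply, Finset.prod_apply, smul_eq_mul]
    rw [this]
    refine sum_mem fun σ _ => Submodule.smul_mem _ _ ?_
    exact prod_mem_pow _ Finset.univ _ fun a _ => V1_entry P P Q _ _
  have hmap1 : (V1 ι).map (rtr s).toLinearMap ≤ V1 ι := by
    rw [V1, Submodule.map_span, Submodule.span_le]
    rintro _ ⟨g, hg, rfl⟩
    rcases hg with rfl | ⟨p, rfl⟩
    · exact Submodule.subset_span (Or.inl rfl)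
    · have := V1_entry 1 s 0 p.1 p.2
      simp only [one_mul, add_zero] at this
      exact this
  have hmap : ∀ g ∈ V, (rtr s).toLinearMap g ∈ V := by
    intro g hg
    have h1 : (V1 ι ^ (Fintype.card ι)).map (rtr s).toLinearMap ≤ V1 ι ^ (Fintype.card ι) := by
      rw [Submodule.map_pow]
      gcongr
    exact h1 ⟨g, hg, rfl⟩
  let T : V →ₗ[QB] V := (rtr s).toLinearMap.restrict hmap
  have hTinj : Function.Injective T := by
    intro g g' h
    ext X
    have := congrFun (congrArg Subtype.val h) (X * s')
    change g.1 (X * s' * s) = g'.1 (X * s' * s) at this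
    simpa [mul_assoc, hs] using this
  have hc0 : T.charpoly.coeff 0 ≠ 0 := by
    intro h0
    have hdet : LinearMap.det T = 0 := by rw [LinearMap.det_eq_sign_charpoly_coeff, h0, mul_zero]
    have : IsUnit T := (Module.End.isUnit_iff _).2
      ⟨hTinj, LinearMap.injective_iff_surjective.1 hTinj⟩
    have hu := (this.map (LinearMap.det : (V →ₗ[QB] V) →* QB)).ne_zero
    exact hu hdet
  by_contra hcon
  push Not at hcon
  have hTpow : ∀ (i : ℕ) (g : V) (X), ((T ^ i) g).1 X = g.1 (X * s ^ i) := by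
    intro i
    induction i with
    | zero => intro g X; simp
    | succ i ih =>
      intro g X
      rw [pow_succ, Module.End.mul_apply, ih]
      show g.1 (X * s ^ i * s) = _
      rw [mul_assoc, ← pow_succ]
  have hCH := T.aeval_self_charpoly
  have h1 := congrFun (congrArg Subtype.val (LinearMap.congr_fun hCH ⟨f, hf⟩)) 1
  rw [aeval_eq_sum_range, LinearMap.charpoly_natDegree] at h1
  simp only [LinearMap.coe_sum, Finset.sum_apply, LinearMap.smul_apply, Submodule.coe_sum,
    Submodule.coe_smul, Pi.smul_apply, hTpow, one_mul] at h1
  rw [Finset.sum_eq_single 0] at h1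
  · have hf1 : f 1 = 1 := by
      simp only [f, mul_one, hPP, hPQ, Matrix.det_one]
    simp only [pow_zero, hf1, smul_eq_mul, mul_one] at h1
    exact hc0 h1
  · intro i hi hi0
    have := hcon i (Nat.pos_of_ne_zero hi0) (by rw [Finset.mem_range] at hi; omega)
    show _ • f (s ^ i) = 0
    simp only [f, this, smul_zero]
  · simp

end

end UG

namespace UG
open Filter Polynomial
set_option autoImplicit false
set_option linter.unusedVariables false
set_option linter.unusedSectionVars false
lemma rat_place_bound (q : ℚ) : ∃ B : ℝ, ∀ v : AbsoluteValue QB ℝ, IsPl v → v (algebraMap ℚ QB q) ≤ B := by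
  refine ⟨|(q : ℝ)| + q.den, ?_⟩
  rintro v (hv | ⟨p, hp, hv⟩)
  · rw [hv q]; simp
  · have : Fact p.Prime := ⟨hp⟩
    rw [hv q]
    have h1 : (padicNorm p q : ℚ) ≤ q.den := by
      have h2 : padicNorm p q * padicNorm p (q.den : ℚ) = padicNorm p (q.num : ℚ) := by
        rw [← padicNorm.mul]; congr 1; exact Rat.mul_den_eq_num q
      have h3 : padicNorm p (q.num : ℚ) ≤ 1 := padicNorm.of_int _
      have hden : (q.den : ℚ) ≠ 0 := by exact_mod_cast q.den_ne_zero
      have h4 : 1 ≤ (q.den : ℚ) * padicNorm p (q.den : ℚ) := by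
        rw [padicNorm.eq_zpow_of_nonzero hden, padicValRat.of_nat, zpow_neg, zpow_natCast]
        rw [← div_eq_mul_inv, one_le_div (by have := hp.pos; positivity)]
        exact_mod_cast Nat.le_of_dvd q.den_pos pow_padicValNat_dvd
      have h5 : 0 ≤ padicNorm p q := padicNorm.nonneg _
      calc padicNorm p q ≤ padicNorm p q * ((q.den : ℚ) * padicNorm p (q.den : ℚ)) :=
            le_mul_of_one_le_right h5 h4
        _ = q.den * (padicNorm p q * padicNorm p (q.den : ℚ)) := by ring
        _ ≤ q.den * 1 := by rw [h2]; gcongr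
        _ = q.den := mul_one _
    have h6 : ((padicNorm p q : ℚ) : ℝ) ≤ q.den := by exact_mod_cast h1
    linarith [abs_nonneg (q : ℝ)]

lemma place_bound (x : QB) : ∃ B : ℝ, ∀ v : AbsoluteValue QB ℝ, IsPl v → v x ≤ B := by
  choose b hb using rat_place_bound
  have hx : IsIntegral ℚ x := Algebra.IsIntegral.isIntegral x
  set p := minpoly ℚ x with hp
  have hmon : p.Monic := minpoly.monic hx
  have h0 : aeval x p = 0 := minpoly.aeval ℚ x
  set n := p.natDegree with hn
  refine ⟨1 + ∑ i ∈ Finset.range n, |b (p.coeff i)|, fun v hv => ?_⟩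
  by_contra hcon
  push Not at hcon
  have hs0 : 0 ≤ ∑ i ∈ Finset.range n, |b (p.coeff i)| := Finset.sum_nonneg fun _ _ => abs_nonneg _
  have h1 : 1 < v x := by linarith
  have hn0 : 0 < n := minpoly.natDegree_pos hx
  have e : x ^ n = - ∑ i ∈ Finset.range n, algebraMap ℚ QB (p.coeff i) * x ^ i := by
    rw [aeval_eq_sum_range, Finset.sum_range_succ, ← hn, hmon.coeff_natDegree, one_smul] at h0
    simp only [Algebra.smul_def] at h0
    rw [eq_neg_iff_add_eq_zero, add_comm]; exact h0
  have h2 : v x ^ n ≤ ∑ i ∈ Finset.range n, |b (p.coeff i)| * v x ^ (n - 1) := by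
    rw [← map_pow, e, AbsoluteValue.map_neg]
    refine (v.sum_le _ _).trans (Finset.sum_le_sum fun i hi => ?_)
    rw [map_mul, map_pow]
    rw [Finset.mem_range] at hi
    refine mul_le_mul ((hb _ v hv).trans (le_abs_self _)) (pow_le_pow_right₀ h1.le (by omega))
      (pow_nonneg (v.nonneg _) _) (abs_nonneg _)
  rw [← Finset.sum_mul] at h2
  have h3 : v x ^ n = v x * v x ^ (n - 1) := by rw [← pow_succ']; congr 1; omega
  rw [h3] at h2
  have h4 : 0 < v x ^ (n - 1) := by positivity
  have := le_of_mul_le_mul_right h2 h4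
  linarith

/-- normalized irreducible situation -/
structure Nrm {H : Type*} [Group H] {d : ℕ} (τ : H →* Matrix (Fin d) (Fin d) QB) (T : Finset ℕ) : Prop where
  det1 : ∀ h, (τ h).det = 1
  neat : ∀ h μ μ', (τ h).charpoly.IsRoot μ → (τ h).charpoly.IsRoot μ' → ∀ k : ℕ, 0 < k → μ ^ k = μ' ^ k → μ = μ'
  out : ∀ h μ, (τ h).charpoly.IsRoot μ → ∀ p, p.Prime → p ∉ T → ∀ v, IsAt p v → v μ ≤ 1
  span : Submodule.span QB (Set.range τ) = ⊤
  mult : ∀ s w a b c, (∀ μ, (τ s).charpoly.IsRoot μ → μ = a) → (∀ μ, (τ w).charpoly.IsRoot μ → μ = b) →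
    (∀ μ, (τ (s * w)).charpoly.IsRoot μ → μ = c) → c = a * b

section
variable {H : Type*} [Group H] {d : ℕ}

lemma entries_field [Group.FG H] (τ : H →* Matrix (Fin d) (Fin d) QB) :
    ∃ L1 : IntermediateField ℚ QB, FiniteDimensional ℚ L1 ∧ ∀ h a b, τ h a b ∈ L1 := by
  obtain ⟨S, hS⟩ := Group.fg_def.1 (inferInstance : Group.FG H)
  obtain ⟨L, hL, hsub⟩ := exists_numfield
    (⋃ s ∈ S, Set.range (fun p : Fin d × Fin d => τ s p.1 p.2) ∪ Set.range (fun p : Fin d × Fin d => τ s⁻¹ p.1 p.2))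
    (Set.Finite.biUnion S.finite_toSet fun s _ => (Set.finite_range _).union (Set.finite_range _))
  refine ⟨L, hL, fun h => ?_⟩
  have hh : h ∈ Subgroup.closure (S : Set H) := by rw [hS]; trivial
  suffices (∀ a b, τ h a b ∈ L) ∧ (∀ a b, τ h⁻¹ a b ∈ L) from this.1
  have hmul : ∀ x y : H, (∀ a b, τ x a b ∈ L) → (∀ a b, τ y a b ∈ L) → ∀ a b, τ (x * y) a b ∈ L := by
    intro x y hx hy a b
    rw [map_mul, Matrix.mul_apply]
    exact sum_mem fun c _ => mul_mem (hx _ _) (hy _ _)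
  induction hh using Subgroup.closure_induction with
  | mem x hx =>
    exact ⟨fun a b => hsub (Set.mem_biUnion hx (Or.inl ⟨(a, b), rfl⟩)),
      fun a b => hsub (Set.mem_biUnion hx (Or.inr ⟨(a, b), rfl⟩))⟩
  | one =>
    have : ∀ a b : Fin d, (1 : Matrix (Fin d) (Fin d) QB) a b ∈ L := by
      intro a b
      rw [Matrix.one_apply]
      split_ifs
      · exact one_mem _
      · exact zero_mem _
    simpa using this
  | mul x y _ _ hx hy =>
    refine ⟨hmul _ _ hx.1 hy.1, ?_⟩
    rw [mul_inv_rev]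
    exact hmul _ _ hy.2 hx.2
  | inv x _ hx => rw [inv_inv]; exact ⟨hx.2, hx.1⟩

lemma root_degree (L1 : IntermediateField ℚ QB) [FiniteDimensional ℚ L1]
    (A : Matrix (Fin d) (Fin d) QB) (hA : ∀ a b, A a b ∈ L1) (μ : QB) (hμ : A.charpoly.IsRoot μ) :
    (minpoly ℚ μ).natDegree ≤ Module.finrank ℚ L1 * d := by
  let A' : Matrix (Fin d) (Fin d) L1 := Matrix.of fun a b => ⟨A a b, hA a b⟩
  have hAA' : A = A'.map (algebraMap L1 QB) := by ext a b; rfl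
  have hch : A.charpoly = A'.charpoly.map (algebraMap L1 QB) := by
    rw [hAA', Matrix.charpoly_map]
  have hroot : aeval μ A'.charpoly = 0 := by
    rw [hch, IsRoot.def, eval_map] at hμ
    exact hμ
  have hintg : IsIntegral L1 μ := ⟨_, A'.charpoly_monic, hroot⟩
  let E := IntermediateField.adjoin L1 {μ}
  have : FiniteDimensional L1 E := IntermediateField.adjoin.finiteDimensional hintg
  have hE : Module.finrank L1 E ≤ d := by
    rw [IntermediateField.adjoin.finrank hintg]
    have := minpoly.min L1 μ A'.charpoly_monic hroot
    have h2 := natDegree_le_natDegree this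
    rwa [Matrix.charpoly_natDegree_eq_dim, Fintype.card_fin] at h2
  have hfin : FiniteDimensional ℚ E := FiniteDimensional.trans ℚ L1 E
  have h3 := minpoly.natDegree_le (A := ℚ) (⟨μ, IntermediateField.mem_adjoin_simple_self L1 μ⟩ : E)
  rw [← Module.finrank_mul_finrank ℚ L1 E] at h3
  refine le_trans (le_of_eq ?_) (h3.trans (Nat.mul_le_mul_left _ hE))
  congr 1
  rw [← minpoly.algebraMap_eq (B' := QB) (algebraMap E QB).injective]
  rfl

lemma fields_bdd [Group.FG H] (τ : H →* Matrix (Fin d) (Fin d) QB) :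
    ∃ (L1 : IntermediateField ℚ QB) (D : ℕ), (∀ h a b, τ h a b ∈ L1) ∧ ∀ h, ∃ L : IntermediateField ℚ QB,
      L1 ≤ L ∧ (∀ x ∈ L, (minpoly ℚ x).natDegree ≤ D) ∧ ∀ μ, (τ h).charpoly.IsRoot μ → μ ∈ L := by
  obtain ⟨L1, hfin, hL1⟩ := entries_field τ
  set n1 := Module.finrank ℚ L1 with hn1
  refine ⟨L1, n1 * (n1 * d + 1) ^ d, hL1, fun h => ?_⟩
  have key : ∀ s : Multiset QB, (∀ μ ∈ s, (τ h).charpoly.IsRoot μ) → ∃ L : IntermediateField ℚ QB, L1 ≤ L ∧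
      FiniteDimensional ℚ L ∧ Module.finrank ℚ L ≤ n1 * (n1 * d + 1) ^ (Multiset.card s) ∧ ∀ μ ∈ s, μ ∈ L := by
    intro s
    induction s using Multiset.induction_on with
    | empty => intro _; exact ⟨L1, le_rfl, hfin, by simp [hn1], by simp⟩
    | cons a s ih =>
      intro hs
      obtain ⟨L, h1, h2, h3, h4⟩ := ih fun μ hμ => hs μ (Multiset.mem_cons_of_mem hμ)
      have hintg : IsIntegral ℚ a := Algebra.IsIntegral.isIntegral a
      have : FiniteDimensional ℚ (IntermediateField.adjoin ℚ {a}) :=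
        IntermediateField.adjoin.finiteDimensional hintg
      refine ⟨L ⊔ IntermediateField.adjoin ℚ {a}, h1.trans le_sup_left,
        IntermediateField.finiteDimensional_sup _ _, ?_, ?_⟩
      · refine (IntermediateField.finrank_sup_le _ _).trans ?_
        rw [Multiset.card_cons, pow_succ, ← mul_assoc]
        refine Nat.mul_le_mul h3 ?_
        rw [IntermediateField.adjoin.finrank hintg]
        exact (root_degree L1 _ (hL1 h) a (hs a (Multiset.mem_cons_self a s))).trans (Nat.le_succ _)
      · intro μ hμ
        rcases Multiset.mem_cons.1 hμ with rfl | hμ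
        · exact le_sup_right (a := L) (IntermediateField.mem_adjoin_simple_self ℚ μ)
        · exact le_sup_left (a := L) (h4 μ hμ)
  obtain ⟨L, h1, h2, h3, h4⟩ := key (τ h).charpoly.roots fun μ hμ => isRoot_of_mem_roots hμ
  refine ⟨L, h1, fun x hx => (deg_le_of_mem L hx).trans (h3.trans ?_), fun μ hμ =>
    h4 μ ((mem_roots (τ h).charpoly_monic.ne_zero).2 hμ)⟩
  refine Nat.mul_le_mul_left _ (Nat.pow_le_pow_right (Nat.succ_pos _) ?_)
  have := card_roots' (τ h).charpoly
  rwa [Matrix.charpoly_natDegree_eq_dim, Fintype.card_fin] at this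

/-- span of balls -/
noncomputable def Wsp (τ : H →* Matrix (Fin d) (Fin d) QB) (S : Finset H) (m : ℕ) : Submodule QB (Matrix (Fin d) (Fin d) QB) :=
  Submodule.span QB {x | ∃ h, InBall (S : Set H) m h ∧ τ h = x}

lemma Wsp_mono (τ : H →* Matrix (Fin d) (Fin d) QB) (S : Finset H) {m n : ℕ} (h : m ≤ n) : Wsp τ S m ≤ Wsp τ S n := by
  apply Submodule.span_mono
  rintro x ⟨h', h1, h2⟩
  exact ⟨h', h1.mono h, h2⟩

lemma Wsp_top (hd : 0 < d) (τ : H →* Matrix (Fin d) (Fin d) QB) (hsp : Submodule.span QB (Set.range τ) = ⊤)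
    (S : Finset H) (hS : Subgroup.closure (S : Set H) = ⊤) : Wsp τ S (d * d) = ⊤ := by
  have stab : ∀ m, Wsp τ S (m + 1) ≤ Wsp τ S m → Wsp τ S m = ⊤ := by
    intro m hm
    rw [eq_top_iff, ← hsp, Submodule.span_le]
    have hstep : ∀ n, Wsp τ S (m + n) ≤ Wsp τ S m := by
      intro n
      induction n with
      | zero => exact le_rfl
      | succ n ih =>
        rw [Wsp, Submodule.span_le]
        rintro x ⟨h, hh, rfl⟩
        have hh' : InBall (S : Set H) (1 + (m + n)) h := by convert hh using 1; omega
        obtain ⟨a, b, ha, hb, rfl⟩ := hh'.split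
        rw [map_mul]
        have hb' : τ b ∈ Wsp τ S m := ih (Submodule.subset_span ⟨b, hb, rfl⟩)
        apply hm
        refine Submodule.span_induction (p := fun y _ => τ a * y ∈ Wsp τ S (m + 1)) ?_ ?_ ?_ ?_ hb'
        · rintro _ ⟨c, hc, rfl⟩
          refine Submodule.subset_span ⟨a * c, ?_, map_mul _ _ _⟩
          rw [add_comm]; exact ha.mul hc
        · simp
        · intro x y _ _ hx hy; rw [mul_add]; exact add_mem hx hy
        · intro c x _ hx; rw [mul_smul_comm]; exact Submodule.smul_mem _ _ hx
    rintro _ ⟨h, rfl⟩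
    obtain ⟨n, hn⟩ := exists_inBall hS h
    exact hstep n (Submodule.subset_span ⟨h, hn.mono (by omega), rfl⟩)
  have grow : ∀ m, Wsp τ S m = ⊤ ∨ m + 1 ≤ Module.finrank QB (Wsp τ S m) := by
    intro m
    induction m with
    | zero =>
      right
      have : Nonempty (Fin d) := ⟨⟨0, hd⟩⟩
      rw [zero_add, Nat.one_le_iff_ne_zero, Submodule.finrank_eq_zero.ne]
      intro h0
      have : (1 : Matrix (Fin d) (Fin d) QB) ∈ Wsp τ S 0 := Submodule.subset_span ⟨1, InBall.one _ _, map_one _⟩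
      rw [h0, Submodule.mem_bot] at this
      exact one_ne_zero this
    | succ m ih =>
      by_cases hle : Wsp τ S (m + 1) ≤ Wsp τ S m
      · left
        have := stab m hle
        rw [eq_top_iff, ← this]; exact Wsp_mono _ _ (Nat.le_succ m)
      · right
        rcases ih with h | h
        · exact absurd (h ▸ le_top) hle
        · have hlt : Wsp τ S m < Wsp τ S (m + 1) := lt_of_le_not_ge (Wsp_mono _ _ (Nat.le_succ m)) hle
          have := Submodule.finrank_lt_finrank_of_lt hlt
          omega
  rcases grow (d * d) with h | h
  · exact h
  · exfalso
    have h1 := Submodule.finrank_le (Wsp τ S (d * d))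
    rw [Module.finrank_matrix] at h1
    simp at h1
    omega

lemma exists_word_basis (hd : 0 < d) (τ : H →* Matrix (Fin d) (Fin d) QB) (hsp : Submodule.span QB (Set.range τ) = ⊤)
    (S : Finset H) (hS : Subgroup.closure (S : Set H) = ⊤) :
    ∃ (e : Fin d × Fin d → H) (B : Module.Basis (Fin d × Fin d) QB (Matrix (Fin d) (Fin d) QB)),
      (∀ i, InBall (S : Set H) (d * d) (e i)) ∧ ∀ i, B i = τ (e i) := by
  have htop := Wsp_top hd τ hsp S hS
  obtain ⟨b, hb, hspan, hli⟩ := exists_linearIndependent QB {x | ∃ h, InBall (S : Set H) (d * d) h ∧ τ h = x}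
  have hspan' : Submodule.span QB b = ⊤ := hspan.trans htop
  let B0 : Module.Basis b QB (Matrix (Fin d) (Fin d) QB) := Module.Basis.mk hli (by rw [Subtype.range_coe, hspan'])
  have : Fintype b := FiniteDimensional.fintypeBasisIndex B0
  have hcard : Fintype.card b = Fintype.card (Fin d × Fin d) := by
    rw [← Module.finrank_eq_card_basis B0, Module.finrank_matrix]; simp
  let eq := Fintype.equivOfCardEq hcard
  have hx : ∀ i, ∃ h, InBall (S : Set H) (d * d) h ∧ τ h = (eq.symm i : Matrix (Fin d) (Fin d) QB) := fun i => hb (eq.symm i).2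
  choose e he1 he2 using hx
  refine ⟨e, B0.reindex eq, he1, fun i => ?_⟩
  rw [he2]
  simp [B0]

end

end UG

namespace UG
open Filter Polynomial
set_option autoImplicit false
set_option linter.unusedVariables false
set_option linter.unusedSectionVars false
section
variable {H : Type*} [Group H] {d : ℕ}

lemma card_roots_charpoly (A : Matrix (Fin d) (Fin d) QB) : A.charpoly.roots.card = d := by
  rw [← (IsAlgClosed.splits A.charpoly).natDegree_eq_card_roots, Matrix.charpoly_natDegree_eq_dim, Fintype.card_fin]

lemma mem_roots_charpoly (A : Matrix (Fin d) (Fin d) QB) (μ : QB) : μ ∈ A.charpoly.roots ↔ A.charpoly.IsRoot μ :=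
  mem_roots A.charpoly_monic.ne_zero

lemma trace_of_single (A : Matrix (Fin d) (Fin d) QB) (a : QB) (h : ∀ μ, A.charpoly.IsRoot μ → μ = a) :
    A.trace = d * a := by
  rw [Matrix.trace_eq_sum_roots_charpoly]
  have : A.charpoly.roots = Multiset.replicate d a :=
    Multiset.eq_replicate.2 ⟨card_roots_charpoly A, fun μ hμ => h μ ((mem_roots_charpoly A μ).1 hμ)⟩
  rw [this]; simp

lemma root_ne_zero {τ : H →* Matrix (Fin d) (Fin d) QB} {T : Finset ℕ} (hN : Nrm τ T) (h : H) (μ : QB)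
    (hμ : (τ h).charpoly.IsRoot μ) : μ ≠ 0 := by
  rintro rfl
  have := hN.det1 h
  rw [Matrix.det_eq_prod_roots_charpoly, Multiset.prod_eq_zero ((mem_roots_charpoly _ _).2 hμ)] at this
  exact zero_ne_one this

lemma two_eig (hd : 2 ≤ d) {τ : H →* Matrix (Fin d) (Fin d) QB} {T : Finset ℕ} (hN : Nrm τ T)
    (S : Finset H) (hS : Subgroup.closure (S : Set H) = ⊤) :
    ∃ g μ μ', InBall (S : Set H) (d * d + 1) g ∧ (τ g).charpoly.IsRoot μ ∧ (τ g).charpoly.IsRoot μ' ∧ μ ≠ μ' := by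
  by_contra hcon
  push Not at hcon
  have hne : Nonempty (Fin d) := ⟨⟨0, by omega⟩⟩
  have hsing : ∀ g, InBall (S : Set H) (d * d + 1) g → ∃ a, ∀ μ, (τ g).charpoly.IsRoot μ → μ = a := by
    intro g hg
    have : (τ g).charpoly.roots ≠ 0 := by
      intro h0
      have := card_roots_charpoly (τ g)
      rw [h0] at this; simp at this; omega
    obtain ⟨a, ha⟩ := Multiset.exists_mem_of_ne_zero this
    exact ⟨a, fun μ hμ => hcon g μ a hg hμ ((mem_roots_charpoly _ _).1 ha)⟩
  have hlet : ∀ s ∈ S, ∃ a : QB, τ s = a • 1 := by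
    intro s hs
    have hs1 : InBall (S : Set H) 1 s := InBall.of_mem hs
    obtain ⟨a, ha⟩ := hsing s (hs1.mono (by omega))
    refine ⟨a, ?_⟩
    rw [Matrix.ext_iff_trace_mul_right]
    intro x
    have hx : x ∈ Wsp τ S (d * d) := by rw [Wsp_top (by omega) τ hN.span S hS]; trivial
    refine Submodule.span_induction (p := fun y _ => (τ s * y).trace = (a • (1 : Matrix (Fin d) (Fin d) QB) * y).trace) ?_ ?_ ?_ ?_ hx
    · rintro _ ⟨w, hw, rfl⟩
      obtain ⟨b, hb⟩ := hsing w (hw.mono (by omega))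
      obtain ⟨c, hc⟩ := hsing (s * w) ((hs1.mul hw).mono (by omega))
      have := hN.mult s w a b c ha hb hc
      rw [← map_mul, trace_of_single _ c hc, smul_mul_assoc, one_mul, Matrix.trace_smul, trace_of_single _ b hb, this]
      simp; ring
    · simp
    · intro x y _ _ hx hy; rw [mul_add, mul_add, Matrix.trace_add, Matrix.trace_add, hx, hy]
    · intro c x _ hx; rw [mul_smul_comm, mul_smul_comm, Matrix.trace_smul, Matrix.trace_smul, hx]
  have hall : ∀ h : H, ∃ a : QB, τ h = a • 1 := by
    intro h
    have hh : h ∈ Subgroup.closure (S : Set H) := by rw [hS]; trivial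
    induction hh using Subgroup.closure_induction with
    | mem x hx => exact hlet x hx
    | one => exact ⟨1, by simp⟩
    | mul x y _ _ hx hy =>
      obtain ⟨a, ha⟩ := hx
      obtain ⟨b, hb⟩ := hy
      exact ⟨a * b, by rw [map_mul, ha, hb, smul_mul_smul_comm, one_mul]⟩
    | inv x _ hx =>
      obtain ⟨a, ha⟩ := hx
      have h1 : τ x * τ x⁻¹ = 1 := by rw [← map_mul]; simp
      rw [ha, smul_mul_assoc, one_mul] at h1
      have ha0 : a ≠ 0 := by
        rintro rfl
        rw [zero_smul] at h1
        exact zero_ne_one h1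
      refine ⟨a⁻¹, ?_⟩
      rw [← h1, smul_smul, inv_mul_cancel₀ ha0, one_smul]
  have hmem : Matrix.single (⟨0, by omega⟩ : Fin d) (⟨1, by omega⟩ : Fin d) (1 : QB) ∈ Submodule.span QB {(1 : Matrix (Fin d) (Fin d) QB)} := by
    have : Submodule.span QB (Set.range τ) ≤ Submodule.span QB {(1 : Matrix (Fin d) (Fin d) QB)} := by
      rw [Submodule.span_le]
      rintro _ ⟨h, rfl⟩
      obtain ⟨a, ha⟩ := hall h
      exact Submodule.mem_span_singleton.2 ⟨a, ha.symm⟩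
    rw [hN.span] at this
    exact this trivial
  obtain ⟨a, ha⟩ := Submodule.mem_span_singleton.1 hmem
  have := congrFun (congrFun ha ⟨0, by omega⟩) ⟨1, by omega⟩
  simp [Matrix.single, Matrix.one_apply] at this

lemma exists_small_root (hd : 0 < d) {τ : H →* Matrix (Fin d) (Fin d) QB} {T : Finset ℕ} (hN : Nrm τ T)
    (v : AbsoluteValue QB ℝ) (h : H) : ∃ μ, (τ h).charpoly.IsRoot μ ∧ v μ ≤ 1 := by
  by_contra hcon
  push Not at hcon
  have h1 := hN.det1 h
  rw [Matrix.det_eq_prod_roots_charpoly] at h1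
  have h2 : ∀ s : Multiset QB, (∀ μ ∈ s, 1 < v μ) → 1 ≤ v s.prod ∧ (s ≠ 0 → 1 < v s.prod) := by
    intro s
    induction s using Multiset.induction with
    | empty => simp
    | cons a s ih =>
      intro hs
      have ha := hs a (Multiset.mem_cons_self _ _)
      have := (ih fun μ hμ => hs μ (Multiset.mem_cons_of_mem hμ)).1
      rw [Multiset.prod_cons, map_mul]
      constructor
      · nlinarith
      · intro _; nlinarith
  have h3 := (h2 (τ h).charpoly.roots fun μ hμ => hcon μ ((mem_roots_charpoly _ _).1 hμ)).2 (by
    intro h0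
    have := card_roots_charpoly (τ h)
    rw [h0] at this; simp at this; omega)
  rw [h1] at h3
  simp at h3

lemma exists_good_element (hd : 2 ≤ d) [Group.FG H] {τ : H →* Matrix (Fin d) (Fin d) QB} {T : Finset ℕ} (hN : Nrm τ T)
    (k0 : ℕ) (hk0 : d * d + 1 ≤ k0) :
    ∃ q : ℕ, 0 < q ∧ ∀ S : Finset H, Subgroup.closure (S : Set H) = ⊤ →
      ∃ (g : H) (v : AbsoluteValue QB ℝ) (Λ : ℝ) (μ μ' : QB), InBall (S : Set H) k0 g ∧ IsPl v ∧ 2 ≤ Λ ∧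
        (∀ h μ, InBall (S : Set H) k0 h → (τ h).charpoly.IsRoot μ → Ctl T Λ μ) ∧
        (τ g).charpoly.IsRoot μ ∧ (τ g).charpoly.IsRoot μ' ∧ v μ' < v μ ∧ Λ ≤ (v μ / v μ') ^ q := by
  obtain ⟨L1, D, hL1, hD⟩ := fields_bdd τ
  obtain ⟨ε, hε, hgap⟩ := gap D
  obtain ⟨q0, hq0⟩ := pow_unbounded_of_one_lt 2 (show 1 < 1 + ε by linarith)
  refine ⟨q0 + 2, by omega, fun S hS => ?_⟩
  set E : Set ℝ := {x | ∃ h μ v, InBall (S : Set H) k0 h ∧ (τ h).charpoly.IsRoot μ ∧ IsPl v ∧ v μ = x} with hE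
  have hbdd : BddAbove E := by
    have hfin : (⋃ h ∈ {h : H | InBall (S : Set H) k0 h}, {μ : QB | (τ h).charpoly.IsRoot μ}).Finite := by
      refine Set.Finite.biUnion (finite_ball S k0) fun h _ => ?_
      classical
      refine ((τ h).charpoly.roots.toFinset.finite_toSet).subset fun μ hμ => ?_
      simpa using (mem_roots_charpoly _ _).2 hμ
    choose b hb using place_bound
    obtain ⟨M, hM⟩ := (hfin.image b).bddAbove
    refine ⟨M, ?_⟩
    rintro x ⟨h, μ, v, h1, h2, h3, rfl⟩
    exact (hb μ v h3).trans (hM ⟨μ, Set.mem_biUnion (show h ∈ {h : H | InBall (S : Set H) k0 h} from h1) h2, rfl⟩)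
  have hctl : ∀ Λ : ℝ, sSup E ≤ Λ → ∀ h μ, InBall (S : Set H) k0 h → (τ h).charpoly.IsRoot μ → Ctl T Λ μ := by
    intro Λ hΛ h μ hh hμ
    refine ⟨fun v hv => (le_csSup hbdd ⟨h, μ, v, hh, hμ, .inl hv, rfl⟩).trans hΛ,
      fun p hp _ v hv => (le_csSup hbdd ⟨h, μ, v, hh, hμ, .inr ⟨p, hp, hv⟩, rfl⟩).trans hΛ,
      fun p hp hpT v hv => hN.out h μ hμ p hp hpT v hv⟩
  by_cases hM : 2 ≤ sSup E
  · have hEne : E.Nonempty := by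
      by_contra h0
      rw [Set.not_nonempty_iff_eq_empty] at h0
      rw [h0, Real.sSup_empty] at hM; linarith
    have hsq : √(sSup E) < sSup E := by
      rw [Real.sqrt_lt' (by linarith)]; nlinarith
    obtain ⟨_, ⟨g, μ, v, hg, hμ, hv, rfl⟩, hx⟩ := exists_lt_of_lt_csSup hEne hsq
    obtain ⟨μ', hμ', hle⟩ := exists_small_root (by omega) hN v g
    have hpos : 0 < v μ' := v.pos (root_ne_zero hN g μ' hμ')
    have h1s : 1 ≤ √(sSup E) := by rw [Real.one_le_sqrt]; linarith
    have hR : √(sSup E) ≤ v μ / v μ' := by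
      rw [le_div_iff₀ hpos]; nlinarith
    refine ⟨g, v, sSup E, μ, μ', hg, hv, hM, hctl _ le_rfl, hμ, hμ', by linarith, ?_⟩
    calc sSup E = √(sSup E) ^ 2 := (Real.sq_sqrt (by linarith)).symm
      _ ≤ √(sSup E) ^ (q0 + 2) := pow_le_pow_right₀ h1s (by omega)
      _ ≤ _ := by gcongr
  · push Not at hM
    obtain ⟨g, μ, μ', hg, hμ, hμ', hne⟩ := two_eig hd hN S hS
    have h0 := root_ne_zero hN g μ hμ
    have h0' := root_ne_zero hN g μ' hμ'
    obtain ⟨L, hLL, hLD, hLr⟩ := hD g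
    obtain ⟨v, hv, hvx⟩ := hgap (μ / μ') (div_ne_zero h0 h0')
      (hLD _ (div_mem (hLr μ hμ) (hLr μ' hμ'))) (by
        intro k hk h1
        rw [div_pow, div_eq_one_iff_eq (pow_ne_zero _ h0')] at h1
        exact hne (hN.neat g μ μ' hμ hμ' k hk h1))
    rw [map_div₀] at hvx
    have hpos : 0 < v μ' := v.pos h0'
    refine ⟨g, v, 2, μ, μ', hg.mono hk0, hv, le_rfl, hctl 2 hM.le, hμ, hμ', ?_, ?_⟩
    · rw [le_div_iff₀ hpos] at hvx; nlinarith
    · calc (2:ℝ) ≤ (1 + ε) ^ q0 := hq0.le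
        _ ≤ (1 + ε) ^ (q0 + 2) := pow_le_pow_right₀ (by linarith) (by omega)
        _ ≤ _ := by gcongr

end

end UG

namespace UG
open Filter Polynomial
set_option autoImplicit false
set_option linter.unusedVariables false
set_option linter.unusedSectionVars false
section
variable {H : Type*} [Group H] {d : ℕ}

lemma ctl_sum {T : Finset ℕ} {Λ : ℝ} (hΛ : 2 ≤ Λ) (s : Multiset QB) (h : ∀ x ∈ s, Ctl T Λ x) :
    Ctl T (Λ ^ (s.card + 1)) s.sum := by
  induction s using Multiset.induction_on with
  | empty => simpa using Ctl.zero (by linarith)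
  | cons a s ih =>
    have h1 := ih fun x hx => h x (Multiset.mem_cons_of_mem hx)
    have h2 := h a (Multiset.mem_cons_self _ _)
    rw [Multiset.sum_cons, Multiset.card_cons]
    refine (h2.add h1).mono ?_
    have h3 : Λ ≤ Λ ^ (s.card + 1) := le_self_pow₀ (by linarith) (by omega)
    rw [pow_succ _ (s.card + 1)]
    nlinarith

lemma reg_trace (b : Module.Basis (Fin d × Fin d) QB (Matrix (Fin d) (Fin d) QB)) (x : Matrix (Fin d) (Fin d) QB) :
    (Matrix.of fun k l => (b l * b k).trace) * Algebra.leftMulMatrix b x = Matrix.of fun k m => (x * b m * b k).trace := by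
  ext k m
  rw [Matrix.mul_apply]
  simp only [Matrix.of_apply, Algebra.leftMulMatrix_eq_repr_mul]
  conv_rhs => rw [← b.sum_repr (x * b m)]
  rw [Finset.sum_mul, Matrix.trace_sum]
  refine Finset.sum_congr rfl fun l _ => ?_
  rw [smul_mul_assoc, Matrix.trace_smul, smul_eq_mul, mul_comm]

lemma reg_trace_det (b : Module.Basis (Fin d × Fin d) QB (Matrix (Fin d) (Fin d) QB)) :
    (Matrix.of fun k l => (b l * b k).trace).det ≠ 0 := by
  rw [ne_eq, ← Matrix.exists_mulVec_eq_zero_iff]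
  rintro ⟨c, hc, h0⟩
  have h1 : ∀ k, ((∑ l, c l • b l) * b k).trace = 0 := by
    intro k
    have := congrFun h0 k
    rw [Matrix.mulVec, dotProduct] at this
    rw [Finset.sum_mul, Matrix.trace_sum, ← show _ = (0 : QB) from this]
    refine Finset.sum_congr rfl fun l _ => ?_
    rw [smul_mul_assoc, Matrix.trace_smul, smul_eq_mul, mul_comm]; rfl
  have h2 : (∑ l, c l • b l) = 0 := by
    rw [Matrix.ext_iff_trace_mul_right]
    intro x
    rw [← b.sum_repr x, Finset.mul_sum, Matrix.trace_sum, Finset.sum_eq_zero, zero_mul, Matrix.trace_zero]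
    intro k _
    rw [mul_smul_comm, Matrix.trace_smul, h1, smul_zero]
  exact hc (funext fun i => Fintype.linearIndependent_iff.1 b.linearIndependent c h2 i)

lemma reg_letter {I : Type*} {F : Fam I} {τ : H →* Matrix (Fin d) (Fin d) QB} {S : I → Finset H}
    {e : I → Fin d × Fin d → H} {B : I → Module.Basis (Fin d × Fin d) QB (Matrix (Fin d) (Fin d) QB)}
    (hB : ∀ i k, B i k = τ (e i k)) (he : ∀ i k, InBall (S i : Set H) (d * d) (e i k))
    {C : ℕ} (htr : ∀ i w, InBall (S i : Set H) (2 * (d * d) + 1) w → F.O i C (τ w).trace)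
    (w : I → H) (hw : ∀ i, InBall (S i : Set H) 1 (w i)) :
    F.CM (fun i => Algebra.leftMulMatrix (B i) (τ (w i))) := by
  have h1 : F.CM (fun i => Matrix.of fun k l => (B i l * B i k).trace) := fun k l =>
    Fam.CF.of_O C fun i => by
      simp only [Matrix.of_apply, hB, ← map_mul]
      exact htr i _ (((he i l).mul (he i k)).mono (by omega))
  have h2 : F.CM (fun i => Matrix.of fun k l => (τ (w i) * B i l * B i k).trace) := fun k l =>
    Fam.CF.of_O C fun i => by
      simp only [Matrix.of_apply, hB, ← map_mul]
      exact htr i _ ((((hw i).mul (he i l)).mul (he i k)).mono (by omega))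
  have h3 := h1.inv.mul h2
  convert h3 using 2 with i
  rw [← reg_trace (B i), ← mul_assoc, Matrix.nonsing_inv_mul, one_mul]
  exact (reg_trace_det (B i)).isUnit

lemma reg_word {I : Type*} {F : Fam I} {τ : H →* Matrix (Fin d) (Fin d) QB} {S : I → Finset H}
    {e : I → Fin d × Fin d → H} {B : I → Module.Basis (Fin d × Fin d) QB (Matrix (Fin d) (Fin d) QB)}
    (hB : ∀ i k, B i k = τ (e i k)) (he : ∀ i k, InBall (S i : Set H) (d * d) (e i k))
    {C : ℕ} (htr : ∀ i w, InBall (S i : Set H) (2 * (d * d) + 1) w → F.O i C (τ w).trace)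
    (m : ℕ) : ∀ (w : I → H) (hw : ∀ i, InBall (S i : Set H) m (w i)),
    F.CM (fun i => Algebra.leftMulMatrix (B i) (τ (w i))) := by
  induction m with
  | zero => exact fun w hw => reg_letter hB he htr w fun i => (hw i).mono (by omega)
  | succ m ih =>
    intro w hw
    choose a b ha hb hab using fun i => (hw i).split
    convert (ih a ha).mul (reg_letter hB he htr b hb) using 2 with i
    rw [← map_mul, ← map_mul, hab]

lemma fam_trace_O {I : Type*} {F : Fam I} {τ : H →* Matrix (Fin d) (Fin d) QB} {S : I → Finset H} {k0 : ℕ}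
    (hL : ∀ i h a b, τ h a b ∈ F.L i)
    (hc : ∀ i h μ, InBall (S i : Set H) k0 h → (τ h).charpoly.IsRoot μ → Ctl F.T (F.Lam i) μ) :
    ∀ i w, InBall (S i : Set H) k0 w → F.O i (d + 1) (τ w).trace := by
  intro i w hw
  refine ⟨sum_mem fun a _ => hL i w a a, ?_⟩
  rw [Matrix.trace_eq_sum_roots_charpoly]
  have := ctl_sum (F.hLam i) (τ w).charpoly.roots fun μ hμ => hc i w μ hw ((mem_roots_charpoly _ _).1 hμ)
  rwa [card_roots_charpoly] at this

lemma CM.aeval_prod {I : Type*} {F : Fam I} {ι : Type*} [Fintype ι] [DecidableEq ι] {J : Type*} (s : Finset J)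
    (p : J → I → QB[X]) (x : I → Matrix ι ι QB) (h : ∀ j ∈ s, F.CM (fun i => aeval (x i) (p j i))) :
    F.CM (fun i => aeval (x i) (∏ j ∈ s, p j i)) := by
  classical
  induction s using Finset.induction_on with
  | empty => simpa using Fam.CM.one
  | insert j s hj ih =>
    have := (h j (Finset.mem_insert_self _ _)).mul (ih fun k hk => h k (Finset.mem_insert_of_mem hk))
    simpa [Finset.prod_insert hj] using this

lemma CM.smul_one {I : Type*} {F : Fam I} {ι : Type*} [Fintype ι] [DecidableEq ι] {c : I → QB} (hc : F.CF c) :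
    F.CM (fun i => algebraMap QB (Matrix ι ι QB) (c i)) := by
  simp only [Algebra.algebraMap_eq_smul_one]
  exact Fam.CM.smul hc .one

lemma cm_sepPoly {I : Type*} {F : Fam I} {ι : Type*} [Fintype ι] [DecidableEq ι] {x : I → Matrix ι ι QB} (hx : F.CM x)
    (μ : I → Fin d → QB) (hμ : ∀ j, F.CF (fun i => μ i j)) (b : I → Finset (Fin d)) :
    F.CM (fun i => aeval (x i) (sepPoly (μ i) (b i))) := by
  have h : ∀ B : Finset (Fin d), F.CM (fun i => aeval (x i) (sepPoly (μ i) B)) := by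
    intro B
    simp only [sepPoly]
    refine CM.aeval_prod _ _ _ fun j _ => ?_
    simp only [map_sub, map_one]
    refine Fam.CM.sub .one (CM.aeval_prod _ _ _ fun l _ => ?_)
    simp only [map_mul, aeval_C, map_sub, aeval_X]
    have h1 := CM.smul_one (ι := ι) ((hμ j).sub (hμ l)).inv
    have h2 := hx.sub (CM.smul_one (ι := ι) (hμ l))
    simpa using h1.mul h2
  intro k l
  exact Fam.CF.choose (fun (B : Finset (Fin d)) i => aeval (x i) (sepPoly (μ i) B) k l) (fun B => h B k l) b

lemma exists_enum (A : Matrix (Fin d) (Fin d) QB) : ∃ μ : Fin d → QB, A.charpoly = ∏ j, (X - C (μ j)) := by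
  have h1 := (IsAlgClosed.splits A.charpoly).eq_prod_roots_of_monic A.charpoly_monic
  have h2 := card_roots_charpoly A
  have hl : (A.charpoly.roots.toList).length = d := by rw [Multiset.length_toList, h2]
  refine ⟨fun j => (A.charpoly.roots.toList).get (j.cast hl.symm), ?_⟩
  have h3 : ∏ j : Fin d, (X - C ((A.charpoly.roots.toList).get (j.cast hl.symm))) =
      ∏ j : Fin (A.charpoly.roots.toList).length, (X - C ((A.charpoly.roots.toList).get j)) :=
    Fintype.prod_equiv (finCongr hl.symm) _ _ fun j => rfl
  rw [h3]
  conv_lhs => rw [h1]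
  have h4 : ∀ l : List QB, ∏ j : Fin l.length, (X - C (l.get j)) = (l.map (fun x => X - C x)).prod := by
    intro l
    rw [← Fin.prod_ofFn]
    congr 1
    conv_rhs => rw [← List.ofFn_get l, List.map_ofFn]
    rfl
  rw [h4, ← Multiset.prod_coe, ← Multiset.map_coe, Multiset.coe_toList]

end

end UG

namespace UG
open Filter Polynomial
set_option autoImplicit false
set_option linter.unusedVariables false
set_option linter.unusedSectionVars false
section
variable {H : Type*} [Group H] {d : ℕ}

lemma aeval_ne_zero_of_root (A : Matrix (Fin d) (Fin d) QB) (p : QB[X]) (μ : QB) (hμ : A.charpoly.IsRoot μ)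
    (hp : p.eval μ ≠ 0) : aeval A p ≠ 0 := by
  intro h0
  obtain ⟨q, hq⟩ := X_sub_C_dvd_sub_C_eval (a := μ) (p := p)
  have h1 : (A - algebraMap QB _ μ) * aeval A q = - algebraMap QB _ (p.eval μ) := by
    have := congrArg (aeval A) hq
    simp only [map_sub, map_mul, aeval_X, aeval_C, h0, zero_sub] at this
    exact this.symm
  have h2 : (A - algebraMap QB _ μ).det = 0 := by
    have := hμ
    rw [IsRoot, Matrix.eval_charpoly] at this
    rw [← neg_sub, Matrix.det_neg]
    rw [Matrix.scalar_apply] at this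
    rw [Matrix.algebraMap_eq_diagonal]
    simp only [Pi.algebraMap_def, Algebra.algebraMap_self_apply]
    rw [this, mul_zero]
  have h3 := congrArg Matrix.det h1
  rw [Matrix.det_mul, h2, zero_mul, ← map_neg, Matrix.algebraMap_eq_diagonal, Matrix.det_diagonal] at h3
  have := Finset.prod_eq_zero_iff.1 h3.symm
  obtain ⟨a, _, ha⟩ := this
  simp at ha
  exact hp ha

lemma sep_data (A : Matrix (Fin d) (Fin d) QB) (μ : Fin d → QB) (hchar : A.charpoly = ∏ j, (X - C (μ j)))
    (b : Finset (Fin d)) (hb : b.Nonempty) (hb' : bᶜ.Nonempty) (hne : ∀ j ∈ bᶜ, ∀ l ∈ b, μ j ≠ μ l) :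
    aeval A ((∏ l ∈ b, (X - C (μ l))) * sepPoly μ b) = 0 ∧ aeval A ((∏ l ∈ bᶜ, (X - C (μ l))) * (1 - sepPoly μ b)) = 0 ∧
    aeval A (sepPoly μ b * (1 - sepPoly μ b)) = 0 ∧ aeval A (sepPoly μ b) ≠ 0 ∧ aeval A (1 - sepPoly μ b) ≠ 0 := by
  have htop := sep_top μ b hne
  have hbot := sep_bot μ b hb
  have hspl : (∏ l ∈ b, (X - C (μ l))) * (∏ l ∈ bᶜ, (X - C (μ l))) = A.charpoly := by
    rw [hchar, Finset.prod_mul_prod_compl]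
  have hch := Matrix.aeval_self_charpoly A
  have kill : ∀ p, A.charpoly ∣ p → aeval A p = 0 := by
    rintro p ⟨q, rfl⟩; rw [map_mul, hch, zero_mul]
  have hroot : ∀ j, A.charpoly.IsRoot (μ j) := by
    intro j
    rw [hchar, IsRoot, eval_prod]
    exact Finset.prod_eq_zero (Finset.mem_univ j) (by simp)
  refine ⟨kill _ ?_, kill _ ?_, kill _ ?_, ?_, ?_⟩
  · rw [← hspl]; exact mul_dvd_mul_left _ htop
  · rw [← hspl, mul_comm (∏ l ∈ bᶜ, _)]; exact mul_dvd_mul_right hbot _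
  · rw [← hspl, mul_comm (sepPoly μ b)]; exact mul_dvd_mul hbot htop
  · obtain ⟨l, hl⟩ := hb
    refine aeval_ne_zero_of_root A _ (μ l) (hroot l) ?_
    have : (X - C (μ l)) ∣ 1 - sepPoly μ b := (Finset.dvd_prod_of_mem (fun j => X - C (μ j)) hl).trans hbot
    rw [dvd_iff_isRoot, IsRoot, eval_sub, eval_one, sub_eq_zero] at this
    rw [← this]; exact one_ne_zero
  · obtain ⟨l, hl⟩ := hb'
    refine aeval_ne_zero_of_root A _ (μ l) (hroot l) ?_
    have : (X - C (μ l)) ∣ sepPoly μ b := (Finset.dvd_prod_of_mem (fun j => X - C (μ j)) hl).trans htop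
    rw [dvd_iff_isRoot, IsRoot] at this
    rw [eval_sub, eval_one, this]; simp

lemma exists_letter {τ : H →* Matrix (Fin d) (Fin d) QB} (hsp : Submodule.span QB (Set.range τ) = ⊤)
    (S : Finset H) (hS : Subgroup.closure (S : Set H) = ⊤) (P Q : Matrix (Fin d) (Fin d) QB)
    (hPQ : P + Q = 1) (hP : P ≠ 0) (hQ : Q ≠ 0) (hQP : Q * P = 0) :
    ∃ s, InBall (S : Set H) 1 s ∧ Q * τ s * P ≠ 0 := by
  by_contra hcon
  push Not at hcon
  have h1 : ∀ m h, InBall (S : Set H) m h → Q * τ h * P = 0 := by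
    intro m
    induction m with
    | zero => intro h hh; exact hcon h (hh.mono (by omega))
    | succ m ih =>
      intro h hh
      obtain ⟨a, b, ha, hb, rfl⟩ := hh.split
      have e : Q * τ (a * b) * P = (Q * τ a * P) * (τ b * P) + (Q * τ a) * (Q * τ b * P) := by
        have : τ a * τ b = τ a * (P + Q) * τ b := by rw [hPQ, mul_one]
        rw [map_mul, this]; noncomm_ring
      rw [e, ih a ha, hcon b hb]; simp
  have h2 : ∀ X : Matrix (Fin d) (Fin d) QB, Q * X * P = 0 := by
    intro X
    have hX : X ∈ Submodule.span QB (Set.range τ) := by rw [hsp]; trivial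
    induction hX using Submodule.span_induction with
    | mem x hx =>
      obtain ⟨h, rfl⟩ := hx
      obtain ⟨m, hm⟩ := exists_inBall hS h
      exact h1 m h hm
    | zero => simp
    | add x y _ _ hx hy => rw [mul_add, add_mul, hx, hy, add_zero]
    | smul c x _ hx => rw [mul_smul_comm, smul_mul_assoc, hx, smul_zero]
  obtain ⟨a, b, hab⟩ : ∃ a b, Q a b ≠ 0 := by
    by_contra h; push Not at h; exact hQ (by ext a b; exact h a b)
  obtain ⟨c, e, hce⟩ : ∃ a b, P a b ≠ 0 := by
    by_contra h; push Not at h; exact hP (by ext a b; exact h a b)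
  have h3 := congrFun (congrFun (h2 (Matrix.single b c 1)) a) e
  rw [Matrix.mul_apply, Finset.sum_eq_single c] at h3
  · rw [Matrix.mul_apply, Finset.sum_eq_single b] at h3
    · simp at h3; exact h3.elim hab hce
    · intro k _ hk; simp [hk, Matrix.single, hk.symm]
    · simp
  · intro k _ hk
    rw [Matrix.mul_apply, Finset.sum_eq_zero]
    · simp
    · intro l _; simp [Matrix.single, hk.symm]
  · simp

lemma kill_inv {ι : Type*} [Fintype ι] [DecidableEq ι] (x x' : Matrix ι ι QB) (h : x' * x = 1) (l : List QB) :
    ∀ y, (∀ μ ∈ l, μ ≠ 0) → aeval x ((l.map (fun μ => X - C μ)).prod) * y = 0 →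
    aeval x' (((l.map (fun μ => μ⁻¹)).map (fun μ => X - C μ)).prod) * y = 0 := by
  induction l with
  | nil => intro y _ h; simpa using h
  | cons μ l ih =>
    intro y hl hy
    have hμ : μ ≠ 0 := hl μ (by simp)
    simp only [List.map_cons, List.prod_cons] at hy ⊢
    rw [mul_comm, map_mul, mul_assoc] at hy
    have h1 := ih _ (fun ν hν => hl ν (by simp [hν])) hy
    rw [map_mul]
    have hcomm : ∀ p : QB[X], aeval x' X * aeval x' p = aeval x' p * aeval x' X := fun p => by
      rw [← map_mul, mul_comm, map_mul]
    have e : aeval x' (X - C μ⁻¹) = - (μ⁻¹ • (x' * (x - algebraMap QB _ μ))) := by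
      rw [mul_sub, h, map_sub, aeval_X, aeval_C, Algebra.algebraMap_eq_smul_one, Algebra.algebraMap_eq_smul_one,
        mul_smul_comm, mul_one, smul_sub, smul_smul, inv_mul_cancel₀ hμ, one_smul]
      abel
    have hc2 : aeval x' (X - C μ⁻¹) * aeval x' (((l.map (fun μ => μ⁻¹)).map (fun μ => X - C μ)).prod) =
       aeval x' (((l.map (fun μ => μ⁻¹)).map (fun μ => X - C μ)).prod) * aeval x' (X - C μ⁻¹) := by
      rw [← map_mul, mul_comm, map_mul]
    rw [hc2, e]
    have hc3 := hcomm (((l.map (fun μ => μ⁻¹)).map (fun μ => X - C μ)).prod)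
    rw [aeval_X] at hc3
    rw [mul_neg, neg_mul, mul_smul_comm, smul_mul_assoc, ← mul_assoc, ← hc3, mul_assoc, mul_assoc]
    rw [map_sub, aeval_X, aeval_C] at h1
    rw [h1]; simp

lemma exists_N (a k E : ℕ) : ∃ N : ℕ, ((a * N + 1 : ℕ) : ℝ) ^ k * 2 ^ E < 2 ^ N := by
  have h := (tendsto_pow_const_div_const_pow_of_one_lt k (show (1:ℝ) < 2 by norm_num)).const_mul (((a + 1 : ℕ) : ℝ) ^ k * 2 ^ E)
  rw [mul_zero] at h
  obtain ⟨N, h1, h2⟩ := ((h.eventually (gt_mem_nhds (show (0:ℝ) < 1 by norm_num))).and (eventually_ge_atTop 1)).exists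
  refine ⟨N, ?_⟩
  rw [mul_div_assoc', div_lt_one (by positivity)] at h1
  refine lt_of_le_of_lt ?_ h1
  rw [mul_right_comm, ← mul_pow]
  gcongr
  have : a * N + 1 ≤ (a + 1) * N := by nlinarith
  exact_mod_cast this

lemma exists_t (R : ℝ) (hR : 1 < R) (hd : 0 < d) : ∃ t : ℝ, 1 < t ∧ t ^ d = R :=
  ⟨R ^ ((d : ℝ)⁻¹), Real.one_lt_rpow hR (by positivity), Real.rpow_inv_natCast_pow (by linarith) (by omega)⟩

lemma exists_gap (hd : 0 < d) (w : Fin d → ℝ) (hw : ∀ j, 0 < w j) (t : ℝ) (ht : 1 < t) (j1 j2 : Fin d)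
    (h : w j2 = w j1 * t ^ d) : ∃ j0, (∀ j, w j ≤ w j0 ∨ t * w j0 < w j) ∧ ∃ j, t * w j0 < w j := by
  classical
  obtain ⟨r, hr, _, h2, h3⟩ := gap_lemma (Finset.univ.image w) t (w j2) ht.le (by simp) (d - 1) (w j1) (by simp) (hw _) (by
    have hsub : (Finset.univ.image w).filter (fun y => w j1 < y) ⊆ (Finset.univ.image w).erase (w j1) := by
      intro y hy
      rw [Finset.mem_filter] at hy
      exact Finset.mem_erase.2 ⟨hy.2.ne', hy.1⟩
    refine (Finset.card_le_card hsub).trans ?_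
    rw [Finset.card_erase_of_mem (by simp)]
    have := Finset.card_image_le (s := Finset.univ) (f := w)
    simp at this
    omega) (by
    rw [h]
    have := hw j1
    gcongr
    omega)
  obtain ⟨j0, _, rfl⟩ := Finset.mem_image.1 hr
  refine ⟨j0, fun j => h2 _ (by simp), ?_⟩
  obtain ⟨x, hx, hx'⟩ := h3
  obtain ⟨j, _, rfl⟩ := Finset.mem_image.1 hx
  exact ⟨j, hx'⟩

end

end UG

namespace UG
open Filter Polynomial
set_option autoImplicit false
set_option linter.unusedVariables false
set_option linter.unusedSectionVars false
section
variable {H : Type*} [Group H] {d : ℕ}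

structure Stp (τ : H →* Matrix (Fin d) (Fin d) QB) (T : Finset ℕ) (q D J : ℕ) (S : Finset H) where
  g : H
  hg : InBall (S : Set H) (2 * (d * d) + 1) g
  v : AbsoluteValue QB ℝ
  hv : IsPl v
  Λ : ℝ
  hΛ : 2 ≤ Λ
  ctl : ∀ h μ, InBall (S : Set H) (2 * (d * d) + 1) h → (τ h).charpoly.IsRoot μ → Ctl T Λ μ
  L : IntermediateField ℚ QB
  hLD : ∀ x ∈ L, (minpoly ℚ x).natDegree ≤ D
  hLe : ∀ h a b, τ h a b ∈ L
  e : Fin d × Fin d → H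
  B : Module.Basis (Fin d × Fin d) QB (Matrix (Fin d) (Fin d) QB)
  he : ∀ k, InBall (S : Set H) (d * d) (e k)
  hB : ∀ k, B k = τ (e k)
  μ : Fin d → QB
  hμL : ∀ j, μ j ∈ L
  hμ0 : ∀ j, μ j ≠ 0
  hroot : ∀ j, (τ g).charpoly.IsRoot (μ j)
  hchar : (τ g).charpoly = ∏ j, (X - C (μ j))
  t : ℝ
  ht : 1 < t
  htq : Λ ≤ (t ^ d) ^ q
  j0 : Fin d
  bot : Finset (Fin d)
  hbot : ∀ j ∈ bot, v (μ j) ≤ v (μ j0)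
  htop : ∀ j ∈ botᶜ, t * v (μ j0) < v (μ j)
  hb1 : bot.Nonempty
  hb2 : botᶜ.Nonempty
  s : H
  hs : InBall (S : Set H) 1 s
  j : ℕ
  hj : j ≤ J
  hQP : aeval (τ g) (sepPoly μ bot) * τ s ^ j * (1 - aeval (τ g) (sepPoly μ bot)) ≠ 0
  hdet : ((1 - aeval (Algebra.leftMulMatrix B (τ g)) (sepPoly μ bot)) * Algebra.leftMulMatrix B (τ s) ^ j *
    (1 - aeval (Algebra.leftMulMatrix B (τ g)) (sepPoly μ bot)) + aeval (Algebra.leftMulMatrix B (τ g)) (sepPoly μ bot)).det ≠ 0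

lemma exists_stp (hd : 2 ≤ d) [Group.FG H] {τ : H →* Matrix (Fin d) (Fin d) QB} {T : Finset ℕ} (hN : Nrm τ T) :
    ∃ q D J : ℕ, 0 < q ∧ ∀ S : Finset H, Subgroup.closure (S : Set H) = ⊤ → Nonempty (Stp τ T q D J S) := by
  obtain ⟨q, hq, hgood⟩ := exists_good_element hd hN (2 * (d * d) + 1) (by omega)
  obtain ⟨L1, D, hL1, hD⟩ := fields_bdd τ
  refine ⟨q, D, Module.finrank QB (V1 (Fin d × Fin d) ^ Fintype.card (Fin d × Fin d) : Submodule QB _), hq, fun S hS => ?_⟩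
  obtain ⟨g, v, Λ, μ2, μ1, hg, hv, hΛ, ctl, hμ2, hμ1, hlt, hR⟩ := hgood S hS
  obtain ⟨L, hLL, hLD, hLr⟩ := hD g
  obtain ⟨e, B, he, hB⟩ := exists_word_basis (by omega) τ hN.span S hS
  obtain ⟨μ, hchar⟩ := exists_enum (τ g)
  have hroot : ∀ j, (τ g).charpoly.IsRoot (μ j) := by
    intro j
    rw [hchar, IsRoot, eval_prod]
    exact Finset.prod_eq_zero (Finset.mem_univ j) (by simp)
  have hidx : ∀ ν, (τ g).charpoly.IsRoot ν → ∃ j, μ j = ν := by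
    intro ν hν
    rw [hchar, IsRoot, eval_prod, Finset.prod_eq_zero_iff] at hν
    obtain ⟨j, _, hj⟩ := hν
    refine ⟨j, ?_⟩
    rw [eval_sub, eval_X, eval_C, sub_eq_zero] at hj
    exact hj.symm
  have hμ0 : ∀ j, μ j ≠ 0 := fun j => root_ne_zero hN g _ (hroot j)
  obtain ⟨j1, rfl⟩ := hidx _ hμ1
  obtain ⟨j2, rfl⟩ := hidx _ hμ2
  have hp1 : 0 < v (μ j1) := v.pos (hμ0 _)
  obtain ⟨t, ht, htR⟩ := exists_t (d := d) (v (μ j2) / v (μ j1)) (by rwa [one_lt_div hp1]) (by omega)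
  obtain ⟨j0, hj0, j3, hj3⟩ := exists_gap (by omega) (fun j => v (μ j)) (fun j => v.pos (hμ0 j)) t ht j1 j2 (by
    rw [htR]; field_simp)
  classical
  set bot : Finset (Fin d) := Finset.univ.filter (fun j => v (μ j) ≤ v (μ j0)) with hbotdef
  have hp0 : 0 < v (μ j0) := v.pos (hμ0 _)
  have hbot : ∀ j ∈ bot, v (μ j) ≤ v (μ j0) := fun j hj => (Finset.mem_filter.1 hj).2
  have htop : ∀ j ∈ botᶜ, t * v (μ j0) < v (μ j) := by
    intro j hj
    rw [Finset.mem_compl, hbotdef, Finset.mem_filter] at hj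
    exact (hj0 j).resolve_left fun h => hj ⟨Finset.mem_univ _, h⟩
  have hb1 : bot.Nonempty := ⟨j0, Finset.mem_filter.2 ⟨Finset.mem_univ _, le_rfl⟩⟩
  have hb2 : botᶜ.Nonempty := ⟨j3, by
    rw [Finset.mem_compl]
    intro h
    have := hbot _ h
    nlinarith⟩
  have hne : ∀ j ∈ botᶜ, ∀ l ∈ bot, μ j ≠ μ l := by
    intro j hj l hl h
    have h1 := htop j hj
    have h2 := hbot l hl
    rw [h] at h1
    nlinarith
  obtain ⟨-, -, h3, h4, h5⟩ := sep_data (τ g) μ hchar bot hb1 hb2 hne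
  rw [map_sub, map_one] at h5
  rw [map_mul, map_sub, map_one] at h3
  set Q := aeval (τ g) (sepPoly μ bot) with hQ
  have hPQ : (1 - Q) + Q = 1 := by abel
  have hPP : (1 - Q) * (1 - Q) = 1 - Q := by
    rw [sub_mul, h3]; simp
  obtain ⟨s, hs, hsne⟩ := exists_letter hN.span S hS (1 - Q) Q hPQ h5 h4 h3
  set φ := Algebra.leftMulMatrix B
  have hφQ : φ Q = aeval (φ (τ g)) (sepPoly μ bot) := (aeval_algHom_apply φ (τ g) (sepPoly μ bot)).symm
  obtain ⟨j, hj0', hj, hdet⟩ := transversal (φ (τ s)) (φ (τ s⁻¹)) (1 - φ Q) (φ Q)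
    (by rw [← map_mul, ← map_mul]; simp) (by abel) (by
      have := congrArg φ hPP
      simpa using this)
  refine ⟨⟨g, hg, v, hv, Λ, hΛ, ctl, L, hLD, fun h a b => hLL (hL1 h a b), e, B, he, hB, μ, fun j => hLr _ (hroot j), hμ0, hroot, hchar, t,
    ht, by rw [htR]; exact hR, j0, bot, hbot, htop, hb1, hb2, s, hs, j, hj, ?_, ?_⟩⟩
  · exact neat_block (τ s) (1 - Q) Q (fun μ hμ => root_ne_zero hN s μ hμ) (hN.neat s) hPQ hPP hsne j hj0'
  · rw [← hφQ]; exact hdet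

lemma ev_le {I : Type*} {F : Fam I} {f : I → ℝ} (h : ∃ C : ℕ, ∀ i, f i ≤ F.Lam i ^ C) :
    ∀ᶠ C : ℕ in atTop, ∀ i, f i ≤ F.Lam i ^ C := by
  obtain ⟨C, hC⟩ := h
  filter_upwards [eventually_ge_atTop C] with C' hC' i
  exact (hC i).trans (pow_le_pow_right₀ (F.one_le i) hC')

lemma ev_lower {I : Type*} {F : Fam I} {f : I → ℝ} (hf : ∀ i, 0 ≤ f i) (h : ∃ C : ℕ, ∀ i, 1 ≤ F.Lam i ^ C * f i) :
    ∀ᶠ C : ℕ in atTop, ∀ i, 1 ≤ F.Lam i ^ C * f i := by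
  obtain ⟨C, hC⟩ := h
  filter_upwards [eventually_ge_atTop C] with C' hC' i
  exact (hC i).trans (mul_le_mul_of_nonneg_right (pow_le_pow_right₀ (F.one_le i) hC') (hf i))

lemma list_form (b : Finset (Fin d)) (μ : Fin d → QB) :
    ((b.toList.map μ).map (fun ν => (X - C ν : QB[X]))).prod = ∏ l ∈ b, (X - C (μ l)) := by
  rw [List.map_map, ← Finset.prod_map_toList]; rfl

end

end UG

namespace UG
open Filter Polynomial
set_option autoImplicit false
set_option linter.unusedVariables false
set_option linter.unusedSectionVars false
section
variable {H : Type*} [Group H] {d : ℕ}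

lemma alpha_est {ι : Type*} [Fintype ι] [DecidableEq ι] (v : AbsoluteValue QB ℝ) (x x' P Q : Matrix ι ι QB)
    (hxx : x' * x = 1) (bot : Finset (Fin d)) (μ : Fin d → QB) (hμ0 : ∀ j, μ j ≠ 0) (r t K : ℝ) (N : ℕ)
    (hr : 0 < r) (ht : 1 < t) (hK : 1 ≤ K) (hbot : ∀ j ∈ bot, v (μ j) ≤ r) (htop : ∀ j ∈ botᶜ, t * r < v (μ j))
    (kQ : aeval x (∏ j ∈ bot, (X - C (μ j))) * Q = 0) (kP : aeval x (∏ j ∈ botᶜ, (X - C (μ j))) * P = 0)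
    (b1 : ∀ j, nu v (x - algebraMap QB _ (μ j)) ≤ K) (b2 : ∀ j, nu v (x' - algebraMap QB _ (μ j)⁻¹) ≤ K)
    (b3 : r⁻¹ ≤ K) (b4 : t * r ≤ K) (b5 : nu v Q ≤ K) (b6 : nu v P ≤ K) :
    nu v (x ^ N * Q) * nu v (x' ^ N * P) ≤ (N + 1 : ℝ) ^ (2 * d) * (t⁻¹) ^ N * K ^ (4 * d + 2) := by
  have hlen : ∀ b : Finset (Fin d), b.toList.length ≤ d := fun b => by
    rw [Finset.length_toList]; simpa using Finset.card_le_univ b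
  have hN : (1 : ℝ) ≤ N + 1 := by linarith [Nat.cast_nonneg (α := ℝ) N]
  have hK2 : 1 ≤ K ^ 2 := one_le_pow₀ hK
  have gen : ∀ (r0 : ℝ) (n : ℕ) (y : ℝ), 0 ≤ r0 → n ≤ d → 0 ≤ y → y ≤ K →
      (N + 1 : ℝ) ^ n * r0 ^ N * (K ^ 2) ^ n * y ≤ (N + 1 : ℝ) ^ d * r0 ^ N * (K ^ 2) ^ d * K := by
    intro r0 n y h0 hn hy hyK
    gcongr
  have e1 : nu v (x ^ N * Q) ≤ (N + 1 : ℝ) ^ d * r ^ N * (K ^ 2) ^ d * K := by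
    have := power_bound v x r (K ^ 2) hr.le hK2 (bot.toList.map μ) Q (by
      intro ν hν
      obtain ⟨j, hj, rfl⟩ := List.mem_map.1 hν
      refine ⟨hbot j (Finset.mem_toList.1 hj), (b1 j).trans ?_⟩
      have h1 : 1 ≤ r * K := by
        have := mul_le_mul_of_nonneg_left b3 hr.le
        rwa [mul_inv_cancel₀ hr.ne'] at this
      nlinarith) (by rw [list_form]; exact kQ) N
    refine this.trans (gen r _ _ hr.le ?_ (nu_nonneg _ _) b5)
    rw [List.length_map]; exact hlen _
  have htr : 0 < t * r := by positivity
  have e2 : nu v (x' ^ N * P) ≤ (N + 1 : ℝ) ^ d * ((t * r)⁻¹) ^ N * (K ^ 2) ^ d * K := by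
    have := power_bound v x' ((t * r)⁻¹) (K ^ 2) (by positivity) hK2 ((botᶜ.toList.map μ).map (fun ν => ν⁻¹)) P (by
      intro ν hν
      rw [List.map_map] at hν
      obtain ⟨j, hj, rfl⟩ := List.mem_map.1 hν
      have h1 := htop j (Finset.mem_toList.1 hj)
      refine ⟨?_, (b2 j).trans ?_⟩
      · rw [Function.comp, map_inv₀]
        exact inv_anti₀ htr h1.le
      · rw [inv_mul_eq_div, le_div_iff₀ htr]
        nlinarith) (kill_inv x x' hxx _ P (by
          intro ν hν
          obtain ⟨j, hj, rfl⟩ := List.mem_map.1 hν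
          exact hμ0 j) (by rw [list_form]; exact kP)) N
    refine this.trans (gen _ _ _ (by positivity) ?_ (nu_nonneg _ _) b6)
    rw [List.length_map, List.length_map]; exact hlen _
  calc nu v (x ^ N * Q) * nu v (x' ^ N * P) ≤ ((N + 1 : ℝ) ^ d * r ^ N * (K ^ 2) ^ d * K) *
      ((N + 1 : ℝ) ^ d * ((t * r)⁻¹) ^ N * (K ^ 2) ^ d * K) :=
        mul_le_mul e1 e2 (nu_nonneg _ _) (by positivity)
    _ = (N + 1 : ℝ) ^ (2 * d) * (t⁻¹) ^ N * K ^ (4 * d + 2) * (r ^ N * (r⁻¹) ^ N) := by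
      rw [mul_inv, mul_pow]; ring
    _ = _ := by rw [← mul_pow, mul_inv_cancel₀ hr.ne', one_pow, mul_one]

lemma final_num (q C N' N : ℕ) (t Λ : ℝ) (ht : 1 < t) (hΛ : 2 ≤ Λ) (htq : Λ ≤ (t ^ d) ^ q) (hN : N = d * q * N')
    (hN' : ((d * q * N' + 1 : ℕ) : ℝ) ^ (2 * d) * 2 ^ ((4 * d + 7) * C + 4) < 2 ^ N') :
    ((N + 1 : ℝ) ^ (2 * d) * (t⁻¹) ^ N * (Λ ^ C) ^ (4 * d + 2)) * (16 * (Λ ^ C) ^ 5) < 1 := by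
  set E := (4 * d + 7) * C + 4 with hE
  have h1 : (1 : ℝ) ≤ ((d * q * N' + 1 : ℕ) : ℝ) ^ (2 * d) := one_le_pow₀ (by push_cast; linarith [show (0:ℝ) ≤ d * q * N' by positivity])
  have h2 : (2 : ℝ) ^ E < 2 ^ N' := lt_of_le_of_lt (le_mul_of_one_le_left (by positivity) h1) hN'
  have h3 : E < N' := (pow_lt_pow_iff_right₀ (by norm_num)).1 h2
  obtain ⟨k, rfl⟩ := Nat.exists_eq_add_of_lt h3
  have h4 : Λ ^ (E + k + 1) ≤ t ^ N := by
    rw [hN, pow_mul, pow_mul]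
    gcongr
  have h5 : (N + 1 : ℝ) ^ (2 * d) < 2 ^ (k + 1) := by
    have : ((d * q * (E + k + 1) + 1 : ℕ) : ℝ) = N + 1 := by rw [hN]; push_cast; ring
    rw [this, show E + k + 1 = (k + 1) + E by omega, pow_add (2:ℝ) (k + 1) E] at hN'
    exact lt_of_mul_lt_mul_right hN' (by positivity)
  have h6 : (2:ℝ) ^ (k + 1) ≤ Λ ^ (k + 1) := by gcongr
  have h7 : (16 : ℝ) ≤ Λ ^ 4 := by
    calc (16 : ℝ) = 2 ^ 4 := by norm_num
      _ ≤ Λ ^ 4 := by gcongr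
  have hΛ0 : 0 < Λ := by linarith
  have htN : 0 < t ^ N := by positivity
  have e : ((N + 1 : ℝ) ^ (2 * d) * (t⁻¹) ^ N * (Λ ^ C) ^ (4 * d + 2)) * (16 * (Λ ^ C) ^ 5) =
     ((N + 1 : ℝ) ^ (2 * d) * (16 * Λ ^ ((4 * d + 7) * C))) / t ^ N := by
    rw [inv_pow, ← pow_mul, ← pow_mul, eq_div_iff htN.ne']
    have : ((N + 1 : ℝ) ^ (2 * d) * (t ^ N)⁻¹ * Λ ^ (C * (4 * d + 2))) * (16 * Λ ^ (C * 5)) * t ^ N = (N + 1 : ℝ) ^ (2 * d) * (16 * (Λ ^ (C * (4 * d + 2)) * Λ ^ (C * 5))) * ((t ^ N)⁻¹ * t ^ N) := by ring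
    rw [this, inv_mul_cancel₀ htN.ne', mul_one, ← pow_add]
    congr 4; ring
  rw [e, div_lt_one htN]
  calc (N + 1 : ℝ) ^ (2 * d) * (16 * Λ ^ ((4 * d + 7) * C)) < Λ ^ (k + 1) * (16 * Λ ^ ((4 * d + 7) * C)) := by
        apply mul_lt_mul_of_pos_right (h5.trans_le h6); positivity
    _ ≤ Λ ^ (k + 1) * (Λ ^ 4 * Λ ^ ((4 * d + 7) * C)) := by gcongr
    _ = Λ ^ (E + k + 1) := by rw [← pow_add, ← pow_add]; congr 1; omega
    _ ≤ _ := h4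

theorem irreducible_case (hd : 2 ≤ d) [Group.FG H] {τ : H →* Matrix (Fin d) (Fin d) QB} {T : Finset ℕ} (hN : Nrm τ T) :
    UFS H := by
  obtain ⟨q, D, J, hq, hst⟩ := exists_stp hd hN
  let I := {S : Finset H // Subgroup.closure (S : Set H) = ⊤}
  let st : ∀ i : I, Stp τ T q D J i.1 := fun i => (hst i.1 i.2).some
  let F : Fam I := ⟨T, D, fun i => (st i).Λ, fun i => (st i).hΛ, fun i => (st i).L, fun i => (st i).hLD,
    fun i => (st i).v, fun i => (st i).hv⟩
  have htr := fam_trace_O (F := F) (S := fun i : I => i.1) (fun i => (st i).hLe) (fun i => (st i).ctl)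
  have reg := reg_word (F := F) (S := fun i : I => i.1) (fun i => (st i).hB) (fun i => (st i).he) htr
  let φ := fun i => Algebra.leftMulMatrix (st i).B
  let x := fun i => φ i (τ (st i).g)
  let x' := fun i => φ i (τ (st i).g⁻¹)
  let h := fun i => φ i (τ ((st i).s ^ (st i).j))
  have hx : F.CM x := reg _ _ fun i => (st i).hg
  have hx' : F.CM x' := reg _ _ fun i => (st i).hg.inv
  have hsj : ∀ i : I, InBall (i.1 : Set H) J ((st i).s ^ (st i).j) := fun i =>
    ((st i).hs.pow (st i).j).mono (by have := (st i).hj; simpa using this)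
  have hh : F.CM h := reg J _ hsj
  have hμ : ∀ j, F.CF (fun i => (st i).μ j) := fun j => .of_O 1 fun i =>
    ⟨(st i).hμL j, by rw [pow_one]; exact (st i).ctl _ _ (st i).hg ((st i).hroot j)⟩
  let Q := fun i => aeval (x i) (sepPoly (st i).μ (st i).bot)
  let P := fun i => 1 - Q i
  have hQ : F.CM Q := cm_sepPoly hx _ hμ _
  have hP : F.CM P := Fam.CM.one.sub hQ
  let M := fun i => P i * h i * P i + Q i
  have hM : F.CM M := ((hP.mul hh).mul hP).add hQ
  let y := fun i => P i * (M i)⁻¹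
  have hy : F.CM y := hP.mul hM.inv
  have hr : F.CF (fun i => (st i).μ (st i).j0) := Fam.CF.choose (fun j i => (st i).μ j) hμ (fun i => (st i).j0)
  -- algebra
  have hsep : ∀ i, aeval (x i) (∏ j ∈ (st i).bot, (X - C ((st i).μ j))) * Q i = 0 ∧
      aeval (x i) (∏ j ∈ (st i).botᶜ, (X - C ((st i).μ j))) * P i = 0 ∧ Q i * P i = 0 := by
    intro i
    obtain ⟨a1, a2, a3, -, -⟩ := sep_data (τ (st i).g) (st i).μ (st i).hchar (st i).bot (st i).hb1 (st i).hb2 (by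
      intro j hj l hl e
      have h1 := (st i).htop j hj
      have h2 := (st i).hbot l hl
      rw [e] at h1
      have := (st i).v.pos ((st i).hμ0 (st i).j0)
      have := (st i).ht
      nlinarith)
    have tr : ∀ p : QB[X], aeval (τ (st i).g) p = 0 → aeval (x i) p = 0 := by
      intro p hp
      rw [show aeval (x i) p = φ i (aeval (τ (st i).g) p) from aeval_algHom_apply (φ i) (τ (st i).g) p, hp, map_zero]
    have b1 := tr _ a1
    have b2 := tr _ a2
    have b3 := tr _ a3
    rw [map_mul] at b1 b2 b3
    rw [map_sub, map_one] at b2 b3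
    exact ⟨b1, b2, b3⟩
  have hPQ1 : ∀ i, P i + Q i = 1 := fun i => sub_add_cancel _ _
  have hPP : ∀ i, P i * P i = P i := by
    intro i
    have e : P i * P i = (P i + Q i) * P i - Q i * P i := by noncomm_ring
    rw [e, hPQ1, (hsep i).2.2]; simp
  have hPQ0 : ∀ i, P i * Q i = 0 := by
    intro i
    have e : P i * Q i = P i * (P i + Q i) - P i * P i := by noncomm_ring
    rw [e, hPQ1, hPP]; simp
  have hxx : ∀ i, x' i * x i = 1 := fun i => by
    change φ i _ * φ i _ = 1
    rw [← map_mul, ← map_mul]; simp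
  have hxx' : ∀ i, x i * x' i = 1 := fun i => by
    change φ i _ * φ i _ = 1
    rw [← map_mul, ← map_mul]; simp
  have hxP : ∀ i, Commute (x i) (P i) := by
    intro i
    refine (Commute.one_right _).sub_right ?_
    have := congrArg (aeval (x i)) (mul_comm X (sepPoly (st i).μ (st i).bot))
    rw [map_mul, map_mul, aeval_X] at this
    exact this
  have hne : ∀ i, Q i * h i * P i ≠ 0 := by
    intro i h0
    apply (st i).hQP
    apply Algebra.leftMulMatrix_injective (st i).B
    rw [map_zero, ← h0]
    change φ i _ = _
    rw [map_mul, map_mul, map_sub, map_one, ← aeval_algHom_apply (φ i), ← map_pow]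
  have hdet : ∀ i, (M i).det ≠ 0 := by
    intro i
    have := (st i).hdet
    rw [← map_pow, ← map_pow] at this
    exact this
  have hPM : ∀ i, P i * M i = P i * h i * P i := by
    intro i
    change P i * (P i * h i * P i + Q i) = _
    rw [mul_add, hPQ0, add_zero, ← mul_assoc, ← mul_assoc, hPP]
  have hMP : ∀ i, M i * P i = P i * h i * P i := by
    intro i
    change (P i * h i * P i + Q i) * P i = _
    rw [add_mul, (hsep i).2.2, add_zero, mul_assoc, hPP]
  have hMu : ∀ i, IsUnit (M i).det := fun i => (hdet i).isUnit
  have hMinv : ∀ i, P i * (M i)⁻¹ = (M i)⁻¹ * P i := by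
    intro i
    calc P i * (M i)⁻¹ = (M i)⁻¹ * (M i * P i) * (M i)⁻¹ := by
          rw [← mul_assoc, Matrix.nonsing_inv_mul _ (hMu i), one_mul]
      _ = (M i)⁻¹ * (P i * M i) * (M i)⁻¹ := by rw [hMP, hPM]
      _ = (M i)⁻¹ * P i := by rw [mul_assoc, mul_assoc, Matrix.mul_nonsing_inv _ (hMu i), mul_one]
  -- constants
  have E1 : ∀ᶠ c : ℕ in atTop, ∀ j, ∀ i, nu (F.v i) (x i - algebraMap QB _ ((st i).μ j)) ≤ F.Lam i ^ c :=
    eventually_all.2 fun j => ev_le (hx.sub (CM.smul_one (hμ j))).bound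
  have E2 : ∀ᶠ c : ℕ in atTop, ∀ j, ∀ i, nu (F.v i) (x' i - algebraMap QB _ ((st i).μ j)⁻¹) ≤ F.Lam i ^ c :=
    eventually_all.2 fun j => ev_le (hx'.sub (CM.smul_one (hμ j).inv)).bound
  have E3 := ev_le hr.inv.bound
  have E4 : ∀ᶠ c : ℕ in atTop, ∀ j, ∀ i, F.v i ((st i).μ j) ≤ F.Lam i ^ c :=
    eventually_all.2 fun j => ev_le (hμ j).bound
  have E5 := ev_le hQ.bound
  have E6 := ev_le hP.bound
  have k1 := ev_le (F := F) (Fam.CM.one (ι := Fin d × Fin d)).bound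
  have k2 := ev_le (hy.mul hh).bound
  have k3 := ev_le (hQ.mul hh).bound
  have k4 := ev_le ((hQ.mul hh).mul hP).bound
  have k5 := ev_le (hP.mul hh).bound
  have k6 := ev_le ((hP.mul hh).mul hP).bound
  have k7 := ev_le hy.bound
  have k8 := ev_lower (fun i => nu_nonneg _ _) (((hQ.mul hh).mul hP).lower hne)
  obtain ⟨c, E1, E2, E3, E4, E5, E6, k1, k2, k3, k4, k5, k6, k7, k8⟩ := (E1.and <| E2.and <| E3.and <| E4.and <| E5.and <| E6.and <|
    k1.and <| k2.and <| k3.and <| k4.and <| k5.and <| k6.and <| k7.and k8).exists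
  obtain ⟨N', hN'⟩ := exists_N (d * q) (2 * d) ((4 * d + 7) * c + 4)
  set N := d * q * N' with hNdef
  refine ⟨J + (2 * (d * d) + 1) * N, fun S hS => ?_⟩
  let i : I := ⟨S, hS⟩
  have hgN : InBall (S : Set H) ((2 * (d * d) + 1) * N) ((st i).g ^ N) := by
    have := (st i).hg.pow N
    exact this.mono (by first | exact le_rfl | exact (mul_comm _ _).le)
  refine ⟨(st i).g ^ N, (st i).s ^ (st i).j * (st i).g ^ N, hgN.mono (by omega), (hsj i).mul hgN, ?_⟩
  have hK : 1 ≤ (st i).Λ ^ c := one_le_pow₀ (by linarith [(st i).hΛ])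
  have hpos := (st i).v.pos ((st i).hμ0 (st i).j0)
  have hα := alpha_est (st i).v (x i) (x' i) (P i) (Q i) (hxx i) (st i).bot (st i).μ (st i).hμ0
    ((st i).v ((st i).μ (st i).j0)) (st i).t ((st i).Λ ^ c) N hpos (st i).ht hK (st i).hbot (st i).htop (hsep i).1 (hsep i).2.1
    (fun j => E1 j i) (fun j => E2 j i) (by have := E3 i; rwa [map_inv₀] at this) (by
      obtain ⟨j, hj⟩ := (st i).hb2
      exact ((st i).htop j hj).le.trans (E4 j i)) (E5 i) (E6 i)
  have hpp := pingpong (st i).v (P := P i) (Q := Q i) (A := x i ^ N) (A' := x' i ^ N) (h := h i) (y := y i)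
    (K := (st i).Λ ^ c) (by
      have hc : Commute (x i) (x' i) := (hxx' i).trans (hxx i).symm
      rw [← hc.mul_pow, hxx', one_pow]) (by
      have hc : Commute (x' i) (x i) := (hxx i).trans (hxx' i).symm
      rw [← hc.mul_pow, hxx, one_pow]) (hPP i) (hPQ1 i) ((hxP i).pow_left N)
    (by change P i * (P i * _) = P i * _; rw [← mul_assoc, hPP])
    (by change P i * _ * P i = P i * _; rw [hMinv, mul_assoc, hPP])
    (by change P i * h i * P i * (P i * (M i)⁻¹) = P i
        rw [← mul_assoc, mul_assoc _ (P i) (P i), hPP, ← hPM, mul_assoc, Matrix.mul_nonsing_inv _ (hMu i), mul_one])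
    (by change P i * (M i)⁻¹ * (P i * h i * P i) = P i
        rw [hMinv, ← hPM, ← mul_assoc, mul_assoc _ (P i) (P i), hPP, mul_assoc, hPM, ← hMP, ← mul_assoc, Matrix.nonsing_inv_mul _ (hMu i), one_mul])
    hK (k1 i) (k2 i) (k3 i) (k4 i) (k5 i) (k6 i) (k7 i) (k8 i) hα
    (final_num q c N' N (st i).t (st i).Λ (st i).ht (st i).hΛ (st i).htq hNdef hN')
  have hmap : FreePair (((φ i : _ →* Matrix (Fin d × Fin d) (Fin d × Fin d) QB).comp τ) ((st i).g ^ N))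
      (((φ i : _ →* Matrix (Fin d × Fin d) (Fin d × Fin d) QB).comp τ) ((st i).s ^ (st i).j * (st i).g ^ N)) := by
    have e1 : ((φ i : _ →* Matrix (Fin d × Fin d) (Fin d × Fin d) QB).comp τ) ((st i).g ^ N) = x i ^ N := by
      rw [map_pow]; rfl
    rw [map_mul, e1]
    exact hpp
  exact hmap.of_map

end

end UG

namespace UG
open Filter Polynomial
set_option autoImplicit false
set_option linter.unusedVariables false
set_option linter.unusedSectionVars false
/-- torsion free group of units, integral outside `T` -/
structure UT (U : Subgroup QBˣ) (T : Finset ℕ) : Prop where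
  tf : ∀ u ∈ U, ∀ k : ℕ, 0 < k → u ^ k = 1 → u = 1
  out : ∀ u ∈ U, ∀ p : ℕ, p.Prime → p ∉ T → ∀ v, IsAt p v → v (u : QB) ≤ 1

lemma UT.out_eq {U : Subgroup QBˣ} {T : Finset ℕ} (h : UT U T) (u : QBˣ) (hu : u ∈ U) (p : ℕ) (hp : p.Prime) (hpT : p ∉ T)
    (v : AbsoluteValue QB ℝ) (hv : IsAt p v) : v (u : QB) = 1 := by
  refine le_antisymm (h.out u hu p hp hpT v hv) ?_
  have h1 := h.out u⁻¹ (inv_mem hu) p hp hpT v hv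
  rw [Units.val_inv_eq_inv_val, map_inv₀] at h1
  exact (inv_le_one₀ (v.pos u.ne_zero)).1 h1

lemma exists_root_hom {H : Type*} [Group H] [Group.FG H] {U : Subgroup QBˣ} {T : Finset ℕ} (hU : UT U T)
    (f : H →* QBˣ) (hf : ∀ h, f h ∈ U) (d : ℕ) (hd : 0 < d) : ∃ δ : H →* QBˣ, ∀ h, δ h ^ d = f h := by
  have hfg : Group.FG f.range := inferInstance
  have : AddGroup.FG (Additive f.range) := AddGroup.fg_iff_mul_fg.2 hfg
  have : Module.Finite ℤ (Additive f.range) := Module.Finite.iff_addGroup_fg.2 this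
  have htf : Module.IsTorsionFree ℤ (Additive f.range) := by
    refine .of_smul_eq_zero fun n x hx => ?_
    by_contra hcon
    push Not at hcon
    obtain ⟨hn, hx0⟩ := hcon
    have h1 : (n.natAbs : ℕ) • x = 0 := by
      rcases Int.natAbs_eq n with h | h
      · rw [h, natCast_zsmul] at hx; simpa using hx
      · rw [h, neg_smul, neg_eq_zero, natCast_zsmul] at hx; simpa using hx
    have hmem : ((x.toMul : f.range) : QBˣ) ∈ U := by
      obtain ⟨h, hh⟩ := (x.toMul : f.range).2
      rw [← hh]; exact hf h
    have h2 := hU.tf _ hmem n.natAbs (Int.natAbs_pos.2 hn) (by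
      have := congrArg (fun z : Additive f.range => ((z.toMul : f.range) : QBˣ)) h1
      simpa using this)
    exact hx0 (Additive.toMul.injective (Subtype.ext (by simpa using h2)))
  have : Module.Free ℤ (Additive f.range) := Module.free_of_finite_type_torsion_free'
  let b := Module.Free.chooseBasis ℤ (Additive f.range)
  have hroot : ∀ x : QBˣ, ∃ y : QBˣ, y ^ d = x := by
    intro x
    obtain ⟨y, hy⟩ := IsAlgClosed.exists_pow_nat_eq (x : QB) hd
    have hy0 : y ≠ 0 := by
      rintro rfl
      rw [zero_pow hd.ne'] at hy
      exact x.ne_zero hy.symm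
    exact ⟨Units.mk0 y hy0, Units.ext (by simpa using hy)⟩
  choose rt hrt using hroot
  let g : Additive f.range →ₗ[ℤ] Additive QBˣ := b.constr ℤ (fun i => Additive.ofMul (rt ((Additive.toMul (b i) : f.range) : QBˣ)))
  have hg : (d : ℤ) • g = (MonoidHom.toAdditive f.range.subtype).toIntLinearMap := by
    refine b.ext fun i => ?_
    rw [LinearMap.smul_apply, Module.Basis.constr_basis]
    apply Additive.toMul.injective
    simp [hrt]
  refine ⟨⟨⟨fun h => (g (Additive.ofMul (f.rangeRestrict h))).toMul, by simp⟩, fun x y => by simp⟩, fun h => ?_⟩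
  have := congrArg Additive.toMul (LinearMap.congr_fun hg (Additive.ofMul (f.rangeRestrict h)))
  simpa using this

end UG

namespace UG
open Filter Polynomial
set_option autoImplicit false
set_option linter.unusedVariables false
set_option linter.unusedSectionVars false
section
variable {H : Type*} [Group H] {d : ℕ}

lemma isRoot_smul (A : Matrix (Fin d) (Fin d) QB) (c : QB) (hc : c ≠ 0) (μ : QB)
    (h : (c • A).charpoly.IsRoot μ) : A.charpoly.IsRoot (c⁻¹ * μ) := by
  rw [IsRoot.def, Matrix.eval_charpoly] at h ⊢
  have : Matrix.scalar (Fin d) μ - c • A = c • (Matrix.scalar (Fin d) (c⁻¹ * μ) - A) := by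
    ext i j
    by_cases hij : i = j
    · subst hij; simp [mul_sub, mul_inv_cancel_left₀ hc]
    · simp [Matrix.scalar_apply, Matrix.diagonal_apply_ne _ hij]
  rw [this, Matrix.det_smul] at h
  exact (mul_eq_zero.1 h).resolve_left (pow_ne_zero _ hc)

lemma det_mem (U : Subgroup QBˣ) (A : Matrix (Fin d) (Fin d) QB)
    (h : ∀ μ, A.charpoly.IsRoot μ → ∃ u ∈ U, (u : QB) = μ) : ∃ u ∈ U, (u : QB) = A.det := by
  rw [Matrix.det_eq_prod_roots_charpoly]
  have h' : ∀ μ ∈ A.charpoly.roots, ∃ u ∈ U, (u : QB) = μ := fun μ hμ => h μ ((mem_roots_charpoly A μ).1 hμ)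
  generalize A.charpoly.roots = m at h'
  induction m using Multiset.induction_on with
  | empty => exact ⟨1, one_mem _, by simp⟩
  | cons a s ih =>
    obtain ⟨u, hu, e⟩ := ih fun μ hμ => h' μ (Multiset.mem_cons_of_mem hμ)
    obtain ⟨w, hw, e2⟩ := h' a (Multiset.mem_cons_self _ _)
    exact ⟨w * u, mul_mem hw hu, by simp [e, e2]⟩

lemma single_pow (hd : 0 < d) (A : Matrix (Fin d) (Fin d) QB) (a : QB) (h : ∀ μ, A.charpoly.IsRoot μ → μ = a) :
    A.charpoly.IsRoot a ∧ A.det = a ^ d := by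
  have e : A.charpoly.roots = Multiset.replicate d a :=
    Multiset.eq_replicate.2 ⟨card_roots_charpoly A, fun μ hμ => h μ ((mem_roots_charpoly A μ).1 hμ)⟩
  constructor
  · rw [← mem_roots_charpoly, e]; exact Multiset.mem_replicate.2 ⟨hd.ne', rfl⟩
  · rw [Matrix.det_eq_prod_roots_charpoly, e]; simp

theorem irred_eigU [Group.FG H] (hd : 2 ≤ d) {U : Subgroup QBˣ} {T : Finset ℕ} (hU : UT U T)
    (τ : H →* Matrix (Fin d) (Fin d) QB) (hsp : Submodule.span QB (Set.range τ) = ⊤)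
    (hE : ∀ h μ, (τ h).charpoly.IsRoot μ → ∃ u ∈ U, (u : QB) = μ) : UFS H := by
  have hd0 : 0 < d := by omega
  let f : H →* QBˣ := (Units.map (Matrix.detMonoidHom (n := Fin d) (R := QB))).comp τ.toHomUnits
  have hfv : ∀ h, (f h : QB) = (τ h).det := fun h => rfl
  have hfU : ∀ h, f h ∈ U := by
    intro h
    obtain ⟨u, hu, e⟩ := det_mem U (τ h) (hE h)
    have : u = f h := Units.ext (by rw [e, hfv])
    rwa [← this]
  obtain ⟨δ, hδ⟩ := exists_root_hom hU f hfU d hd0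
  let τ' : H →* Matrix (Fin d) (Fin d) QB :=
    { toFun := fun h => ((δ h : QB)⁻¹) • τ h
      map_one' := by simp
      map_mul' := fun a b => by
        simp [Matrix.smul_mul, Matrix.mul_smul, smul_smul, mul_comm] }
  have hτ' : ∀ h, τ' h = ((δ h : QB)⁻¹) • τ h := fun h => rfl
  have hδ0 : ∀ h, (δ h : QB) ≠ 0 := fun h => (δ h).ne_zero
  have key : ∀ h μ, (τ' h).charpoly.IsRoot μ → ∃ u ∈ U, (u : QB) = δ h * μ := by
    intro h μ hμ
    rw [hτ'] at hμ
    have := isRoot_smul _ _ (inv_ne_zero (hδ0 h)) _ hμ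
    rw [inv_inv] at this
    exact hE h _ this
  have hδd : ∀ h, (δ h : QB) ^ d = (τ h).det := fun h => by
    rw [← hfv, ← hδ]; simp
  have hdet : ∀ h, (τ' h).det = 1 := by
    intro h
    rw [hτ', Matrix.det_smul, Fintype.card_fin, inv_pow, hδd, inv_mul_cancel₀]
    rw [← hδd]; exact pow_ne_zero _ (hδ0 h)
  refine irreducible_case hd (τ := τ') (T := T) ⟨hdet, ?_, ?_, ?_, ?_⟩
  · intro h μ μ' hμ hμ' k hk he
    obtain ⟨u, hu, e⟩ := key h μ hμ
    obtain ⟨u', hu', e'⟩ := key h μ' hμ'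
    have h1 : u / u' = 1 := by
      refine hU.tf _ (div_mem hu hu') k hk ?_
      rw [div_pow, div_eq_one]
      refine Units.ext ?_
      push_cast
      rw [e, e', mul_pow, mul_pow, he]
    rw [div_eq_one] at h1
    rw [h1, e'] at e
    exact (mul_left_cancel₀ (hδ0 h) e).symm
  · intro h μ hμ p hp hpT v hv
    obtain ⟨u, hu, e⟩ := key h μ hμ
    have h1 := hU.out_eq u hu p hp hpT v hv
    have h2 := hU.out_eq _ (hfU h) p hp hpT v hv
    rw [hfv, ← hδd, map_pow] at h2
    have h3 : v (δ h : QB) = 1 := (pow_eq_one_iff_of_nonneg (v.nonneg _) hd0.ne').1 h2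
    rw [e, map_mul, h3, one_mul] at h1
    exact h1.le
  · rw [eq_top_iff, ← hsp, Submodule.span_le]
    rintro _ ⟨h, rfl⟩
    have : τ h = (δ h : QB) • τ' h := by rw [hτ', smul_smul, mul_inv_cancel₀ (hδ0 h), one_smul]
    rw [this]
    exact Submodule.smul_mem _ _ (Submodule.subset_span ⟨h, rfl⟩)
  · intro s w a b c ha hb hc
    obtain ⟨ra, pa⟩ := single_pow hd0 _ a ha
    obtain ⟨rb, pb⟩ := single_pow hd0 _ b hb
    obtain ⟨rc, pc⟩ := single_pow hd0 _ c hc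
    rw [hdet] at pa pb pc
    obtain ⟨u, hu, e⟩ := key s a ra
    obtain ⟨u', hu', e'⟩ := key w b rb
    obtain ⟨u3, hu3, e3⟩ := key (s * w) c rc
    have h1 : u3 / (u * u') = 1 := by
      refine hU.tf _ (div_mem hu3 (mul_mem hu hu')) d hd0 ?_
      rw [div_pow, div_eq_one]
      refine Units.ext ?_
      push_cast
      rw [e, e', e3, map_mul, Units.val_mul, mul_pow, ← pc, mul_pow, mul_pow, mul_pow, mul_pow, ← pa, ← pb]
      ring
    rw [div_eq_one] at h1
    have h2 := congrArg Units.val h1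
    rw [Units.val_mul, e3, e, e', map_mul, Units.val_mul] at h2
    refine mul_left_cancel₀ (mul_ne_zero (hδ0 s) (hδ0 w)) (h2.trans ?_)
    ring
end

end UG

namespace UG
open Filter Polynomial
set_option autoImplicit false
set_option linter.unusedVariables false
set_option linter.unusedSectionVars false
section
variable {H : Type*} [Group H] {V : Type*} [AddCommGroup V] [Module QB V] [FiniteDimensional QB V]

lemma burnside [Nontrivial V] (τ : H →* Module.End QB V)
    (hirr : ∀ W : Submodule QB V, (∀ h, ∀ v ∈ W, τ h v ∈ W) → W = ⊥ ∨ W = ⊤) :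
    Submodule.span QB (Set.range τ) = ⊤ := by
  classical
  have hspan : (Subalgebra.toSubmodule (Algebra.adjoin QB (Set.range τ))) = Submodule.span QB (Set.range τ) := by
    rw [Algebra.adjoin_eq_span]
    congr 1
    have : Set.range τ = (MonoidHom.mrange τ : Set _) := rfl
    rw [this, Submonoid.closure_eq]
  set A := Algebra.adjoin QB (Set.range τ) with hA
  have hsimple : IsSimpleModule A V := by
    rw [isSimpleModule_iff]
    refine ⟨fun W => ?_⟩
    have hW := hirr (W.restrictScalars QB) (fun h v hv => by
      exact W.smul_mem (⟨τ h, Algebra.subset_adjoin ⟨h, rfl⟩⟩ : A) hv)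
    rcases hW with hW | hW
    · left; exact (Submodule.restrictScalars_eq_bot_iff ..).1 hW
    · right; exact (Submodule.restrictScalars_eq_top_iff ..).1 hW
  have hbij := IsSimpleModule.algebraMap_end_bijective_of_isAlgClosed (A := A) (V := V) QB
  rw [← hspan, eq_top_iff]
  intro f _
  let F : Module.End (Module.End A V) V :=
    { toFun := f
      map_add' := f.map_add
      map_smul' := fun g v => by
        obtain ⟨c, rfl⟩ := hbij.2 g
        simp }
  obtain ⟨s, hs⟩ := (Module.Finite.fg_top : (⊤ : Submodule QB V).FG)
  obtain ⟨r, hr⟩ := jacobson_density F s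
  have : f = (r : Module.End QB V) := by
    refine LinearMap.ext_on (s := s) hs fun m hm => ?_
    exact hr m hm
  rw [this]
  exact r.2

/-- eigenvalues of subquotients -/
lemma eig_sub (f : Module.End QB V) (A : Submodule QB V) (hA : ∀ v ∈ A, f v ∈ A) (v : V) (hv : v ∉ A) (μ : QB)
    (h : f v - μ • v ∈ A) : f.HasEigenvalue μ := by
  by_contra hcon
  have hinj : Function.Injective (f - algebraMap QB (Module.End QB V) μ) := by
    rw [← LinearMap.ker_eq_bot, Algebra.algebraMap_eq_smul_one, ← Module.End.eigenspace_def]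
    by_contra h2
    exact hcon h2
  let g : A →ₗ[QB] A := (f - algebraMap QB (Module.End QB V) μ).restrict (p := A) (q := A) (fun x hx => by
    simpa using A.sub_mem (hA x hx) (A.smul_mem μ hx))
  have hg : Function.Injective g := fun x y hxy => by
    have := congrArg Subtype.val hxy
    exact Subtype.ext (hinj this)
  obtain ⟨a, ha⟩ := (LinearMap.injective_iff_surjective.1 hg) ⟨_, h⟩
  have := congrArg Subtype.val ha
  have h3 : v = a := (hinj (this.trans (by simp))).symm
  exact hv (h3 ▸ a.2)

def Inv (τ : H →* Module.End QB V) (A : Submodule QB V) : Prop := ∀ h, ∀ v ∈ A, τ h v ∈ A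

lemma irr_step [Group.FG H] {U : Subgroup QBˣ} {T : Finset ℕ} (hU : UT U T) (τ : H →* Module.End QB V)
    (hE : ∀ h μ, (τ h).HasEigenvalue μ → ∃ u ∈ U, (u : QB) = μ)
    (A B : Submodule QB V) (hA : Inv τ A) (hB : Inv τ B) (hAB : A ≤ B)
    (hmin : ∀ W, Inv τ W → A ≤ W → W ≤ B → W = A ∨ W = B)
    (hdim : Module.finrank QB A + 2 ≤ Module.finrank QB B) : UFS H := by
  classical
  let A' : Submodule QB B := A.submoduleOf B
  let τB : H → Module.End QB B := fun h => (τ h).restrict (hB h)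
  have hA' : ∀ h, A' ≤ A'.comap (τB h) := fun h v hv => hA h v hv
  let σ : H →* Module.End QB (B ⧸ A') :=
    { toFun := fun h => A'.mapQ A' (τB h) (hA' h)
      map_one' := by
        refine LinearMap.ext fun x => ?_
        obtain ⟨v, rfl⟩ := A'.mkQ_surjective x
        simp only [Submodule.mkQ_apply, Submodule.mapQ_apply, Module.End.one_apply]
        congr 1
        refine Subtype.ext ?_
        change (τ 1) (v : V) = v
        simp
      map_mul' := fun g h => by
        refine LinearMap.ext fun x => ?_
        obtain ⟨v, rfl⟩ := A'.mkQ_surjective x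
        simp only [Submodule.mkQ_apply, Submodule.mapQ_apply, Module.End.mul_apply]
        congr 1
        refine Subtype.ext ?_
        change (τ (g * h)) (v : V) = τ g (τ h v)
        simp }
  have hσ : ∀ h v, σ h (A'.mkQ v) = A'.mkQ (τB h v) := fun h v => rfl
  obtain ⟨d, hd⟩ : ∃ d, d = Module.finrank QB (B ⧸ A') := ⟨_, rfl⟩
  have hdd : 2 ≤ d := by
    have h1 := Submodule.finrank_quotient_add_finrank A'
    have h2 : Module.finrank QB A' = Module.finrank QB A := (Submodule.submoduleOfEquivOfLe hAB).finrank_eq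
    omega
  have : Nontrivial (B ⧸ A') := Module.nontrivial_of_finrank_pos (R := QB) (by omega)
  have hsp := burnside σ (by
    intro W hW
    let W0 : Submodule QB V := (W.comap A'.mkQ).map B.subtype
    have hmemW0 : ∀ v : B, (v : V) ∈ W0 ↔ A'.mkQ v ∈ W := fun v => by
      simp only [W0, Submodule.mem_map, Submodule.mem_comap]
      constructor
      · rintro ⟨y, hy, e⟩
        have : y = v := Subtype.ext e
        rwa [← this]
      · intro hv; exact ⟨v, hv, rfl⟩
    have := hmin W0 (by
      rintro h _ ⟨v, hv, rfl⟩
      exact (hmemW0 (τB h v)).2 (by rw [← hσ]; exact hW h _ hv)) (by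
      intro a ha
      refine (hmemW0 ⟨a, hAB ha⟩).2 ?_
      have : A'.mkQ ⟨a, hAB ha⟩ = 0 := (Submodule.Quotient.mk_eq_zero _).2 ha
      rw [this]; exact W.zero_mem) (by rintro _ ⟨v, hv, rfl⟩; exact v.2)
    rcases this with h | h
    · left
      rw [eq_bot_iff]
      intro x hx
      obtain ⟨v, rfl⟩ := A'.mkQ_surjective x
      have : (v : V) ∈ A := h ▸ (hmemW0 v).2 hx
      exact (Submodule.Quotient.mk_eq_zero _).2 this
    · right
      rw [eq_top_iff]
      intro x _
      obtain ⟨v, rfl⟩ := A'.mkQ_surjective x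
      exact (hmemW0 v).1 (by rw [h]; exact v.2))
  let b : Module.Basis (Fin d) QB (B ⧸ A') := Module.finBasisOfFinrankEq QB (B ⧸ A') hd.symm
  let e := LinearMap.toMatrixAlgEquiv b
  refine irred_eigU hdd hU ((e : _ →* Matrix (Fin d) (Fin d) QB).comp σ) ?_ ?_
  · have : Set.range ((e : _ →* Matrix (Fin d) (Fin d) QB).comp σ) = e.toLinearMap '' (Set.range σ) := by
      rw [← Set.range_comp]; rfl
    rw [this, ← Submodule.map_span, hsp, Submodule.map_top, LinearMap.range_eq_top]
    exact e.surjective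
  · intro h μ hμ
    have h1 : (e (σ h)).charpoly = (σ h).charpoly := LinearMap.charpoly_toMatrix (σ h) b
    have h2 : (σ h).HasEigenvalue μ := by
      rw [Module.End.hasEigenvalue_iff_isRoot_charpoly, ← h1]; exact hμ
    obtain ⟨x, hx⟩ := h2.exists_hasEigenvector
    obtain ⟨v, rfl⟩ := A'.mkQ_surjective x
    refine hE h μ (eig_sub (τ h) A (hA h) v ?_ μ ?_)
    · intro hvA
      exact hx.2 ((Submodule.Quotient.mk_eq_zero _).2 hvA)
    · have h3 := hx.apply_eq_smul
      rw [hσ, ← sub_eq_zero, ← map_smul, ← map_sub] at h3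
      exact (Submodule.Quotient.mk_eq_zero A').1 h3
end

end UG

namespace UG
open Filter Polynomial
set_option autoImplicit false
set_option linter.unusedVariables false
set_option linter.unusedSectionVars false
section
variable {H : Type*} [Group H] {V : Type*} [AddCommGroup V] [Module QB V] [FiniteDimensional QB V]

/-- vectors on which `H` acts by `χ` modulo `A` -/
def NN (τ : H →* Module.End QB V) (χ : H →* QBˣ) (A : Submodule QB V) : Submodule QB V where
  carrier := {v | ∀ h, τ h v - (χ h : QB) • v ∈ A}
  zero_mem' := fun h => by simp
  add_mem' := fun {v w} hv hw h => by
    have := A.add_mem (hv h) (hw h)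
    rwa [sub_add_sub_comm, ← map_add, ← smul_add] at this
  smul_mem' := fun c v hv h => by
    have := A.smul_mem c (hv h)
    rwa [smul_sub, ← map_smul, smul_comm] at this

lemma mem_NN {τ : H →* Module.End QB V} {χ : H →* QBˣ} {A : Submodule QB V} {v : V} :
    v ∈ NN τ χ A ↔ ∀ h, τ h v - (χ h : QB) • v ∈ A := Iff.rfl

lemma NN_mono (τ : H →* Module.End QB V) (χ : H →* QBˣ) : Monotone (NN τ χ) :=
  fun A B hAB v hv h => hAB (hv h)

lemma le_NN {τ : H →* Module.End QB V} (χ : H →* QBˣ) {A : Submodule QB V} (hA : Inv τ A) : A ≤ NN τ χ A :=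
  fun v hv h => A.sub_mem (hA h v hv) (A.smul_mem _ hv)

lemma NN_inv {τ : H →* Module.End QB V} (χ : H →* QBˣ) {A : Submodule QB V} (hA : Inv τ A) : Inv τ (NN τ χ A) := by
  intro g v hv h
  have h1 := hA g _ (hv (g⁻¹ * h * g))
  have e1 : τ g (τ (g⁻¹ * h * g) v) = τ h (τ g v) := by
    rw [← Module.End.mul_apply, ← Module.End.mul_apply, ← map_mul, ← map_mul]
    congr 2; group
  have e2 : χ (g⁻¹ * h * g) = χ h := by
    rw [map_mul, map_mul, map_inv]; rw [mul_comm, mul_inv_cancel_left]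
  rw [map_sub, e1, map_smul, e2] at h1
  exact h1

lemma NNit_mono (τ : H →* Module.End QB V) (χ : H →* QBˣ) (k : ℕ) : Monotone ((NN τ χ)^[k]) :=
  (NN_mono τ χ).iterate k

lemma NNit_inv {τ : H →* Module.End QB V} (χ : H →* QBˣ) {A : Submodule QB V} (hA : Inv τ A) (k : ℕ) :
    Inv τ ((NN τ χ)^[k] A) := by
  induction k with
  | zero => exact hA
  | succ k ih => rw [Function.iterate_succ_apply']; exact NN_inv χ ih

lemma NNit_succ {τ : H →* Module.End QB V} (χ : H →* QBˣ) {A : Submodule QB V} (hA : Inv τ A) (k : ℕ) :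
    (NN τ χ)^[k] A ≤ (NN τ χ)^[k+1] A := by
  rw [Function.iterate_succ_apply']; exact le_NN χ (NNit_inv χ hA k)

lemma le_NNit {τ : H →* Module.End QB V} (χ : H →* QBˣ) {A : Submodule QB V} (hA : Inv τ A) (k : ℕ) :
    A ≤ (NN τ χ)^[k] A := by
  induction k with
  | zero => exact le_rfl
  | succ k ih => exact ih.trans (NNit_succ χ hA k)

lemma inv_inf {τ : H →* Module.End QB V} {A B : Submodule QB V} (hA : Inv τ A) (hB : Inv τ B) : Inv τ (A ⊓ B) :=
  fun h v hv => ⟨hA h v hv.1, hB h v hv.2⟩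

lemma inv_sup_span {τ : H →* Module.End QB V} {χ : H →* QBˣ} {A : Submodule QB V} (hA : Inv τ A) {v : V}
    (hv : v ∈ NN τ χ A) : Inv τ (A ⊔ Submodule.span QB {v}) := by
  intro h x hx
  obtain ⟨a, ha, y, hy, rfl⟩ := Submodule.mem_sup.1 hx
  obtain ⟨c, rfl⟩ := Submodule.mem_span_singleton.1 hy
  have : τ h (a + c • v) = (τ h a + c • (τ h v - (χ h : QB) • v)) + (c * (χ h : QB)) • v := by
    rw [map_add, map_smul, smul_sub, smul_smul]; abel
  rw [this]
  exact Submodule.add_mem_sup (A.add_mem (hA h a ha) (A.smul_mem c (hv h)))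
    (Submodule.smul_mem _ _ (Submodule.mem_span_singleton_self v))

lemma lt_sup_span {A : Submodule QB V} {v : V} (hv : v ∉ A) : A < A ⊔ Submodule.span QB {v} := by
  refine lt_of_le_of_ne le_sup_left fun h => hv ?_
  rw [h]
  exact Submodule.mem_sup_right (Submodule.mem_span_singleton_self v)

lemma coeff_unique {A : Submodule QB V} {v : V} (hv : v ∉ A) {c : QB} (h : c • v ∈ A) : c = 0 := by
  by_contra hc
  exact hv ((Submodule.smul_mem_iff A hc).1 h)

lemma NN_disj {τ : H →* Module.End QB V} {χ ψ : H →* QBˣ} (hne : χ ≠ ψ) {A : Submodule QB V} (hA : Inv τ A)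
    (i j : ℕ) : (NN τ χ)^[i] A ⊓ (NN τ ψ)^[j] A ≤ A := by
  obtain ⟨h, hh⟩ : ∃ h, χ h ≠ ψ h := by
    by_contra hcon; push Not at hcon; exact hne (MonoidHom.ext hcon)
  have key : ∀ (φ : H →* QBˣ) (k : ℕ) (v : V), v ∈ (NN τ φ)^[k] A →
      aeval (τ h) ((X - C (φ h : QB)) ^ k) v ∈ A := by
    intro φ k
    induction k with
    | zero => intro v hv; simpa using hv
    | succ k ih =>
      intro v hv
      rw [Function.iterate_succ_apply'] at hv
      have := ih _ (hv h)
      rw [pow_succ, map_mul, Module.End.mul_apply]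
      simpa using! this
  have hinv : ∀ (p : QB[X]) (v : V), v ∈ A → aeval (τ h) p v ∈ A := by
    intro p v hv
    induction p using Polynomial.induction_on' with
    | add p q hp hq => rw [map_add, LinearMap.add_apply]; exact A.add_mem hp hq
    | monomial n a =>
      rw [aeval_monomial, Module.End.mul_apply, Module.algebraMap_end_apply]
      refine A.smul_mem _ ?_
      induction n with
      | zero => simpa using hv
      | succ n ih => rw [pow_succ', Module.End.mul_apply]; exact hA h _ ih
  have hcop : IsCoprime ((X - C (χ h : QB)) ^ i) ((X - C (ψ h : QB)) ^ j) := by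
    refine IsCoprime.pow (isCoprime_X_sub_C_of_isUnit_sub ?_)
    exact (sub_ne_zero.2 fun e => hh (Units.ext e)).isUnit
  obtain ⟨a, b, hab⟩ := hcop
  intro v hv
  have h1 := congrArg (fun p => aeval (τ h) p v) hab
  simp only [map_add, map_mul, LinearMap.add_apply, Module.End.mul_apply, map_one, Module.End.one_apply] at h1
  rw [← h1]
  exact A.add_mem (hinv _ _ (key χ i v hv.1)) (hinv _ _ (key ψ j v hv.2))

lemma exists_line [Group.FG H] {U : Subgroup QBˣ} {T : Finset ℕ} (hU : UT U T) (τ : H →* Module.End QB V)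
    (hE : ∀ h μ, (τ h).HasEigenvalue μ → ∃ u ∈ U, (u : QB) = μ) (hno : ¬ UFS H)
    (A B : Submodule QB V) (hA : Inv τ A) (hB : Inv τ B) (hAB : A < B) :
    ∃ v ∈ B, v ∉ A ∧ ∃ χ : H →* QBˣ, (∀ h, χ h ∈ U) ∧ v ∈ NN τ χ A := by
  classical
  have hex : ∃ k, ∃ W, Inv τ W ∧ A < W ∧ W ≤ B ∧ Module.finrank QB W = k := ⟨_, B, hB, hAB, le_rfl, rfl⟩
  obtain ⟨W, hW, hAW, hWB, hk⟩ := Nat.find_spec hex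
  have hmin : ∀ W', Inv τ W' → A ≤ W' → W' ≤ W → W' = A ∨ W' = W := by
    intro W' h1 h2 h3
    by_cases h4 : W' = A
    · exact Or.inl h4
    · right
      refine Submodule.eq_of_le_of_finrank_le h3 ?_
      rw [hk]
      exact Nat.find_min' hex ⟨W', h1, lt_of_le_of_ne h2 (Ne.symm h4), h3.trans hWB, rfl⟩
  have hdim : ¬ (Module.finrank QB A + 2 ≤ Module.finrank QB W) := fun h =>
    hno (irr_step hU τ hE A W hA hW hAW.le hmin h)
  obtain ⟨v, hvW, hvA⟩ := SetLike.exists_of_lt hAW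
  have hWeq : A ⊔ Submodule.span QB {v} = W := by
    refine Submodule.eq_of_le_of_finrank_le (sup_le hAW.le ?_) ?_
    · rw [Submodule.span_singleton_le_iff_mem]; exact hvW
    · have := Submodule.finrank_lt_finrank_of_lt (lt_sup_span hvA)
      omega
  have h1 : ∀ h, ∃ u : QBˣ, u ∈ U ∧ τ h v - (u : QB) • v ∈ A := by
    intro h
    have h2 : τ h v ∈ A ⊔ Submodule.span QB {v} := by rw [hWeq]; exact hW h v hvW
    obtain ⟨a, ha, y, hy, e⟩ := Submodule.mem_sup.1 h2
    obtain ⟨c, rfl⟩ := Submodule.mem_span_singleton.1 hy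
    have h3 : τ h v - c • v ∈ A := by rw [← e, add_sub_cancel_right]; exact ha
    obtain ⟨u, hu, rfl⟩ := hE h c (eig_sub (τ h) A (hA h) v hvA c h3)
    exact ⟨u, hu, h3⟩
  choose χ hχU hχ using h1
  refine ⟨v, hWB hvW, hvA, MonoidHom.mk' χ fun g h => ?_, hχU, hχ⟩
  have h2 := hχ (g * h)
  have h3 := hA g _ (hχ h)
  have h4 := A.smul_mem (χ h : QB) (hχ g)
  have h5 : ((χ (g * h) : QB) - χ g * χ h) • v ∈ A := by
    have := A.sub_mem (A.add_mem h3 h4) h2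
    rw [map_sub, map_smul, map_mul, Module.End.mul_apply] at this
    convert this using 1
    rw [sub_smul, smul_sub, smul_smul, mul_comm]; abel
  have h6 := coeff_unique hvA h5
  exact Units.ext (by rw [Units.val_mul]; exact sub_eq_zero.1 h6)

lemma split_ext [Group.FG H] {U : Subgroup QBˣ} {T : Finset ℕ} (hU : UT U T) (τ : H →* Module.End QB V)
    (hno : ¬ UFS H) (A : Submodule QB V) (hA : Inv τ A) (χ ψ : H →* QBˣ) (hχ : ∀ h, χ h ∈ U) (hψ : ∀ h, ψ h ∈ U)
    (hne : χ ≠ ψ) (v w : V) (hv : v ∈ NN τ χ A) (hvA : v ∉ A) (hw : w ∈ NN τ ψ (A ⊔ Submodule.span QB {v})) :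
    ∃ t : QB, w + t • v ∈ NN τ ψ A := by
  classical
  have h1 : ∀ h, ∃ b : QB, τ h w - (ψ h : QB) • w - b • v ∈ A := by
    intro h
    obtain ⟨a, ha, y, hy, e⟩ := Submodule.mem_sup.1 (hw h)
    obtain ⟨c, rfl⟩ := Submodule.mem_span_singleton.1 hy
    exact ⟨c, by rw [← e, add_sub_cancel_right]; exact ha⟩
  choose b hb using h1
  have hb2 : ∀ g h, b (g * h) = ψ h * b g + χ g * b h := by
    intro g h
    have e1 := hA g _ (hb h)
    have e2 := A.smul_mem (ψ h : QB) (hb g)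
    have e3 := A.smul_mem (b h) (hv g)
    have h5 : (b (g * h) - (ψ h * b g + χ g * b h)) • v ∈ A := by
      have := A.sub_mem (A.add_mem (A.add_mem e1 e2) e3) (hb (g * h))
      rw [map_sub, map_sub, map_smul, map_smul, map_mul, Module.End.mul_apply, map_mul, Units.val_mul] at this
      convert this using 1
      module
    exact sub_eq_zero.1 (coeff_unique hvA h5)
  have hno' : ∃ y, ∀ h, ((χ / ψ) h : QB) * y + b h * (ψ h : QB)⁻¹ = y := by
    by_contra hcon
    refine hno (affine_case (χ / ψ) (fun h => b h * (ψ h : QB)⁻¹) ?_ ?_ ?_ hcon)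
    · intro g h
      rw [hb2]
      have := (ψ g).ne_zero
      have := (ψ h).ne_zero
      simp only [map_mul, Units.val_mul, MonoidHom.div_apply, Units.val_div_eq_div_val]
      field_simp
    · intro h k hk e
      exact hU.tf _ (div_mem (hχ h) (hψ h)) k hk e
    · by_contra hc
      push Not at hc
      refine hne (MonoidHom.ext fun h => ?_)
      have := hc h
      rwa [MonoidHom.div_apply, div_eq_one] at this
  obtain ⟨y, hy⟩ := hno'
  refine ⟨y, fun h => ?_⟩
  have e1 := A.add_mem (hb h) (A.smul_mem y (hv h))
  have e2 : b h = y * ψ h - y * χ h := by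
    have := hy h
    have hp := (ψ h).ne_zero
    rw [MonoidHom.div_apply, Units.val_div_eq_div_val] at this
    field_simp at this
    linear_combination this
  rw [e2] at e1
  convert e1 using 1
  rw [map_add, map_smul]
  module
end

end UG

namespace UG
open Filter Polynomial
set_option autoImplicit false
set_option linter.unusedVariables false
set_option linter.unusedSectionVars false
section
variable {H : Type*} [Group H] {V : Type*} [AddCommGroup V] [Module QB V] [FiniteDimensional QB V]

lemma decomp [Group.FG H] {U : Subgroup QBˣ} {T : Finset ℕ} (hU : UT U T) (τ : H →* Module.End QB V)
    (hE : ∀ h μ, (τ h).HasEigenvalue μ → ∃ u ∈ U, (u : QB) = μ) (hno : ¬ UFS H) (k : ℕ) :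
    ∀ A B : Submodule QB V, Inv τ A → Inv τ B → A ≤ B → Module.finrank QB B ≤ Module.finrank QB A + k →
      B ≤ ⨆ χ : {χ : H →* QBˣ // ∀ h, χ h ∈ U}, B ⊓ (NN τ χ.1)^[k] A := by
  induction k with
  | zero =>
    intro A B hA hB hAB hf
    have : A = B := Submodule.eq_of_le_of_finrank_le hAB hf
    subst this
    exact le_iSup_of_le ⟨1, fun h => one_mem _⟩ (le_inf le_rfl le_rfl)
  | succ k ih =>
    intro A B hA hB hAB hf
    have single : ∀ χ : H →* QBˣ, (∀ h, χ h ∈ U) → B ≤ (NN τ χ)^[k+1] A →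
        B ≤ ⨆ χ : {χ : H →* QBˣ // ∀ h, χ h ∈ U}, B ⊓ (NN τ χ.1)^[k+1] A := fun χ hχ h =>
      le_iSup_of_le ⟨χ, hχ⟩ (le_inf le_rfl h)
    by_cases hlt : A = B
    · subst hlt
      exact single 1 (fun h => one_mem _) (le_NNit 1 hA _)
    have hlt : A < B := lt_of_le_of_ne hAB hlt
    have step : ∀ L, Inv τ L → A < L → L ≤ B →
        (B ≤ ⨆ χ : {χ : H →* QBˣ // ∀ h, χ h ∈ U}, B ⊓ (NN τ χ.1)^[k+1] A) ∨
        ∃ ψ : H →* QBˣ, (∀ h, ψ h ∈ U) ∧ B ≤ (NN τ ψ)^[k] L := by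
      intro L hL hAL hLB
      have hfL := Submodule.finrank_lt_finrank_of_lt hAL
      have h1 := ih L B hL hB hLB (by omega)
      by_cases hex : ∃ ψ : H →* QBˣ, (∀ h, ψ h ∈ U) ∧ B ≤ (NN τ ψ)^[k] L
      · exact Or.inr hex
      · left
        refine h1.trans (iSup_le fun ψ => ?_)
        have hWlt : B ⊓ (NN τ ψ.1)^[k] L < B := by
          refine lt_of_le_of_ne inf_le_left fun e => hex ⟨ψ.1, ψ.2, ?_⟩
          exact inf_eq_left.1 e
        have hfW := Submodule.finrank_lt_finrank_of_lt hWlt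
        refine (ih A (B ⊓ (NN τ ψ.1)^[k] L) hA (inv_inf hB (NNit_inv _ hL k))
          (le_inf hAB (hAL.le.trans (le_NNit _ hL k))) (by omega)).trans ?_
        exact iSup_mono fun χ => inf_le_inf inf_le_left (NNit_succ _ hA k)
    obtain ⟨v, hvB, hvA, χ, hχ, hv⟩ := exists_line hU τ hE hno A B hA hB hlt
    set L := A ⊔ Submodule.span QB {v} with hLdef
    have hL : Inv τ L := inv_sup_span hA hv
    have hAL : A < L := lt_sup_span hvA
    have hLB : L ≤ B := sup_le hAB ((Submodule.span_singleton_le_iff_mem _ _).2 hvB)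
    have hLN : L ≤ NN τ χ A := sup_le (le_NN χ hA) ((Submodule.span_singleton_le_iff_mem _ _).2 hv)
    rcases step L hL hAL hLB with h | ⟨ψ, hψ, hBψ⟩
    · exact h
    by_cases hLB' : L = B
    · refine single χ hχ ?_
      rw [← hLB', Function.iterate_succ_apply]
      exact hLN.trans (le_NNit χ (NN_inv χ hA) k)
    by_cases hχψ : χ = ψ
    · subst hχψ
      refine single χ hχ ?_
      rw [Function.iterate_succ_apply]
      exact hBψ.trans (NNit_mono τ χ k hLN)
    obtain ⟨w, hwB, hwL, ψ', hψ', hw⟩ := exists_line hU τ hE hno L B hL hB (lt_of_le_of_ne hLB hLB')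
    have e : ψ' = ψ := by
      by_contra hne
      exact hwL (NN_disj hne hL 1 k ⟨hw, hBψ hwB⟩)
    subst e
    obtain ⟨t, ht⟩ := split_ext hU τ hno A hA χ ψ' hχ hψ hχψ v w hv hvA hw
    set w' := w + t • v with hw'
    have hvL : v ∈ L := Submodule.mem_sup_right (Submodule.mem_span_singleton_self v)
    have hw'L : w' ∉ L := fun h => hwL (by
      have := L.sub_mem h (L.smul_mem t hvL)
      rwa [hw', add_sub_cancel_right] at this)
    have hw'A : w' ∉ A := fun h => hw'L (hAL.le h)
    have hw'B : w' ∈ B := B.add_mem hwB (B.smul_mem t hvB)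
    set L1 := A ⊔ Submodule.span QB {w'} with hL1def
    have hL1 : Inv τ L1 := inv_sup_span hA ht
    have hL1B : L1 ≤ B := sup_le hAB ((Submodule.span_singleton_le_iff_mem _ _).2 hw'B)
    have hL1N : L1 ≤ NN τ ψ' A := sup_le (le_NN ψ' hA) ((Submodule.span_singleton_le_iff_mem _ _).2 ht)
    rcases step L1 hL1 (lt_sup_span hw'A) hL1B with h | ⟨φ, hφ, hBφ⟩
    · exact h
    by_cases hφψ : φ = ψ'
    · subst hφψ
      refine single φ hφ ?_
      rw [Function.iterate_succ_apply]
      exact hBφ.trans (NNit_mono τ φ k hL1N)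
    have hC : Inv τ (L ⊔ L1) := by
      intro h x hx
      obtain ⟨a, ha, b, hb, rfl⟩ := Submodule.mem_sup.1 hx
      rw [map_add]
      exact Submodule.add_mem_sup (hL h a ha) (hL1 h b hb)
    have hBC : B ≤ L ⊔ L1 := (le_inf (hBφ.trans (NNit_mono τ φ k le_sup_right))
      (hBψ.trans (NNit_mono τ ψ' k le_sup_left))).trans (NN_disj hφψ hC k k)
    refine hBC.trans (sup_le ?_ ?_)
    · refine le_iSup_of_le ⟨χ, hχ⟩ (le_inf hLB ?_)
      change L ≤ (NN τ χ)^[k+1] A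
      rw [Function.iterate_succ_apply]
      exact hLN.trans (le_NNit χ (NN_inv χ hA) k)
    · refine le_iSup_of_le ⟨ψ', hψ'⟩ (le_inf hL1B ?_)
      change L1 ≤ (NN τ ψ')^[k+1] A
      rw [Function.iterate_succ_apply]
      exact hL1N.trans (le_NNit ψ' (NN_inv ψ' hA) k)

lemma lcs_lower (τ : H →* Module.End QB V) (χ : H →* QBˣ) (j : ℕ) :
    ∀ a ∈ (⊤ : Subgroup H).lowerCentralSeries j, ∀ i, ∀ v ∈ (NN τ χ)^[i + j + 1] (⊥ : Submodule QB V),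
      τ a v - (χ a : QB) • v ∈ (NN τ χ)^[i] (⊥ : Submodule QB V) := by
  have hbot : Inv τ (⊥ : Submodule QB V) := fun h v hv => by
    rw [Submodule.mem_bot] at hv ⊢; rw [hv, map_zero]
  have hF : ∀ i, Inv τ ((NN τ χ)^[i] ⊥) := fun i => NNit_inv χ hbot i
  have hD : ∀ i a v, v ∈ (NN τ χ)^[i + 1] (⊥ : Submodule QB V) →
      τ a v - (χ a : QB) • v ∈ (NN τ χ)^[i] (⊥ : Submodule QB V) := by
    intro i a v hv
    rw [Function.iterate_succ_apply'] at hv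
    exact hv a
  have hc : ∀ a b v, τ (a * b) v = τ a (τ b v) := fun a b v => by rw [map_mul, Module.End.mul_apply]
  let K : ℕ → Subgroup H := fun j =>
    { carrier := {a | ∀ i, ∀ v ∈ (NN τ χ)^[i + j + 1] (⊥ : Submodule QB V),
        τ a v - (χ a : QB) • v ∈ (NN τ χ)^[i] (⊥ : Submodule QB V)}
      one_mem' := fun i v hv => by simp
      mul_mem' := fun {a b} ha hb i v hv => by
        have := Submodule.add_mem _ (hF i a _ (hb i v hv)) (Submodule.smul_mem _ (χ b : QB) (ha i v hv))
        convert this using 1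
        rw [hc, map_mul, Units.val_mul, map_sub, map_smul]
        module
      inv_mem' := fun {a} ha i v hv => by
        have := Submodule.smul_mem _ (-(χ a : QB)⁻¹) (hF i a⁻¹ _ (ha i v hv))
        convert this using 1
        rw [map_sub, ← hc, inv_mul_cancel, map_one, Module.End.one_apply, map_smul, map_inv χ a, smul_sub, smul_smul,
          neg_mul, inv_mul_cancel₀ (χ a).ne_zero, Units.val_inv_eq_inv_val]
        module }
  suffices h : (⊤ : Subgroup H).lowerCentralSeries j ≤ K j from fun a ha => h ha
  induction j with
  | zero => intro a _ i v hv; exact hD i a v hv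
  | succ j ih =>
    rw [Subgroup.lowerCentralSeries_succ, Subgroup.commutator_le]
    intro a ha b _ i v hv
    have ha' := ih ha
    set u := τ (b * a)⁻¹ v with hu
    have hvu : v = τ (b * a) u := by rw [hu, ← hc, mul_inv_cancel, map_one, Module.End.one_apply]
    have huF : u ∈ (NN τ χ)^[i + j + 1 + 1] (⊥ : Submodule QB V) := hF _ _ _ hv
    have e1 := ha' i _ (hD _ b u huF)
    have e2 := hD i b _ (ha' (i + 1) u (by
      have : i + 1 + j + 1 = i + j + 1 + 1 := by ring
      rw [this]; exact huF))
    open scoped commutatorElement in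
    have hχ1 : χ ⁅a, b⁆ = 1 := by
      rw [map_commutatorElement, commutatorElement_eq_one_iff_mul_comm, mul_comm]
    open scoped commutatorElement in
    have e3 : τ ⁅a, b⁆ v = τ (a * b) u := by
      rw [hvu, ← hc]; congr 2; rw [commutatorElement_def]; group
    rw [hχ1, e3, Units.val_one, one_smul, hvu]
    have := Submodule.sub_mem _ e1 e2
    convert this using 1
    rw [hc, hc, map_sub, map_sub, map_smul, map_smul]
    module

theorem dichotomy [Group.FG H] {U : Subgroup QBˣ} {T : Finset ℕ} (hU : UT U T) (τ : H →* Module.End QB V)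
    (hE : ∀ h μ, (τ h).HasEigenvalue μ → ∃ u ∈ U, (u : QB) = μ)
    (hnil : ∃ a ∈ (⊤ : Subgroup H).lowerCentralSeries (Module.finrank QB V + 1), τ a ≠ 1) : UFS H := by
  by_contra hno
  obtain ⟨a, ha, hne⟩ := hnil
  apply hne
  have hbot : Inv τ (⊥ : Submodule QB V) := fun h v hv => by
    rw [Submodule.mem_bot] at hv ⊢; rw [hv, map_zero]
  have h1 := decomp hU τ hE hno (Module.finrank QB V) ⊥ ⊤ hbot (fun _ _ _ => trivial) bot_le (by simp)
  have h2 : (⨆ χ : {χ : H →* QBˣ // ∀ h, χ h ∈ U}, ⊤ ⊓ (NN τ χ.1)^[Module.finrank QB V] ⊥) ≤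
      LinearMap.ker (τ a - 1) := by
    refine iSup_le fun χ => ?_
    rintro v ⟨-, hv⟩
    have h3 := lcs_lower τ χ.1 _ a ha 0 v (NNit_succ _ hbot _ (by
      rw [zero_add]; exact NNit_succ _ hbot _ hv))
    have h4 : χ.1 a = 1 := by
      have h5 : a ∈ (⊤ : Subgroup H).lowerCentralSeries 1 :=
        Subgroup.lowerCentralSeries_antitone _ (by omega : 1 ≤ Module.finrank QB V + 1) ha
      rw [Subgroup.top_lowerCentralSeries_one] at h5
      exact Abelianization.commutator_subset_ker χ.1 h5
    rw [h4, Units.val_one, one_smul] at h3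
    rw [LinearMap.mem_ker]
    exact (Submodule.mem_bot _).1 h3
  have h3 := top_le_iff.1 (h1.trans h2)
  rw [LinearMap.ker_eq_top, sub_eq_zero] at h3
  exact h3
end

end UG

namespace UG
open Filter Polynomial
set_option autoImplicit false
set_option linter.unusedVariables false
set_option linter.unusedSectionVars false
section
variable {A : Type} [CommRing A] [IsDomain A] [Algebra ℚ A]

/-- `φ` specializes the parameters to `a` -/
def Spec {s : ℕ} (g : MvPolynomial (Fin s) ℚ →ₐ[ℚ] A) (a : Fin s → ℤ) (φ : A →ₐ[ℚ] QB) : Prop :=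
  ∀ P, φ (g P) = algebraMap ℚ QB (MvPolynomial.eval (fun i => (a i : ℚ)) P)

lemma clear_denom {σ : Type*} (P : MvPolynomial σ ℚ) :
    ∃ c : ℤ, c ≠ 0 ∧ ∃ Q : MvPolynomial σ ℤ, MvPolynomial.map (Int.castRingHom ℚ) Q = MvPolynomial.C (c : ℚ) * P := by
  induction P using MvPolynomial.induction_on with
  | C a =>
    refine ⟨a.den, by simp, MvPolynomial.C a.num, ?_⟩
    rw [MvPolynomial.map_C, ← MvPolynomial.C_mul]
    congr 1
    simp [mul_comm, Rat.mul_den_eq_num]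
  | add p q hp hq =>
    obtain ⟨c, hc, Q, hQ⟩ := hp
    obtain ⟨c', hc', Q', hQ'⟩ := hq
    refine ⟨c * c', mul_ne_zero hc hc', MvPolynomial.C c' * Q + MvPolynomial.C c * Q', ?_⟩
    rw [map_add, map_mul, map_mul, hQ, hQ', MvPolynomial.map_C, MvPolynomial.map_C]
    push_cast
    rw [map_mul, eq_intCast, eq_intCast]
    ring
  | mul_X p i hp =>
    obtain ⟨c, hc, Q, hQ⟩ := hp
    refine ⟨c, hc, Q * MvPolynomial.X i, ?_⟩
    rw [map_mul, hQ, MvPolynomial.map_X, mul_assoc]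

lemma clear_denom_eval {s : ℕ} (P : MvPolynomial (Fin s) ℚ) :
    ∃ c : ℤ, c ≠ 0 ∧ ∀ a : Fin s → ℤ, ∃ m : ℤ, (m : ℚ) = c * MvPolynomial.eval (fun i => (a i : ℚ)) P := by
  obtain ⟨c, hc, Q, hQ⟩ := clear_denom P
  refine ⟨c, hc, fun a => ⟨MvPolynomial.eval a Q, ?_⟩⟩
  have := congrArg (MvPolynomial.eval (fun i => (a i : ℚ))) hQ
  rw [map_mul, MvPolynomial.eval_C, MvPolynomial.eval_map] at this
  rw [← this]
  have h2 := MvPolynomial.eval₂_comp_left (Int.castRingHom ℚ) (RingHom.id ℤ) a Q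
  exact h2

lemma spec_int {s : ℕ} (g : MvPolynomial (Fin s) ℚ →ₐ[ℚ] A) (hintg : g.IsIntegral) (x : A) :
    ∃ c : ℤ, c ≠ 0 ∧ ∃ D : ℕ, ∀ a φ, Spec g a φ → ∃ W : ℤ[X], W.natDegree ≤ D ∧ W.leadingCoeff = c ∧
      aeval (φ x) W = 0 := by
  obtain ⟨P, hP, hx⟩ := hintg x
  choose c hc hm using fun k => clear_denom_eval (P.coeff k)
  let c0 : ℤ := ∏ k ∈ Finset.range (P.natDegree + 1), c k
  have hc0 : c0 ≠ 0 := Finset.prod_ne_zero_iff.2 fun k _ => hc k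
  refine ⟨c0, hc0, P.natDegree, fun a φ hφ => ?_⟩
  let E : MvPolynomial (Fin s) ℚ →+* ℚ := MvPolynomial.eval (fun i => (a i : ℚ))
  have h1 : ∀ k ∈ Finset.range (P.natDegree + 1), ∃ m : ℤ, (m : ℚ) = c0 * E (P.coeff k) := by
    intro k hk
    obtain ⟨m, hm⟩ := hm k a
    refine ⟨(∏ j ∈ (Finset.range (P.natDegree + 1)).erase k, c j) * m, ?_⟩
    have : c0 = (∏ j ∈ (Finset.range (P.natDegree + 1)).erase k, c j) * c k := by
      rw [Finset.prod_erase_mul _ _ hk]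
    rw [this]
    push_cast
    rw [hm, mul_assoc]
  let m : ℕ → ℤ := fun k => if h : k ∈ Finset.range (P.natDegree + 1) then (h1 k h).choose else 0
  have hmk : ∀ k ∈ Finset.range (P.natDegree + 1), (m k : ℚ) = c0 * E (P.coeff k) := by
    intro k hk
    simp only [m, dif_pos hk]
    exact (h1 k hk).choose_spec
  let W : ℤ[X] := ∑ k ∈ Finset.range (P.natDegree + 1), C (m k) * X ^ k
  have hWc : ∀ k, W.coeff k = if k ∈ Finset.range (P.natDegree + 1) then m k else 0 := by
    intro k
    simp only [W, finsetSum_coeff, coeff_C_mul_X_pow]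
    rw [Finset.sum_ite_eq]
  have hmap : W.map (Int.castRingHom ℚ) = C (c0 : ℚ) * P.map E := by
    ext k
    rw [coeff_map, coeff_C_mul, coeff_map, hWc]
    split_ifs with h
    · rw [eq_intCast, hmk k h]
    · rw [coeff_eq_zero_of_natDegree_lt (by simpa using h)]; simp
  have hdeg : W.natDegree ≤ P.natDegree := by
    rw [natDegree_le_iff_coeff_eq_zero]
    intro k hk
    rw [hWc, if_neg (by simpa using hk)]
  have htop : W.coeff P.natDegree = c0 := by
    have := congrArg (fun p => coeff p P.natDegree) hmap
    simp only [coeff_map, coeff_C_mul] at this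
    rw [show P.coeff P.natDegree = 1 from hP, map_one, mul_one, eq_intCast] at this
    exact_mod_cast this
  have hdeg' : W.natDegree = P.natDegree :=
    le_antisymm hdeg (le_natDegree_of_ne_zero (by rw [htop]; exact hc0))
  refine ⟨W, hdeg, by rw [leadingCoeff, hdeg', htop], ?_⟩
  have h3 : aeval (φ x) W = aeval (φ x) (W.map (Int.castRingHom ℚ)) := (aeval_map_algebraMap ℚ (φ x) W).symm
  rw [h3, hmap, map_mul]
  have h4 : aeval (φ x) (P.map E) = φ (eval₂ (g : MvPolynomial (Fin s) ℚ →+* A) x P) := by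
    rw [aeval_def, eval₂_map]
    change _ = (φ : A →+* QB) _
    rw [hom_eval₂]
    congr 1
    refine RingHom.ext fun q => ?_
    change algebraMap ℚ QB (E _) = φ (g _)
    rw [hφ]
  rw [h4]
  have : eval₂ (g : MvPolynomial (Fin s) ℚ →+* A) x P = 0 := hx
  rw [this, map_zero, mul_zero]

lemma exists_spec {s : ℕ} (g : MvPolynomial (Fin s) ℚ →ₐ[ℚ] A) (hinj : Function.Injective g) (hintg : g.IsIntegral)
    (a : Fin s → ℤ) : ∃ φ, Spec g a φ := by
  let E : MvPolynomial (Fin s) ℚ →ₐ[ℚ] ℚ := MvPolynomial.aeval (fun i => (a i : ℚ))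
  have hEs : Function.Surjective E := fun q => ⟨MvPolynomial.C q, by simp [E]⟩
  algebraize [g.toRingHom]
  have hI : Algebra.IsIntegral (MvPolynomial (Fin s) ℚ) A := ⟨hintg⟩
  have : (RingHom.ker E).IsMaximal := RingHom.ker_isMaximal_of_surjective _ hEs
  obtain ⟨Q, hQ, hQc⟩ := Ideal.exists_ideal_over_maximal_of_isIntegral (S := A) (RingHom.ker E) (by
    have : RingHom.ker (algebraMap (MvPolynomial (Fin s) ℚ) A) = ⊥ := (RingHom.injective_iff_ker_eq_bot _).1 hinj
    rw [this]; exact bot_le)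
  have hgQ : ∀ P, g P - algebraMap ℚ A (E P) ∈ Q := by
    intro P
    have : P - MvPolynomial.C (E P) ∈ Q.comap (algebraMap (MvPolynomial (Fin s) ℚ) A) := by
      rw [hQc, RingHom.mem_ker, map_sub, sub_eq_zero]
      simp [E]
    rw [Ideal.mem_comap, map_sub] at this
    have h2 : g (MvPolynomial.C (E P)) = algebraMap ℚ A (E P) := by
      rw [← MvPolynomial.algebraMap_eq, AlgHom.commutes]
    rw [← h2]
    exact this
  let _ : Field (A ⧸ Q) := Ideal.Quotient.field Q
  have halg : Algebra.IsAlgebraic ℚ (A ⧸ Q) := by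
    have : Algebra.IsIntegral ℚ (A ⧸ Q) := by
      refine ⟨fun y => ?_⟩
      obtain ⟨x, rfl⟩ := Ideal.Quotient.mk_surjective y
      obtain ⟨P, hP, hx⟩ := hintg x
      refine ⟨P.map (E : _ →+* ℚ), hP.map _, ?_⟩
      rw [eval₂_map]
      have h1 := congrArg (Ideal.Quotient.mk Q) hx
      rw [hom_eval₂, map_zero] at h1
      rw [← h1]
      congr 1
      refine RingHom.ext fun P => ?_
      have := (Ideal.Quotient.mk_eq_mk_iff_sub_mem _ _).2 (hgQ P)
      exact this.symm
    infer_instance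
  let ψ : (A ⧸ Q) →ₐ[ℚ] QB := IsAlgClosed.lift
  refine ⟨ψ.comp (Ideal.Quotient.mkₐ ℚ Q), fun P => ?_⟩
  have := (Ideal.Quotient.mk_eq_mk_iff_sub_mem _ _).2 (hgQ P)
  have h2 : (ψ.comp (Ideal.Quotient.mkₐ ℚ Q)) (g P) = ψ (Ideal.Quotient.mk Q (algebraMap ℚ A (E P))) := by
    rw [← this]; rfl
  rw [h2]
  have h3 : ψ (Ideal.Quotient.mk Q (algebraMap ℚ A (E P))) = algebraMap ℚ QB (E P) := ψ.commutes (E P)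
  rw [h3]
  simp only [E, MvPolynomial.aeval_eq_eval]

lemma exists_avoid {s : ℕ} (g : MvPolynomial (Fin s) ℚ →ₐ[ℚ] A) (hinj : Function.Injective g) (hintg : g.IsIntegral)
    (f : A) (hf : f ≠ 0) : ∃ a, ∀ φ, Spec g a φ → φ f ≠ 0 := by
  algebraize [g.toRingHom]
  have hI : Algebra.IsIntegral (MvPolynomial (Fin s) ℚ) A := ⟨hintg⟩
  have : FaithfulSMul (MvPolynomial (Fin s) ℚ) A := (faithfulSMul_iff_algebraMap_injective _ _).2 hinj
  have hfa : IsAlgebraic (MvPolynomial (Fin s) ℚ) f := (hI.isIntegral f).isAlgebraic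
  obtain ⟨r, hr, hrf⟩ := hfa.exists_nonzero_dvd (mem_nonZeroDivisors_of_ne_zero hf)
  by_contra hcon
  push Not at hcon
  apply hr
  refine MvPolynomial.funext_set (fun _ => Set.range ((↑) : ℤ → ℚ)) (fun _ => Set.infinite_range_of_injective Int.cast_injective) fun x hx => ?_
  choose a ha using fun i => hx i trivial
  obtain ⟨φ, hφ, h0⟩ := hcon a
  obtain ⟨y, hy⟩ := hrf
  have h1 : φ (g r) = 0 := by
    have : g r = f * y := hy
    rw [this, map_mul, h0, zero_mul]
  rw [hφ] at h1
  have h2 := (map_eq_zero _).1 h1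
  have h3 : (fun i => (a i : ℚ)) = x := funext ha
  rw [h3] at h2
  rw [h2, map_zero]
end

end UG

namespace UG
open Filter Polynomial
set_option autoImplicit false
set_option linter.unusedVariables false
set_option linter.unusedSectionVars false
lemma exists_G0 {G : Type*} [Group G] [Group.FG G] (B : ℕ) :
    ∃ G0 : Subgroup G, G0.FiniteIndex ∧ ∀ K : Subgroup G, K.index ≠ 0 → K.index ≤ B → G0 ≤ K := by
  classical
  obtain ⟨S, hS⟩ := Group.fg_def.1 (inferInstance : Group.FG G)
  have hfin : ∀ j : Fin (B + 1), Finite (G →* Equiv.Perm (Fin j)) := by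
    intro j
    refine Finite.of_injective (fun f : G →* Equiv.Perm (Fin j) => fun s : S => f s) ?_
    intro f g hfg
    refine MonoidHom.eq_of_eqOn_dense hS fun s hs => ?_
    exact congrFun hfg ⟨s, hs⟩
  refine ⟨⨅ x : (j : Fin (B + 1)) × (G →* Equiv.Perm (Fin j)), x.2.ker, ?_, ?_⟩
  · exact Subgroup.finiteIndex_iInf fun x => inferInstance
  · intro K hK hKB
    have : K.FiniteIndex := ⟨hK⟩
    have : Finite (G ⧸ K) := Subgroup.finite_quotient_of_finiteIndex
    let e : (G ⧸ K) ≃ Fin K.index := Finite.equivFin _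
    let f : G →* Equiv.Perm (Fin K.index) := (e.permCongrHom : _ →* _).comp (MulAction.toPermHom G (G ⧸ K))
    refine (iInf_le _ ⟨⟨K.index, by omega⟩, f⟩).trans ?_
    intro g hg
    have h1 : f g = 1 := hg
    have h2 : MulAction.toPermHom G (G ⧸ K) g = 1 := e.permCongrHom.injective (by rw [map_one]; exact h1)
    have h3 := congrArg (fun σ : Equiv.Perm (G ⧸ K) => σ ((1 : G) : G ⧸ K)) h2
    simp only [MulAction.toPermHom_apply, MulAction.toPerm_apply, Equiv.Perm.one_apply] at h3
    have h4 : ((g : G) : G ⧸ K) = ((1 : G) : G ⧸ K) := by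
      rw [← h3]; simp
    simpa using QuotientGroup.eq.1 h4.symm

lemma frob_fix {K : Type*} [Field K] (p : ℕ) [hp : Fact p.Prime] [CharP K p] (D : ℕ) (y : K) (W : ℤ[X])
    (hD : W.natDegree ≤ D) (hl : ¬ (p : ℤ) ∣ W.leadingCoeff) (hy : aeval y W = 0) : y ^ p ^ D.factorial = y := by
  let _ := ZMod.algebra K p
  set W' := W.map (Int.castRingHom (ZMod p)) with hW'
  have hW0 : W' ≠ 0 := by
    intro h
    have := congrArg (fun q => coeff q W.natDegree) h
    simp only [hW', coeff_map, coeff_zero, eq_intCast] at this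
    exact hl ((ZMod.intCast_zmod_eq_zero_iff_dvd _ p).1 this)
  have hy' : aeval y W' = 0 := by
    rw [hW', aeval_def, eval₂_map]
    rw [aeval_def] at hy
    rw [← hy]
    congr 1
    exact RingHom.ext_int _ _
  have hintg : IsIntegral (ZMod p) y := isAlgebraic_iff_isIntegral.1 ⟨W', hW0, hy'⟩
  have hfin := IntermediateField.adjoin.finiteDimensional hintg
  have hd := IntermediateField.adjoin.finrank hintg
  set d := Module.finrank (ZMod p) (IntermediateField.adjoin (ZMod p) {y}) with hdef
  have hdD : d ≤ D := by
    rw [hd]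
    exact (natDegree_le_of_dvd (minpoly.dvd _ _ hy') hW0).trans (natDegree_map_le.trans hD)
  have hd0 : 0 < d := Module.finrank_pos
  have : Finite (IntermediateField.adjoin (ZMod p) {y}) := Module.finite_of_finite (ZMod p)
  have hF : Fintype (IntermediateField.adjoin (ZMod p) {y}) := Fintype.ofFinite _
  have hcard := Module.card_eq_pow_finrank (K := ZMod p) (V := IntermediateField.adjoin (ZMod p) {y})
  rw [ZMod.card, ← hdef] at hcard
  have h1 := FiniteField.pow_card (⟨y, IntermediateField.mem_adjoin_simple_self _ y⟩ : IntermediateField.adjoin (ZMod p) {y})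
  have h2 : y ^ p ^ d = y := by
    rw [← hcard]
    exact congrArg Subtype.val h1
  obtain ⟨e, he⟩ := Nat.dvd_factorial hd0 hdD
  rw [he, pow_mul]
  clear he
  induction e with
  | zero => simp
  | succ e ih => rw [pow_succ, pow_mul, ih, h2]

/-- valuation ring of a nonarchimedean absolute value -/
def VR {p : ℕ} {v : AbsoluteValue QB ℝ} (hp : p.Prime) (hv : IsAt p v) : ValuationSubring QB where
  carrier := {x | v x ≤ 1}
  mul_mem' := fun {a b} ha hb => by
    change v (a * b) ≤ 1
    rw [map_mul]; exact mul_le_one₀ ha (v.nonneg _) hb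
  one_mem' := by simp
  add_mem' := fun {a b} ha hb => (hv.nonarch hp a b).trans (max_le ha hb)
  zero_mem' := by simp
  neg_mem' := fun {a} ha => by simpa using ha
  mem_or_inv_mem' := fun x => by
    rcases le_total (v x) 1 with h | h
    · exact Or.inl h
    · right
      change v x⁻¹ ≤ 1
      rw [map_inv₀]; exact inv_le_one_of_one_le₀ h

lemma mem_VR {p : ℕ} {v : AbsoluteValue QB ℝ} (hp : p.Prime) (hv : IsAt p v) (x : QB) : x ∈ VR hp hv ↔ v x ≤ 1 := Iff.rfl

lemma IsAt.intCast_eq {p : ℕ} {v : AbsoluteValue QB ℝ} (hp : p.Prime) (hv : IsAt p v) (c : ℤ) (hc : ¬ (p : ℤ) ∣ c) :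
    v (c : QB) = 1 := by
  have : Fact p.Prime := ⟨hp⟩
  have := hv c
  rw [map_intCast] at this
  rw [this, (padicNorm.int_eq_one_iff c).2 hc]
  simp

lemma IsAt.le_one_of_root {p : ℕ} {v : AbsoluteValue QB ℝ} (hp : p.Prime) (hv : IsAt p v) (W : ℤ[X]) (x : QB)
    (hl : ¬ (p : ℤ) ∣ W.leadingCoeff) (hx : aeval x W = 0) : v x ≤ 1 := by
  have h1 : IsIntegral ℤ (W.leadingCoeff • x) := isIntegral_leadingCoeff_smul W x hx
  have h2 : IsIntegral (VR hp hv) (W.leadingCoeff • x) := h1.tower_top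
  obtain ⟨y, hy⟩ := IsIntegrallyClosed.isIntegral_iff.1 h2
  have h3 : v (W.leadingCoeff • x) ≤ 1 := by
    rw [← hy]; exact y.2
  rwa [zsmul_eq_mul, map_mul, hv.intCast_eq hp _ hl, one_mul] at h3

lemma VR_res {p : ℕ} {v : AbsoluteValue QB ℝ} (hp : p.Prime) (hv : IsAt p v) (x : VR hp hv) :
    IsLocalRing.residue (VR hp hv) x = 0 ↔ v (x : QB) < 1 := by
  rw [IsLocalRing.residue_eq_zero_iff, IsLocalRing.mem_maximalIdeal, mem_nonunits_iff, ← not_le, not_iff_not]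
  constructor
  · rintro ⟨u, rfl⟩
    have h1 : v ((u : VR hp hv) : QB) * v ((u⁻¹.1 : VR hp hv) : QB) = 1 := by
      rw [← map_mul, ← map_one v]
      congr 1
      exact congrArg Subtype.val u.mul_inv
    have h2 : v ((u⁻¹.1 : VR hp hv) : QB) ≤ 1 := u⁻¹.1.2
    nlinarith [v.nonneg ((u : VR hp hv) : QB)]
  · intro h
    have h0 : (x : QB) ≠ 0 := by
      intro h0; rw [h0, map_zero] at h; linarith
    refine IsUnit.of_mul_eq_one ⟨(x : QB)⁻¹, ?_⟩ ?_
    · rw [mem_VR, map_inv₀]; exact inv_le_one_of_one_le₀ h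
    · exact Subtype.ext (mul_inv_cancel₀ h0)

lemma VR_charP {p : ℕ} {v : AbsoluteValue QB ℝ} (hp : p.Prime) (hv : IsAt p v) :
    CharP (IsLocalRing.ResidueField (VR hp hv)) p := by
  have : Fact p.Prime := ⟨hp⟩
  refine ⟨fun x => ?_⟩
  have h1 : ((x : ℕ) : IsLocalRing.ResidueField (VR hp hv)) = IsLocalRing.residue (VR hp hv) ((x : ℕ) : VR hp hv) := by
    rw [map_natCast]
  rw [h1, VR_res]
  have h2 := hv x
  rw [map_natCast] at h2
  have h3 : (((x : ℕ) : VR hp hv) : QB) = ((x : ℕ) : QB) := rfl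
  rw [h3, h2, ← padicNorm.nat_lt_one_iff (p := p)]
  exact_mod_cast Iff.rfl

lemma residue_index {G : Type*} [Group G] {n p : ℕ} {v : AbsoluteValue QB ℝ} (hp : p.Prime) (hv : IsAt p v)
    (τ : G →* Matrix (Fin n) (Fin n) QB) (S : Set G) (hS : Subgroup.closure S = ⊤) (D : ℕ)
    (hW : ∀ s ∈ S, ∀ i j, ∃ W : ℤ[X], W.natDegree ≤ D ∧ ¬ (p : ℤ) ∣ W.leadingCoeff ∧ aeval (τ s i j) W = 0)
    (hintg : ∀ g i j, v (τ g i j) ≤ 1) :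
    ∃ K : Subgroup G, K.index ≠ 0 ∧ K.index ≤ (p ^ D.factorial) ^ (n * n) ∧ ∀ g ∈ K, ∀ i j, v ((τ g - 1) i j) < 1 := by
  classical
  have : Fact p.Prime := ⟨hp⟩
  have hch := VR_charP hp hv
  let M : G →* Matrix (Fin n) (Fin n) (VR hp hv) :=
    { toFun := fun g => Matrix.of fun i j => ⟨τ g i j, hintg g i j⟩
      map_one' := by
        ext i j
        simp only [map_one, Matrix.of_apply, Matrix.one_apply]
        split_ifs <;> rfl
      map_mul' := fun a b => by
        ext i j
        simp [Matrix.mul_apply] }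
  let r : G →* Matrix (Fin n) (Fin n) (IsLocalRing.ResidueField (VR hp hv)) :=
    ((IsLocalRing.residue (VR hp hv)).mapMatrix (m := Fin n)).toMonoidHom.comp M
  have hr : ∀ g i j, r g i j = IsLocalRing.residue (VR hp hv) ⟨τ g i j, hintg g i j⟩ := fun g i j => rfl
  set q := p ^ D.factorial with hq
  have hq1 : 1 < q := Nat.one_lt_pow (Nat.factorial_ne_zero _) hp.one_lt
  have hfix : ∀ g i j, r g i j ^ q = r g i j := by
    have h1 : (((iterateFrobenius (IsLocalRing.ResidueField (VR hp hv)) p D.factorial).mapMatrix (m := Fin n)).toMonoidHom.comp r) = r := by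
      refine MonoidHom.eq_of_eqOn_dense hS fun s hs => ?_
      ext i j
      obtain ⟨W, hWD, hWl, hW0⟩ := hW s hs i j
      change iterateFrobenius _ p D.factorial (r s i j) = r s i j
      rw [iterateFrobenius_def]
      refine frob_fix p D _ W hWD hWl ?_
      have h2 : aeval (⟨τ s i j, hintg s i j⟩ : VR hp hv) W = 0 := by
        apply Subtype.ext
        have := Polynomial.aeval_algebraMap_apply QB (⟨τ s i j, hintg s i j⟩ : VR hp hv) W
        exact this.symm.trans hW0
      rw [hr]
      have h3 := Polynomial.hom_eval₂ W (algebraMap ℤ (VR hp hv)) (IsLocalRing.residue (VR hp hv)) ⟨τ s i j, hintg s i j⟩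
      rw [aeval_def] at h2 ⊢
      rw [h2, map_zero] at h3
      rw [h3]
      congr 1
    intro g i j
    have h2 := congrArg (fun f => f g i j) h1
    change iterateFrobenius _ p D.factorial (r g i j) = r g i j at h2
    rwa [iterateFrobenius_def] at h2
  let Fx : Finset (IsLocalRing.ResidueField (VR hp hv)) :=
    (X ^ q - X : (IsLocalRing.ResidueField (VR hp hv))[X]).roots.toFinset
  have hne : (X ^ q - X : (IsLocalRing.ResidueField (VR hp hv))[X]) ≠ 0 := FiniteField.X_pow_card_sub_X_ne_zero _ hq1
  have hFx : ∀ y, y ^ q = y → y ∈ Fx := by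
    intro y hy
    rw [Multiset.mem_toFinset, mem_roots hne]
    simp [hy]
  have hFc : Fx.card ≤ q := by
    refine (Multiset.toFinset_card_le _).trans ((card_roots' _).trans ?_)
    rw [FiniteField.X_pow_card_sub_X_natDegree_eq _ hq1]
  let ι : r.toHomUnits.range → (Fin n × Fin n → Fx) := fun u k =>
    ⟨(u.1 : Matrix (Fin n) (Fin n) _) k.1 k.2, by
      obtain ⟨g, hg⟩ := u.2
      rw [← hg]
      exact hFx _ (hfix g _ _)⟩
  have hι : Function.Injective ι := by
    intro u w h
    apply Subtype.ext
    apply Units.ext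
    ext i j
    exact congrArg Subtype.val (congrFun h (i, j))
  have hfin : Finite r.toHomUnits.range := Finite.of_injective ι hι
  refine ⟨r.toHomUnits.ker, ?_, ?_, ?_⟩
  · rw [Subgroup.index_ker]
    exact Nat.card_pos.ne'
  · rw [Subgroup.index_ker]
    refine (Nat.card_le_card_of_injective ι hι).trans ?_
    rw [Nat.card_fun]
    simp only [Nat.card_eq_fintype_card, Fintype.card_prod, Fintype.card_fin, Fintype.card_coe]
    exact Nat.pow_le_pow_left hFc _
  · intro g hg i j
    have h1 : r g = 1 := congrArg Units.val (MonoidHom.mem_ker.1 hg)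
    have h2 : IsLocalRing.residue (VR hp hv) ((M g - 1) i j) = 0 := by
      rw [Matrix.sub_apply, map_sub]
      have h3 : IsLocalRing.residue (VR hp hv) (M g i j) = r g i j := rfl
      rw [h3, h1, Matrix.one_apply, Matrix.one_apply]
      split_ifs <;> simp
    rw [VR_res] at h2
    convert h2 using 2
    simp only [Matrix.sub_apply, Matrix.one_apply]
    split_ifs <;> rfl

end UG

namespace UG
open Filter Polynomial
set_option autoImplicit false
set_option linter.unusedVariables false
set_option linter.unusedSectionVars false
lemma tf_aux {p : ℕ} {v : AbsoluteValue QB ℝ} (hp : p.Prime) (hv : IsAt p v) (l : ℕ) (hl : l.Prime) (hlp : l ≠ p)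
    (w : QB) (hw : v (w - 1) < 1) (hwl : w ^ l = 1) : w = 1 := by
  have hch := VR_charP hp hv
  have hw1 : v w ≤ 1 := by
    have := hv.nonarch hp (w - 1) 1
    rw [sub_add_cancel] at this
    refine this.trans (max_le hw.le (by simp))
  let W : VR hp hv := ⟨w, hw1⟩
  have hWl : W ^ l = 1 := Subtype.ext hwl
  have hres : IsLocalRing.residue (VR hp hv) W = 1 := by
    have : IsLocalRing.residue (VR hp hv) (W - 1) = 0 := (VR_res hp hv _).2 hw
    rwa [map_sub, map_one, sub_eq_zero] at this
  have h1 := geom_sum_mul W l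
  rw [hWl, sub_self, mul_eq_zero] at h1
  rcases h1 with h1 | h1
  · exfalso
    have h2 := congrArg (IsLocalRing.residue (VR hp hv)) h1
    rw [map_sum, map_zero] at h2
    simp only [map_pow, hres, one_pow, Finset.sum_const, Finset.card_range, nsmul_eq_mul, mul_one] at h2
    have h3 := (CharP.cast_eq_zero_iff (IsLocalRing.ResidueField (VR hp hv)) p l).1 h2
    exact hlp ((Nat.prime_dvd_prime_iff_eq hp hl).1 h3).symm
  · rw [sub_eq_zero] at h1
    exact congrArg Subtype.val h1

/-- the group of units outside `T` congruent to one at two places -/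
def UU (T : Finset ℕ) {p q : ℕ} (hp : p.Prime) (hq : q.Prime) (hpT : p ∉ T) (hqT : q ∉ T) {v w : AbsoluteValue QB ℝ}
    (hv : IsAt p v) (hw : IsAt q w) : Subgroup QBˣ where
  carrier := {u | (∀ l : ℕ, l.Prime → l ∉ T → ∀ v', IsAt l v' → v' (u : QB) = 1) ∧ v (u - 1) < 1 ∧ w (u - 1) < 1}
  one_mem' := by simp
  mul_mem' := fun {a b} ha hb => by
    refine ⟨fun l hl hlT v' hv' => ?_, ?_, ?_⟩
    · rw [Units.val_mul, map_mul, ha.1 l hl hlT v' hv', hb.1 l hl hlT v' hv', one_mul]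
    · have h1 : ((a * b : QBˣ) : QB) - 1 = (a - 1) * b + (b - 1) := by push_cast; ring
      rw [h1]
      refine (hv.nonarch hp _ _).trans_lt (max_lt ?_ hb.2.1)
      rw [map_mul, hb.1 p hp hpT v hv, mul_one]; exact ha.2.1
    · have h1 : ((a * b : QBˣ) : QB) - 1 = (a - 1) * b + (b - 1) := by push_cast; ring
      rw [h1]
      refine (hw.nonarch hq _ _).trans_lt (max_lt ?_ hb.2.2)
      rw [map_mul, hb.1 q hq hqT w hw, mul_one]; exact ha.2.2
  inv_mem' := fun {a} ha => by
    have h1 : ((a⁻¹ : QBˣ) : QB) - 1 = - ((a - 1) * (a : QB)⁻¹) := by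
      rw [Units.val_inv_eq_inv_val]
      field_simp
      ring
    refine ⟨fun l hl hlT v' hv' => ?_, ?_, ?_⟩
    · rw [Units.val_inv_eq_inv_val, map_inv₀, ha.1 l hl hlT v' hv', inv_one]
    · rw [h1, AbsoluteValue.map_neg, map_mul, map_inv₀, ha.1 p hp hpT v hv, inv_one, mul_one]; exact ha.2.1
    · rw [h1, AbsoluteValue.map_neg, map_mul, map_inv₀, ha.1 q hq hqT w hw, inv_one, mul_one]; exact ha.2.2

lemma UU_UT (T : Finset ℕ) {p q : ℕ} (hp : p.Prime) (hq : q.Prime) (hpq : p ≠ q) (hpT : p ∉ T) (hqT : q ∉ T)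
    {v w : AbsoluteValue QB ℝ} (hv : IsAt p v) (hw : IsAt q w) : UT (UU T hp hq hpT hqT hv hw) T where
  out := fun u hu l hl hlT v' hv' => (hu.1 l hl hlT v' hv').le
  tf := fun u hu k hk huk => by
    by_contra hne
    have hord : 0 < orderOf u := orderOf_pos_iff.2 (isOfFinOrder_iff_pow_eq_one.2 ⟨k, hk, huk⟩)
    have hord1 : orderOf u ≠ 1 := fun h => hne (orderOf_eq_one_iff.1 h)
    set l := (orderOf u).minFac with hl
    have hlp : l.Prime := Nat.minFac_prime hord1
    obtain ⟨e, he⟩ := Nat.minFac_dvd (orderOf u)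
    rw [← hl] at he
    have he0 : e ≠ 0 := by rintro rfl; omega
    have hx : (u ^ e) ^ l = 1 := by rw [← pow_mul, mul_comm, ← he, pow_orderOf_eq_one]
    have hx' : ((u ^ e : QBˣ) : QB) ^ l = 1 := by rw [← Units.val_pow_eq_pow_val, hx]; rfl
    have hxU : u ^ e ∈ UU T hp hq hpT hqT hv hw := pow_mem hu e
    have hx1 : ((u ^ e : QBˣ) : QB) = 1 := by
      by_cases h : l = p
      · exact tf_aux hq hw l hlp (fun h' => hpq (h.symm.trans h')) _ hxU.2.2 hx'
      · exact tf_aux hp hv l hlp h _ hxU.2.1 hx'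
    have hx2 : u ^ e = 1 := Units.ext hx1
    have h3 := Nat.le_of_dvd (Nat.pos_of_ne_zero he0) (orderOf_dvd_of_pow_eq_one hx2)
    have := hlp.two_le
    nlinarith [Nat.pos_of_ne_zero he0]

lemma sum_le_term {p : ℕ} {v : AbsoluteValue QB ℝ} (hp : p.Prime) (hv : IsAt p v) {ι : Type*} (s : Finset ι) (hs : s.Nonempty)
    (f : ι → QB) : ∃ j ∈ s, v (∑ i ∈ s, f i) ≤ v (f j) := by
  classical
  induction hs using Finset.Nonempty.cons_induction with
  | singleton a => exact ⟨a, by simp, by simp⟩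
  | cons a s ha hs ih =>
    obtain ⟨j, hj, hle⟩ := ih
    rw [Finset.sum_cons]
    rcases le_max_iff.1 (hv.nonarch hp (f a) (∑ i ∈ s, f i)) with h | h
    · exact ⟨a, by simp, h⟩
    · exact ⟨j, by simp [hj], h.trans hle⟩

lemma eig_le {p n : ℕ} {v : AbsoluteValue QB ℝ} (hp : p.Prime) (hv : IsAt p v) (A : Matrix (Fin n) (Fin n) QB)
    (x : Fin n → QB) (hx : x ≠ 0) (μ : QB) (h : A.mulVec x = μ • x) : ∃ i j, v μ ≤ v (A i j) := by
  obtain ⟨k, hk⟩ := Function.ne_iff.1 hx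
  obtain ⟨i, -, hi⟩ := Finset.exists_max_image Finset.univ (fun i => v (x i)) ⟨k, Finset.mem_univ k⟩
  have hi0 : 0 < v (x i) := (v.pos hk).trans_le (hi k (Finset.mem_univ k))
  have h1 := congrFun h i
  rw [Matrix.mulVec, dotProduct, Pi.smul_apply, smul_eq_mul] at h1
  obtain ⟨j, -, hj⟩ := sum_le_term hp hv Finset.univ ⟨k, Finset.mem_univ k⟩ (fun j => A i j * x j)
  refine ⟨i, j, ?_⟩
  rw [h1, map_mul, map_mul] at hj
  have h2 := mul_le_mul_of_nonneg_left (hi j (Finset.mem_univ j)) (v.nonneg (A i j))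
  exact le_of_mul_le_mul_right (hj.trans h2) hi0

lemma eig_unit {p n : ℕ} {v : AbsoluteValue QB ℝ} (hp : p.Prime) (hv : IsAt p v) (A B : Matrix (Fin n) (Fin n) QB)
    (hBA : B * A = 1) (hA : ∀ i j, v (A i j) ≤ 1) (hB : ∀ i j, v (B i j) ≤ 1)
    (x : Fin n → QB) (hx : x ≠ 0) (μ : QB) (h : A.mulVec x = μ • x) : v μ = 1 := by
  obtain ⟨i, j, hij⟩ := eig_le hp hv A x hx μ h
  refine le_antisymm (hij.trans (hA i j)) ?_
  have h1 : x = μ • B.mulVec x := by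
    rw [← Matrix.mulVec_smul, ← h, Matrix.mulVec_mulVec, hBA, Matrix.one_mulVec]
  have h0 : μ ≠ 0 := by
    rintro rfl
    rw [zero_smul] at h1
    exact hx h1
  have h2 : B.mulVec x = μ⁻¹ • x := by
    conv_rhs => rw [h1]
    rw [smul_smul, inv_mul_cancel₀ h0, one_smul]
  obtain ⟨i, j, hij⟩ := eig_le hp hv B x hx _ h2
  have h3 := hij.trans (hB i j)
  rw [map_inv₀] at h3
  exact (inv_le_one₀ (v.pos h0)).1 h3

lemma eig_cong {p n : ℕ} {v : AbsoluteValue QB ℝ} (hp : p.Prime) (hv : IsAt p v) (A : Matrix (Fin n) (Fin n) QB)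
    (hA : ∀ i j, v ((A - 1) i j) < 1)
    (x : Fin n → QB) (hx : x ≠ 0) (μ : QB) (h : A.mulVec x = μ • x) : v (μ - 1) < 1 := by
  obtain ⟨i, j, hij⟩ := eig_le hp hv (A - 1) x hx (μ - 1) (by
    rw [Matrix.sub_mulVec, h, Matrix.one_mulVec, sub_smul, one_smul])
  exact hij.trans_lt (hA i j)

end UG

namespace UG
open Filter Polynomial
set_option autoImplicit false
set_option linter.unusedVariables false
set_option linter.unusedSectionVars false
lemma entries_mem {G : Type*} [Group G] {L : Type*} [CommRing L] {n : ℕ} (R : Subring L)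
    (τ : G →* Matrix (Fin n) (Fin n) L) (S : Set G) (hS : Subgroup.closure S = ⊤) (hinv : ∀ s ∈ S, s⁻¹ ∈ S)
    (hmem : ∀ s ∈ S, ∀ i j, τ s i j ∈ R) (g : G) : ∀ i j, τ g i j ∈ R := by
  have hg : g ∈ Submonoid.closure S := by
    have h1 : g ∈ (Subgroup.closure S).toSubmonoid := by rw [hS]; trivial
    rw [Subgroup.closure_toSubmonoid] at h1
    have h2 : S ∪ S⁻¹ = S := Set.union_eq_left.2 fun s hs => by
      have := hinv _ hs
      rwa [inv_inv] at this
    rwa [h2] at h1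
  induction hg using Submonoid.closure_induction with
  | mem x hx => exact hmem x hx
  | one =>
    intro i j
    rw [map_one, Matrix.one_apply]
    split_ifs
    · exact R.one_mem
    · exact R.zero_mem
  | mul x y _ _ hx hy =>
    intro i j
    rw [map_mul, Matrix.mul_apply]
    exact R.sum_mem fun k _ => R.mul_mem (hx i k) (hy k j)

lemma exists_lcs {G : Type*} [Group G] {n : ℕ} (ρ : G →* GL (Fin n) ℂ)
    (h : ¬ ∃ H : Subgroup ρ.range, H.FiniteIndex ∧ Group.IsNilpotent H) (G0 : Subgroup G) [hG0 : G0.FiniteIndex] (m : ℕ) :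
    ∃ a ∈ (⊤ : Subgroup G0).lowerCentralSeries m, ρ a ≠ 1 := by
  by_contra hno
  push Not at hno
  apply h
  have hsurj : Function.Surjective ρ.rangeRestrict := ρ.rangeRestrict_surjective
  refine ⟨G0.map ρ.rangeRestrict, ⟨fun h0 => ?_⟩, ?_⟩
  · have := G0.index_map_dvd hsurj
    rw [h0, zero_dvd_iff] at this
    exact hG0.index_ne_zero this
  · refine Subgroup.nilpotent_iff_lowerCentralSeries.2 ⟨m, ?_⟩
    have h1 := Subgroup.map_lowerCentralSeries (S := (⊤ : Subgroup G0)) (ρ.rangeRestrict.subgroupMap G0) m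
    rw [Subgroup.map_top_of_surjective _ (ρ.rangeRestrict.subgroupMap_surjective G0)] at h1
    rw [← h1, eq_bot_iff]
    rintro _ ⟨a, ha, rfl⟩
    have h2 := hno a ha
    exact Subtype.ext (Subtype.ext h2)

theorem main {G : Type*} [Group G] (hG : Group.FG G)
    (n : ℕ) (ρ : G →* GL (Fin n) ℂ)
    (h : ¬ ∃ H : Subgroup ρ.range, H.FiniteIndex ∧ Group.IsNilpotent H) : UFS G := by
  classical
  obtain ⟨S0, hS0⟩ := Group.fg_def.1 hG
  let S : Finset G := S0 ∪ S0.image (fun x => x⁻¹)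
  have hS : Subgroup.closure (S : Set G) = ⊤ := by
    rw [eq_top_iff, ← hS0]
    exact Subgroup.closure_mono (by simp [S])
  have hSinv : ∀ s ∈ (S : Set G), s⁻¹ ∈ (S : Set G) := by
    intro s hs
    simp only [S, Finset.coe_union, Finset.coe_image, Set.mem_union, Set.mem_image, Finset.mem_coe] at hs ⊢
    rcases hs with hs | ⟨x, hx, rfl⟩
    · exact Or.inr ⟨s, hs, rfl⟩
    · left; rwa [inv_inv]
  let ρ' : G →* Matrix (Fin n) (Fin n) ℂ := (Units.coeHom _).comp ρ
  let E : Set ℂ := Set.range (fun k : S × Fin n × Fin n => ρ' k.1 k.2.1 k.2.2)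
  have hE : E.Finite := Set.finite_range _
  let A : Subalgebra ℚ ℂ := Algebra.adjoin ℚ E
  have hAft : Algebra.FiniteType ℚ A := by
    rw [← Subalgebra.fg_iff_finiteType]
    exact ⟨hE.toFinset, by rw [hE.coe_toFinset]⟩
  have hent : ∀ g i j, ρ' g i j ∈ A := by
    intro g
    refine entries_mem A.toSubring ρ' S hS hSinv ?_ g
    intro s hs i j
    exact Algebra.subset_adjoin ⟨(⟨s, hs⟩, i, j), rfl⟩
  let ρA : G →* Matrix (Fin n) (Fin n) A :=
    { toFun := fun g => Matrix.of fun i j => ⟨ρ' g i j, hent g i j⟩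
      map_one' := by
        ext i j
        simp only [map_one, Matrix.of_apply, Matrix.one_apply]
        split_ifs <;> rfl
      map_mul' := fun a b => by
        ext i j
        simp [Matrix.mul_apply] }
  obtain ⟨s, g, hinj, hintg⟩ := exists_integral_inj_algHom_of_fg ℚ A
  choose c hc D hD using fun k : S × Fin n × Fin n => spec_int g hintg (ρA k.1 k.2.1 k.2.2)
  let C : ℤ := ∏ k, c k
  have hC : C ≠ 0 := Finset.prod_ne_zero_iff.2 fun k _ => hc k
  let DD : ℕ := Finset.univ.sup D
  let T : Finset ℕ := C.natAbs.primeFactors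
  have hT : ∀ l : ℕ, l.Prime → l ∉ T → ¬ (l : ℤ) ∣ C := by
    intro l hl hlT hd
    apply hlT
    exact Nat.mem_primeFactors.2 ⟨hl, Int.natCast_dvd.1 hd, Int.natAbs_ne_zero.2 hC⟩
  have hTl : ∀ l : ℕ, C.natAbs < l → l ∉ T := by
    intro l hl hlT
    exact absurd (Nat.le_of_mem_primeFactors hlT) (by omega)
  obtain ⟨p, hpC, hp⟩ := Nat.exists_infinite_primes (C.natAbs + 1)
  obtain ⟨q, hqp, hq⟩ := Nat.exists_infinite_primes (p + 1)
  have hpT : p ∉ T := hTl p (by omega)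
  have hqT : q ∉ T := hTl q (by omega)
  have hpq : p ≠ q := by omega
  obtain ⟨v, hv⟩ := exists_isAt p hp
  obtain ⟨w, hw⟩ := exists_isAt q hq
  obtain ⟨G0, hG0, hK⟩ := exists_G0 (G := G) (max ((p ^ DD.factorial) ^ (n * n)) ((q ^ DD.factorial) ^ (n * n)))
  obtain ⟨a0, ha0, hne⟩ := exists_lcs ρ h G0 (n + 1)
  have hneA : ∃ i j, (ρA a0 - 1) i j ≠ 0 := by
    by_contra hcon
    push Not at hcon
    apply hne
    apply Units.ext
    ext i j
    have h1 : ρA a0 = 1 := sub_eq_zero.1 (Matrix.ext hcon)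
    have h2 := congrArg (fun M => ((M i j : A) : ℂ)) h1
    refine h2.trans ?_
    simp only [Matrix.one_apply, Units.val_one]
    split_ifs <;> rfl
  obtain ⟨i0, j0, hf⟩ := hneA
  obtain ⟨a, ha⟩ := exists_avoid g hinj hintg _ hf
  obtain ⟨φ, hφ⟩ := exists_spec g hinj hintg a
  have hφf := ha φ hφ
  let τ : G →* Matrix (Fin n) (Fin n) QB := ((φ : A →+* QB).mapMatrix (m := Fin n)).toMonoidHom.comp ρA
  have hτ : ∀ x i j, τ x i j = φ (ρA x i j) := fun x i j => rfl
  have hW : ∀ l : ℕ, l.Prime → l ∉ T → ∀ s ∈ (S : Set G), ∀ i j,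
      ∃ W : ℤ[X], W.natDegree ≤ DD ∧ ¬ (l : ℤ) ∣ W.leadingCoeff ∧ aeval (τ s i j) W = 0 := by
    intro l hl hlT s hs i j
    obtain ⟨W, h1, h2, h3⟩ := hD (⟨s, hs⟩, i, j) a φ hφ
    refine ⟨W, h1.trans (Finset.le_sup (f := D) (Finset.mem_univ _)), ?_, h3⟩
    rw [h2]
    intro hd
    exact hT l hl hlT (hd.trans (Finset.dvd_prod_of_mem c (Finset.mem_univ _)))
  have hτi : ∀ l : ℕ, l.Prime → l ∉ T → ∀ v', IsAt l v' → ∀ x i j, v' (τ x i j) ≤ 1 := by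
    intro l hl hlT v' hv' x
    refine entries_mem (VR hl hv').toSubring τ S hS hSinv ?_ x
    intro s hs i j
    obtain ⟨W, h1, h2, h3⟩ := hW l hl hlT s hs i j
    exact hv'.le_one_of_root hl W _ h2 h3
  obtain ⟨Kp, hKp0, hKpB, hKp⟩ := residue_index hp hv τ S hS DD (hW p hp hpT) (hτi p hp hpT v hv)
  obtain ⟨Kq, hKq0, hKqB, hKq⟩ := residue_index hq hw τ S hS DD (hW q hq hqT) (hτi q hq hqT w hw)
  have hGp := hK Kp hKp0 (hKpB.trans (le_max_left _ _))
  have hGq := hK Kq hKq0 (hKqB.trans (le_max_right _ _))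
  refine UFS.of_finiteIndex G0 ?_
  let σ : G0 →* Module.End QB (Fin n → QB) :=
    (Matrix.toLinAlgEquiv' : Matrix (Fin n) (Fin n) QB ≃ₐ[QB] _).toAlgHom.toRingHom.toMonoidHom.comp (τ.comp G0.subtype)
  have hσ : ∀ (x : G0) y, σ x y = (τ x).mulVec y := fun x y => rfl
  refine dichotomy (UU_UT T hp hq hpq hpT hqT hv hw) σ ?_ ⟨a0, ?_, ?_⟩
  · intro x μ hμ
    obtain ⟨y, hy⟩ := hμ.exists_hasEigenvector
    have hy0 := hy.2
    have hy1 : (τ x).mulVec y = μ • y := by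
      rw [← hσ]; exact hy.apply_eq_smul
    have hun : ∀ l : ℕ, l.Prime → l ∉ T → ∀ v', IsAt l v' → v' μ = 1 := fun l hl hlT v' hv' =>
      eig_unit hl hv' (τ x) (τ (x : G)⁻¹) (by rw [← map_mul, inv_mul_cancel, map_one])
        (hτi l hl hlT v' hv' _) (hτi l hl hlT v' hv' _) y hy0 μ hy1
    have hμ0 : μ ≠ 0 := by
      rintro rfl
      have := hun p hp hpT v hv
      simp at this
    refine ⟨Units.mk0 μ hμ0, ⟨hun, ?_, ?_⟩, rfl⟩
    · exact eig_cong hp hv (τ x) (hKp x (hGp x.2)) y hy0 μ hy1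
    · exact eig_cong hq hw (τ x) (hKq x (hGq x.2)) y hy0 μ hy1
  · rwa [Module.finrank_fin_fun]
  · intro h1
    have h2 : τ a0 = 1 := by
      apply (Matrix.toLinAlgEquiv' : Matrix (Fin n) (Fin n) QB ≃ₐ[QB] _).injective
      rw [map_one]
      exact h1
    apply hφf
    rw [Matrix.sub_apply, map_sub, ← hτ, h2, Matrix.one_apply, Matrix.one_apply]
    split_ifs <;> simp

end UG

/-- a finitely generated group with a linear representation over `ℂ`
whose image is not virtually nilpotent has uniformly exponential growth. -/
theorem uniform_growth_of_linear_rep {G : Type*} [Group G] (hG : Group.FG G)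
    (n : ℕ) (hn : 2 ≤ n) (ρ : G →* GL (Fin n) ℂ)
    (h : ¬ ∃ H : Subgroup ρ.range, H.FiniteIndex ∧ Group.IsNilpotent H) :
    1 < minGrowth G := by
  obtain ⟨m, hm⟩ := UG.main hG n ρ h
  exact UG.growth_criterion hG m hm
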